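/- For a ∈ (0,a*) let u_a be a minimizer of e(a) with Lagrange multiplier μ_a, and set ε_a = (∫_{ℝ²}|∇|u_a||² dx)^{−1/2}. Then ε_a → 0 and μ_a ε_a² → −1/a* as a ↗ a*. -/

import Mathlib

open MeasureTheory Filter Topology Set Metric

noncomputable section

/-- The plane `ℝ²` with the Euclidean norm. -/
abbrev Plane : Type := EuclideanSpace ℝ (Fin 2)

def e0 : Plane := EuclideanSpace.single (0 : Fin 2) (1 : ℝ)
def e1 : Plane := EuclideanSpace.single (1 : Fin 2) (1 : ℝ)

/-- Partial derivatives of a complex-valued function. -/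
def d0 (u : Plane → ℂ) (x : Plane) : ℂ := fderiv ℝ u x e0
def d1 (u : Plane → ℂ) (x : Plane) : ℂ := fderiv ℝ u x e1

/-- `|∇u|²` for complex-valued `u`. -/
def gradSq (u : Plane → ℂ) (x : Plane) : ℝ := ‖d0 u x‖ ^ 2 + ‖d1 u x‖ ^ 2

/-- `|∇|u||²`. -/
def gradAbsSq (u : Plane → ℂ) (x : Plane) : ℝ := ‖fderiv ℝ (fun y => ‖u y‖) x‖ ^ 2

/-- Membership in `H¹(ℝ², ℂ)` (smooth-representative formulation). -/
def InH1 (u : Plane → ℂ) : Prop :=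
  Differentiable ℝ u ∧ Integrable (fun x => ‖u x‖ ^ 2) ∧ Integrable (gradSq u)

/-- Membership in the space `𝓗 = {u ∈ H¹ : ∫ V |u|² < ∞}`. -/
def InH (V : Plane → ℝ) (u : Plane → ℂ) : Prop :=
  InH1 u ∧ Integrable (fun x => V x * ‖u x‖ ^ 2)

/-- The constraint set `S_a`. -/
def Sset (V : Plane → ℝ) (a : ℝ) : Set (Plane → ℂ) :=
  {u | InH V u ∧ (∫ x : Plane, ‖u x‖ ^ 2) = a}

/-- The momentum density `x^⊥ · (iu, ∇u)`, with `x^⊥ = (-x₂, x₁)` and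
`(iu,∇u)_j = Im(ū ∂_j u)`. -/
def momentum (u : Plane → ℂ) (x : Plane) : ℝ :=
  (-(x 1)) * ((starRingEnd ℂ) (u x) * d0 u x).im + (x 0) * ((starRingEnd ℂ) (u x) * d1 u x).im

/-- The logarithmic convolution term `∫∫ ln|x-y| |u(x)|²|u(y)|²`. -/
def logConv (u : Plane → ℂ) : ℝ :=
  ∫ x : Plane, ∫ y : Plane, Real.log ‖x - y‖ * ‖u x‖ ^ 2 * ‖u y‖ ^ 2

/-- The energy functional `E_a`. -/
def Ea (V : Plane → ℝ) (Ω : ℝ) (u : Plane → ℂ) : ℝ :=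
  (∫ x : Plane, (gradSq u x + V x * ‖u x‖ ^ 2)) + (1 / 2) * logConv u
    - (1 / 2) * (∫ x : Plane, ‖u x‖ ^ 4) - Ω * (∫ x : Plane, momentum u x)

/-- `u` is a minimizer of `e(a) = inf_{S_a} E_a`. -/
def IsMinimizer (V : Plane → ℝ) (Ω a : ℝ) (u : Plane → ℂ) : Prop :=
  u ∈ Sset V a ∧ ∀ v ∈ Sset V a, Ea V Ω u ≤ Ea V Ω v

/-- `e(a) = inf_{u ∈ S_a} E_a(u)`. -/
def eInf (V : Plane → ℝ) (Ω a : ℝ) : ℝ := sInf (Ea V Ω '' Sset V a)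

/-- `f(x) → ∞` as `|x| → ∞`. -/
def TendsInfty (f : Plane → ℝ) : Prop := ∀ M : ℝ, ∃ R : ℝ, ∀ x : Plane, R ≤ ‖x‖ → M ≤ f x

/-- Hypotheses (1.10): `0 ≤ V ∈ L^∞_loc` and `liminf_{|x|→∞} V(x)/|x|² > 0`. -/
def V110 (V : Plane → ℝ) : Prop :=
  Measurable V ∧ (∀ x, 0 ≤ V x) ∧
  (∀ R : ℝ, ∃ C : ℝ, ∀ x : Plane, ‖x‖ ≤ R → V x ≤ C) ∧
  (∃ c : ℝ, 0 < c ∧ ∃ R : ℝ, ∀ x : Plane, R ≤ ‖x‖ → c * ‖x‖ ^ 2 ≤ V x)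

/-- The set of rotational velocities `W > 0` with `V(x) - (W²/4)|x|² → ∞`;
`Ω* = sup RotSet V`. -/
def RotSet (V : Plane → ℝ) : Set ℝ :=
  {W : ℝ | 0 < W ∧ TendsInfty (fun x => V x - W ^ 2 / 4 * ‖x‖ ^ 2)}

/-- `Ω < Ω*` where `Ω* = sup RotSet V` (possibly `+∞`). -/
def SubCritical (V : Plane → ℝ) (Ω : ℝ) : Prop := ∃ W ∈ RotSet V, Ω < W

def d0R (q : Plane → ℝ) (x : Plane) : ℝ := fderiv ℝ q x e0
def d1R (q : Plane → ℝ) (x : Plane) : ℝ := fderiv ℝ q x e1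

/-- `|∇q|²` for real-valued `q`. -/
def gradSqR (q : Plane → ℝ) (x : Plane) : ℝ := (d0R q x) ^ 2 + (d1R q x) ^ 2

/-- The Laplacian of a real-valued function. -/
def lapR (q : Plane → ℝ) (x : Plane) : ℝ := fderiv ℝ (d0R q) x e0 + fderiv ℝ (d1R q) x e1

/-- `Q` is the positive radially symmetric `H¹` solution of `-ΔQ + Q - Q³ = 0` on `ℝ²`. -/
def IsGroundState (Q : Plane → ℝ) : Prop :=
  ContDiff ℝ 2 Q ∧ (∀ x, 0 < Q x) ∧ (∀ x y : Plane, ‖x‖ = ‖y‖ → Q x = Q y) ∧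
  Integrable (fun x => (Q x) ^ 2) ∧ Integrable (fun x => ‖fderiv ℝ Q x‖ ^ 2) ∧
  (∀ x, - lapR Q x + Q x - (Q x) ^ 3 = 0)

/-- The Laplacian of a complex-valued function. -/
def lapC (u : Plane → ℂ) (x : Plane) : ℂ := fderiv ℝ (d0 u) x e0 + fderiv ℝ (d1 u) x e1

/-- The Euler–Lagrange equation (1.18):
`-Δu + V u + (∫ ln|x-y||u(y)|² dy) u + iΩ (x^⊥·∇u) = μ u + |u|² u`. -/
def EulerLagrange (V : Plane → ℝ) (Ω : ℝ) (u : Plane → ℂ) (μ : ℝ) : Prop :=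
  ∀ x : Plane,
    - lapC u x + (V x : ℂ) * u x
      + (((∫ y : Plane, Real.log ‖x - y‖ * ‖u y‖ ^ 2) : ℝ) : ℂ) * u x
      + Complex.I * (Ω : ℂ) * (((-(x 1) : ℝ) : ℂ) * d0 u x + ((x 0 : ℝ) : ℂ) * d1 u x)
    = (μ : ℂ) * u x + ((‖u x‖ ^ 2 : ℝ) : ℂ) * u x

/-- Condition (V): `0 ≤ V_Ω ∈ C^α_loc`, `V_Ω` vanishes only at the origin, and `V` has at
most exponential growth. Here `V_Ω(x) = V(x) - (Ω²/4)|x|²`. -/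
def CondV (V : Plane → ℝ) (Ω α : ℝ) : Prop :=
  α ∈ Ioo (0 : ℝ) 1 ∧
  (∀ x : Plane, 0 ≤ V x - Ω ^ 2 / 4 * ‖x‖ ^ 2) ∧
  (∀ x : Plane, V x - Ω ^ 2 / 4 * ‖x‖ ^ 2 = 0 ↔ x = 0) ∧
  (∀ R : ℝ, 0 < R → ∃ C : ℝ, ∀ x ∈ closedBall (0 : Plane) R, ∀ y ∈ closedBall (0 : Plane) R,
    |(V x - Ω ^ 2 / 4 * ‖x‖ ^ 2) - (V y - Ω ^ 2 / 4 * ‖y‖ ^ 2)| ≤ C * ‖x - y‖ ^ α) ∧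
  (∃ C γ : ℝ, 0 < γ ∧ ∀ x : Plane, V x ≤ C * Real.exp (γ * ‖x‖))

/-- `ε_a = (∫ |∇|u_a||²)^{-1/2}` for a family of minimizers. -/
def epsOf (u : ℝ → Plane → ℂ) (a : ℝ) : ℝ :=
  (∫ x : Plane, gradAbsSq (u a) x) ^ (-(1 : ℝ) / 2)

/-- The rescaled family
`w_a(y) = ε_a u_a(ε_a y + x_a) e^{-i((ε_a Ω/2) y·x_a^⊥ - θ)}`. -/
def wfam (Ω : ℝ) (u : ℝ → Plane → ℂ) (xa : ℝ → Plane) (a θv : ℝ) (y : Plane) : ℂ :=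
  ((epsOf u a : ℝ) : ℂ) * u a ((epsOf u a) • y + xa a) *
    Complex.exp (-Complex.I *
      ((((epsOf u a * Ω / 2) * (-(y 0) * (xa a 1) + (y 1) * (xa a 0)) - θv) : ℝ) : ℂ))

/-- The limit profile `(1/√a*) Q(x/√a*)` where `a* = ‖Q‖₂²`. -/
def Qstar (Q : Plane → ℝ) (x : Plane) : ℝ :=
  (Real.sqrt (∫ y : Plane, (Q y) ^ 2))⁻¹ * Q ((Real.sqrt (∫ y : Plane, (Q y) ^ 2))⁻¹ • x)

theorem plane_norm_sq (x : Plane) : ‖x‖ ^ 2 = x 0 ^ 2 + x 1 ^ 2 := by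
  rw [EuclideanSpace.real_norm_sq_eq]; simp

@[simp] theorem norm_e0 : ‖e0‖ = 1 := by simp [e0]
@[simp] theorem norm_e1 : ‖e1‖ = 1 := by simp [e1]

theorem abs_coord_le (x : Plane) (i : Fin 2) : |x i| ≤ ‖x‖ := by
  simpa using EuclideanSpace.norm_eq x ▸ Real.abs_le_sqrt (by
    fin_cases i <;> simp <;> positivity)

theorem clm_norm_sq (L : Plane →L[ℝ] ℝ) : ‖L‖ ^ 2 = L e0 ^ 2 + L e1 ^ 2 := by
  obtain ⟨y, rfl⟩ := (InnerProductSpace.toDual ℝ Plane).surjective L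
  rw [LinearIsometryEquiv.norm_map, plane_norm_sq]
  simp [e0, e1, InnerProductSpace.toDual_apply_apply, EuclideanSpace.inner_single_right]

theorem fderiv_norm_eq_zero {u : Plane → ℂ} {x : Plane} (hx : u x = 0) :
    fderiv ℝ (fun y => ‖u y‖) x = 0 := by
  apply IsLocalMin.fderiv_eq_zero
  refine Filter.Eventually.of_forall fun y => ?_
  simp [hx]

theorem fderiv_norm_mul {u : Plane → ℂ} {x : Plane} (hu : DifferentiableAt ℝ u x) (hx : u x ≠ 0)
    (v : Plane) :
    ‖u x‖ * fderiv ℝ (fun y => ‖u y‖) x v = ((starRingEnd ℂ) (u x) * fderiv ℝ u x v).re := by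
  have h1 : HasFDerivAt (fun y => ‖u y‖ ^ 2) _ x := hu.hasFDerivAt.norm_sq
  have h2 : HasFDerivAt (fun y => ‖u y‖ ^ 2) _ x := (hu.norm ℝ hx).hasFDerivAt.pow 2
  have := congrArg (fun L => L v) (h1.unique h2)
  simp [Complex.inner] at this
  simp [Complex.mul_re] 
  linarith

theorem diamagnetic {u : Plane → ℂ} {x : Plane} (hu : DifferentiableAt ℝ u x) (Ω : ℝ) :
    gradAbsSq u x ≤ gradSq u x + Ω ^ 2 / 4 * ‖x‖ ^ 2 * ‖u x‖ ^ 2 - Ω * momentum u x := by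
  by_cases hx : u x = 0
  · simp [gradAbsSq, fderiv_norm_eq_zero hx, momentum, hx, gradSq]; positivity
  have h0 := fderiv_norm_mul hu hx e0
  have h1 := fderiv_norm_mul hu hx e1
  have hn : 0 < ‖u x‖ := norm_pos_iff.2 hx
  rw [gradAbsSq, clm_norm_sq, gradSq, momentum, plane_norm_sq, d0, d1]
  set p := fderiv ℝ (fun y => ‖u y‖) x e0
  set q := fderiv ℝ (fun y => ‖u y‖) x e1
  set z0 := (starRingEnd ℂ) (u x) * fderiv ℝ u x e0 with hz0
  set z1 := (starRingEnd ℂ) (u x) * fderiv ℝ u x e1 with hz1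
  have k0 : z0.re ^ 2 + z0.im ^ 2 = ‖u x‖ ^ 2 * ‖fderiv ℝ u x e0‖ ^ 2 := by
    have : ‖z0‖ ^ 2 = ‖u x‖ ^ 2 * ‖fderiv ℝ u x e0‖ ^ 2 := by
      rw [hz0, norm_mul, mul_pow]; simp
    rw [← this, Complex.sq_norm, Complex.normSq_apply]; ring
  have k1 : z1.re ^ 2 + z1.im ^ 2 = ‖u x‖ ^ 2 * ‖fderiv ℝ u x e1‖ ^ 2 := by
    have : ‖z1‖ ^ 2 = ‖u x‖ ^ 2 * ‖fderiv ℝ u x e1‖ ^ 2 := by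
      rw [hz1, norm_mul, mul_pow]; simp
    rw [← this, Complex.sq_norm, Complex.normSq_apply]; ring
  rw [← h0] at k0
  rw [← h1] at k1
  refine le_of_mul_le_mul_left ?_ (pow_pos hn 2)
  nlinarith [sq_nonneg (z0.im + Ω / 2 * x 1 * ‖u x‖ ^ 2), sq_nonneg
    (z1.im - Ω / 2 * x 0 * ‖u x‖ ^ 2)]

theorem gradAbsSq_nonneg (u : Plane → ℂ) (x : Plane) : 0 ≤ gradAbsSq u x := by
  unfold gradAbsSq; positivity

theorem gradAbsSq_le_gradSq {u : Plane → ℂ} {x : Plane} (hu : DifferentiableAt ℝ u x) :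
    gradAbsSq u x ≤ gradSq u x := by
  simpa using diamagnetic hu 0

theorem measurable_gradAbsSq (u : Plane → ℂ) : Measurable (gradAbsSq u) :=
  ((measurable_fderiv ℝ _).norm.pow_const 2)

theorem measurable_d0 (u : Plane → ℂ) : Measurable (d0 u) := measurable_fderiv_apply_const ℝ u e0
theorem measurable_d1 (u : Plane → ℂ) : Measurable (d1 u) := measurable_fderiv_apply_const ℝ u e1

theorem integrableOn_norm_rpow_ball {s : ℝ} (hs : -2 < s) (r : ℝ) :
    IntegrableOn (fun x : Plane => ‖x‖ ^ s) (ball 0 r) := by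
  rw [integrableOn_fun_norm_addHaar (μ := volume) (f := fun t : ℝ => t ^ s)]
  rcases le_or_gt r 0 with hr | hr
  · simp [Ioo_eq_empty_of_le hr]
  have : IntegrableOn (fun t : ℝ => t ^ (s + 1)) (Ioo 0 r) :=
    (intervalIntegral.integrableOn_Ioo_rpow_iff hr).2 (by linarith)
  refine this.congr_fun (fun t ht => ?_) measurableSet_Ioo
  simp [Real.rpow_add ht.1, mul_comm]

/-- The singular part of the logarithmic kernel. -/
def logSing (z : Plane) : ℝ := (ball (0 : Plane) 1).indicator (fun z => |Real.log ‖z‖|) z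

theorem measurable_logSing : Measurable logSing :=
  (measurable_norm.log.abs).indicator measurableSet_ball

theorem logSing_nonneg (z : Plane) : 0 ≤ logSing z :=
  indicator_nonneg (fun _ _ => abs_nonneg _) z

theorem integrable_logSing_sq : Integrable (fun z => logSing z ^ 2) := by
  have h : Integrable ((ball (0 : Plane) 1).indicator (fun z => 4 * ‖z‖ ^ (-1 : ℝ))) := by
    rw [integrable_indicator_iff measurableSet_ball]
    exact (integrableOn_norm_rpow_ball (by norm_num) 1).const_mul 4
  refine h.mono' (measurable_logSing.pow_const 2).aestronglyMeasurable
    (Eventually.of_forall fun z => ?_)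
  by_cases hz : z ∈ ball (0 : Plane) 1
  · rw [Real.norm_of_nonneg (by positivity), logSing, indicator_of_mem hz, indicator_of_mem hz]
    rcases eq_or_ne z 0 with rfl | hz0
    · simp
    have hn : 0 < ‖z‖ := norm_pos_iff.2 hz0
    have hlt : ‖z‖ < 1 := by simpa using hz
    have := Real.abs_log_mul_self_rpow_lt ‖z‖ (1 / 2) hn hlt.le (by norm_num)
    rw [← Real.sqrt_eq_rpow, abs_mul, abs_of_nonneg (Real.sqrt_nonneg _)] at this
    norm_num at this
    have h2 : |Real.log ‖z‖| ^ 2 * ‖z‖ ≤ 4 := by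
      have h3 := Real.sq_sqrt hn.le
      nlinarith [mul_nonneg (abs_nonneg (Real.log ‖z‖)) (Real.sqrt_nonneg ‖z‖)]
    rw [Real.rpow_neg_one, ← div_eq_mul_inv, le_div_iff₀ hn]
    exact h2
  · simp [logSing, indicator_of_notMem hz]

theorem abs_log_norm_le (z : Plane) : |Real.log ‖z‖| ≤ logSing z + ‖z‖ := by
  by_cases hz : z ∈ ball (0 : Plane) 1
  · rw [logSing, indicator_of_mem hz]; linarith [norm_nonneg z]
  · rw [logSing, indicator_of_notMem hz]
    have : 1 ≤ ‖z‖ := by simpa using hz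
    rw [abs_of_nonneg (Real.log_nonneg this)]
    linarith [Real.log_le_sub_one_of_pos (by linarith : 0 < ‖z‖)]

theorem neg_logSing_le_log (z : Plane) : -logSing z ≤ Real.log ‖z‖ := by
  by_cases hz : z ∈ ball (0 : Plane) 1
  · rw [logSing, indicator_of_mem hz]; exact neg_abs_le _
  · rw [logSing, indicator_of_notMem hz]
    have : 1 ≤ ‖z‖ := by simpa using hz
    simpa using Real.log_nonneg this

/-- Functions against which the logarithmic kernel is integrable. -/
structure LogDens (f : Plane → ℝ) : Prop where
  int : Integrable f
  mom : Integrable (fun x => ‖x‖ * f x)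
  sq : Integrable (fun x => f x ^ 2)

theorem LogDens.memLp {f : Plane → ℝ} (hf : LogDens f) : MemLp f 2 :=
  (memLp_two_iff_integrable_sq hf.int.aestronglyMeasurable).2 hf.sq

theorem LogDens.integrable_mul {f g : Plane → ℝ} (hf : LogDens f) (hg : LogDens g) :
    Integrable (fun x => f x * g x) := hf.memLp.integrable_mul hg.memLp

theorem LogDens.add {f g : Plane → ℝ} (hf : LogDens f) (hg : LogDens g) :
    LogDens (fun x => f x + g x) where
  int := hf.int.add hg.int
  mom := by simp only [mul_add]; exact hf.mom.add hg.mom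
  sq := (hf.memLp.add hg.memLp).integrable_sq

theorem LogDens.smul {f : Plane → ℝ} (hf : LogDens f) (c : ℝ) : LogDens (fun x => c * f x) where
  int := hf.int.const_mul c
  mom := by simpa only [mul_left_comm] using hf.mom.const_mul c
  sq := by simpa only [mul_pow] using hf.sq.const_mul (c ^ 2)

theorem measurable_log_sub : Measurable (fun p : Plane × Plane => Real.log ‖p.1 - p.2‖) :=
  ((measurable_fst.sub measurable_snd).norm).log

theorem integrable_logSing_mul {g : Plane → ℝ} (hg : LogDens g) (x : Plane) :
    Integrable (fun y => logSing (x - y) * g y) := by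
  refine MemLp.integrable_mul (p := 2) (q := 2) ?_ hg.memLp
  rw [memLp_two_iff_integrable_sq]
  · exact integrable_logSing_sq.comp_sub_left x
  · exact (measurable_logSing.comp (measurable_const.sub measurable_id)).aestronglyMeasurable

theorem integral_logSing_mul_le {g : Plane → ℝ} (hg : LogDens g) (x : Plane) {s : ℝ} (hs : 0 < s) :
    ∫ y, logSing (x - y) * g y ≤
      1 / 2 * (s * (∫ z, logSing z ^ 2) + s⁻¹ * ∫ y, g y ^ 2) := by
  have e : ∫ z, logSing z ^ 2 = ∫ y, logSing (x - y) ^ 2 :=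
    (integral_sub_left_eq_self (fun z => logSing z ^ 2) volume x).symm
  have i1 : Integrable (fun y => logSing (x - y) ^ 2) := integrable_logSing_sq.comp_sub_left x
  rw [e, ← integral_const_mul, ← integral_const_mul, ← integral_add (i1.const_mul _)
    (hg.sq.const_mul _),
    ← integral_const_mul]
  refine integral_mono (integrable_logSing_mul hg x)
    (((i1.const_mul _).add (hg.sq.const_mul _)).const_mul _) fun y => ?_
  have : 0 ≤ s⁻¹ * (s * logSing (x - y) - g y) ^ 2 := by positivity
  have e2 : s⁻¹ * (s * logSing (x - y) - g y) ^ 2 =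
    s * logSing (x - y) ^ 2 - 2 * (logSing (x - y) * g y) + s⁻¹ * g y ^ 2 := by
    field_simp; ring
  simp only []
  linarith

theorem LogDens.integrable_section {g : Plane → ℝ} (hg : LogDens g) (x : Plane) :
    Integrable (fun y => Real.log ‖x - y‖ * g y) := by
  have h := ((integrable_logSing_mul hg x).norm.add ((hg.int.norm.const_mul ‖x‖).add hg.mom.norm))
  refine h.mono' ?_ (Eventually.of_forall fun y => ?_)
  · exact ((measurable_log_sub.comp
      (measurable_const.prodMk measurable_id)).aestronglyMeasurable).mul hg.int.aestronglyMeasurable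
  · simp only [norm_mul, Real.norm_eq_abs, Pi.add_apply, abs_norm]
    have h1 := abs_log_norm_le (x - y)
    have h2 := norm_sub_le x y
    have h3 := abs_nonneg (g y)
    rw [abs_of_nonneg (logSing_nonneg _)]
    nlinarith [mul_le_mul_of_nonneg_right (h1.trans (add_le_add_right h2 _)) h3]

theorem LogDens.integrable_prod {f g : Plane → ℝ} (hf : LogDens f) (hg : LogDens g) :
    Integrable (fun p : Plane × Plane => Real.log ‖p.1 - p.2‖ * f p.1 * g p.2)
      (volume.prod volume) := by
  have i1 : Integrable (fun p : Plane × Plane => |g p.2| * logSing (p.1 - p.2) ^ 2)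
      (volume.prod volume) :=
    Integrable.convolution_integrand (ContinuousLinearMap.mul ℝ ℝ) hg.int.norm integrable_logSing_sq
  have i2 : Integrable (fun p : Plane × Plane => f p.1 ^ 2 * |g p.2|) (volume.prod volume) :=
    hf.sq.mul_prod hg.int.norm
  have i3 : Integrable (fun p : Plane × Plane => |‖p.1‖ * f p.1| * |g p.2|) (volume.prod volume) :=
    hf.mom.norm.mul_prod hg.int.norm
  have i4 : Integrable (fun p : Plane × Plane => |f p.1| * |‖p.2‖ * g p.2|) (volume.prod volume) :=
    hf.int.norm.mul_prod hg.mom.norm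
  refine ((i1.add i2).add (i3.add i4)).mono' ?_ (Eventually.of_forall fun p => ?_)
  · exact (measurable_log_sub.aestronglyMeasurable.mul
      hf.int.aestronglyMeasurable.comp_fst).mul hg.int.aestronglyMeasurable.comp_snd
  · obtain ⟨x, y⟩ := p
    simp only [norm_mul, Real.norm_eq_abs, Pi.add_apply, abs_mul, abs_norm]
    have h1 := abs_log_norm_le (x - y)
    have h2 := norm_sub_le x y
    have h3 := abs_nonneg (g y)
    have h4 := abs_nonneg (f x)
    have h5 := mul_le_mul_of_nonneg_right (h1.trans (add_le_add_right h2 _)) (mul_nonneg h4 h3)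
    have h6 : logSing (x - y) * |f x| ≤ logSing (x - y) ^ 2 + f x ^ 2 := by
      rw [← sq_abs (f x)]
      nlinarith [sq_nonneg (logSing (x - y) - |f x|), sq_nonneg (logSing (x - y) + |f x|)]
    have h7 := mul_le_mul_of_nonneg_right h6 h3
    nlinarith

/-- The bilinear form of the logarithmic kernel. -/
def logForm (f g : Plane → ℝ) : ℝ := ∫ x, ∫ y, Real.log ‖x - y‖ * f x * g y

theorem logForm_symm {f g : Plane → ℝ} (hf : LogDens f) (hg : LogDens g) :
    logForm f g = logForm g f := by
  unfold logForm
  rw [integral_integral_swap (f := fun x y => Real.log ‖x - y‖ * f x * g y) (hf.integrable_prod hg)]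
  simp only [norm_sub_rev, mul_right_comm]

/-- The logarithmic potential of a density. -/
def logPot (g : Plane → ℝ) (x : Plane) : ℝ := ∫ y, Real.log ‖x - y‖ * g y

theorem logForm_eq (f g : Plane → ℝ) : logForm f g = ∫ x, f x * logPot g x := by
  unfold logForm logPot
  congr 1 with x
  rw [← integral_const_mul]
  congr 1 with y
  ring

theorem LogDens.integrable_mul_logPot {f g : Plane → ℝ} (hf : LogDens f) (hg : LogDens g) :
    Integrable (fun x => f x * logPot g x) := by
  refine (hf.integrable_prod hg).integral_prod_left.congr (Eventually.of_forall fun x => ?_)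
  simp only [logPot]
  rw [← integral_const_mul]
  congr 1 with y
  ring

theorem logForm_add_left {f f' g : Plane → ℝ} (hf : LogDens f) (hf' : LogDens f')
    (hg : LogDens g) : logForm (fun x => f x + f' x) g = logForm f g + logForm f' g := by
  simp only [logForm_eq, add_mul]
  exact integral_add (hf.integrable_mul_logPot hg) (hf'.integrable_mul_logPot hg)

theorem logForm_smul_left (c : ℝ) (f g : Plane → ℝ) :
    logForm (fun x => c * f x) g = c * logForm f g := by
  simp only [logForm_eq, mul_assoc]
  exact integral_const_mul _ _

theorem logForm_self_lower {f : Plane → ℝ} (hf : LogDens f) (h0 : ∀ x, 0 ≤ f x) {s : ℝ}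
    (hs : 0 < s) :
    -((∫ x, f x) * (1 / 2 * (s * (∫ z, logSing z ^ 2) + s⁻¹ * ∫ y, f y ^ 2))) ≤ logForm f f := by
  rw [logForm_eq, ← integral_mul_const, ← integral_neg]
  refine integral_mono (hf.int.mul_const _).neg (hf.integrable_mul_logPot hf) fun x => ?_
  have h1 := integral_logSing_mul_le hf x hs
  have h2 : -∫ y, logSing (x - y) * f y ≤ logPot f x := by
    rw [← integral_neg]
    refine integral_mono (integrable_logSing_mul hf x).neg (hf.integrable_section x) fun y => ?_
    have := mul_le_mul_of_nonneg_right (neg_logSing_le_log (x - y)) (h0 y)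
    simpa using this
  simp only []
  nlinarith [h0 x, mul_le_mul_of_nonneg_left (neg_le_neg h1 |>.trans h2) (h0 x)]

theorem abs_log_sub_log_le {s t : ℝ} (hs : 0 < s) (ht : 0 < t) :
    |Real.log s - Real.log t| ≤ 2 * √|s - t| * ((√s)⁻¹ + (√t)⁻¹) := by
  wlog h : t ≤ s generalizing s t
  · rw [abs_sub_comm, abs_sub_comm s t, add_comm]
    exact this ht hs (le_of_not_ge h)
  have hst : √s ≤ √t + √(s - t) := by
    rw [Real.sqrt_le_left (by positivity)]
    nlinarith [Real.sq_sqrt ht.le, Real.sq_sqrt (sub_nonneg.2 h),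
      mul_nonneg (Real.sqrt_nonneg t) (Real.sqrt_nonneg (s - t))]
  have h0 : 0 < √t := Real.sqrt_pos.2 ht
  have h0' : 0 < √s := Real.sqrt_pos.2 hs
  rw [abs_of_nonneg (sub_nonneg.2 (Real.log_le_log ht h)), abs_of_nonneg (sub_nonneg.2 h)]
  have e : Real.log s - Real.log t = 2 * Real.log (√s / √t) := by
    rw [Real.log_div h0'.ne' h0.ne', Real.log_sqrt hs.le, Real.log_sqrt ht.le]; ring
  have h1 := Real.log_le_sub_one_of_pos (div_pos h0' h0)
  have h2 : √s / √t - 1 ≤ √(s - t) * (√t)⁻¹ := by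
    rw [← div_eq_mul_inv, div_sub_one h0.ne']
    gcongr
    linarith
  have h3 : 0 ≤ √(s - t) * (√s)⁻¹ := by positivity
  rw [e]
  linarith

theorem integrable_sqrt_inv_mul {g : Plane → ℝ} (hg : LogDens g) : ∃ C, ∀ x,
    Integrable (fun y => (√‖x - y‖)⁻¹ * |g y|) ∧ ∫ y, (√‖x - y‖)⁻¹ * |g y| ≤ C := by
  have hk : Integrable ((ball (0 : Plane) 1).indicator (fun z => ‖z‖⁻¹)) := by
    rw [integrable_indicator_iff measurableSet_ball]
    simpa only [Real.rpow_neg_one] using integrableOn_norm_rpow_ball (s := -1) (by norm_num) 1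
  refine ⟨(∫ z, (ball (0 : Plane) 1).indicator (fun z => ‖z‖⁻¹) z) + ((∫ y, g y ^ 2) +
    ∫ y, |g y|), fun x => ?_⟩
  have i1 := hk.comp_sub_left x
  have i2 := i1.add (hg.sq.add hg.int.norm)
  have hb : ∀ y, (√‖x - y‖)⁻¹ * |g y| ≤
      (ball (0 : Plane) 1).indicator (fun z => ‖z‖⁻¹) (x - y) + (g y ^ 2 + |g y|) := by
    intro y
    by_cases hy : x - y ∈ ball (0 : Plane) 1
    · rw [indicator_of_mem hy]
      have : ‖x - y‖⁻¹ = (√‖x - y‖)⁻¹ ^ 2 := by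
        rw [inv_pow, Real.sq_sqrt (norm_nonneg _)]
      rw [this, ← sq_abs (g y)]
      nlinarith [sq_nonneg ((√‖x - y‖)⁻¹ - |g y|), abs_nonneg (g y), sq_nonneg
        ((√‖x - y‖)⁻¹ + |g y|)]
    · rw [indicator_of_notMem hy]
      have h1 : 1 ≤ √‖x - y‖ := by
        rw [Real.one_le_sqrt]; simpa using hy
      have := inv_le_one_of_one_le₀ h1
      nlinarith [abs_nonneg (g y), sq_nonneg (g y)]
  have i3 : Integrable (fun y => (√‖x - y‖)⁻¹ * |g y|) := by
    refine i2.mono' ?_ (Eventually.of_forall fun y => ?_)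
    · exact (by fun_prop : Measurable fun y : Plane => (√‖x - y‖)⁻¹).aestronglyMeasurable.mul
        hg.int.aestronglyMeasurable.norm
    · rw [Real.norm_of_nonneg (by positivity)]
      exact hb y
  refine ⟨i3, ?_⟩
  rw [← integral_sub_left_eq_self (fun z => (ball (0 : Plane) 1).indicator (fun z => ‖z‖⁻¹) z)
    volume x, ← integral_add hg.sq (by exact hg.int.norm), ← integral_add i1
      (by exact hg.sq.add hg.int.norm)]
  exact integral_mono i3 i2 hb

theorem logPot_holder {g : Plane → ℝ} (hg : LogDens g) :
    ∃ C, ∀ x x', |logPot g x - logPot g x'| ≤ C * √‖x - x'‖ := by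
  obtain ⟨C, hC⟩ := integrable_sqrt_inv_mul hg
  refine ⟨4 * C, fun x x' => ?_⟩
  unfold logPot
  rw [← integral_sub (hg.integrable_section x) (hg.integrable_section x')]
  have i := (((hC x).1.add (hC x').1).const_mul (2 * √‖x - x'‖))
  rw [← Real.norm_eq_abs]
  refine (norm_integral_le_of_norm_le i ?_).trans ?_
  · have h1 : ∀ᵐ y : Plane, y ≠ x := by simp [ae_iff]
    have h2 : ∀ᵐ y : Plane, y ≠ x' := by simp [ae_iff]
    filter_upwards [h1, h2] with y hy hy'
    rw [← sub_mul, norm_mul, Real.norm_eq_abs, Real.norm_eq_abs, Pi.add_apply, ← add_mul, ←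
      mul_assoc]
    gcongr
    refine (abs_log_sub_log_le (norm_pos_iff.2 (sub_ne_zero.2 hy.symm))
      (norm_pos_iff.2 (sub_ne_zero.2 hy'.symm))).trans ?_
    gcongr
    simpa using abs_norm_sub_norm_le (x - y) (x' - y)
  · rw [integral_const_mul]
    simp only [Pi.add_apply]
    rw [integral_add (hC x).1 (hC x').1]
    nlinarith [Real.sqrt_nonneg ‖x - x'‖, mul_le_mul_of_nonneg_left (add_le_add (hC x).2 (hC x').2)
      (Real.sqrt_nonneg ‖x - x'‖)]

theorem integral_comp_smul_plane (F : Plane → ℝ) {τ : ℝ} (hτ : 0 < τ) :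
    ∫ x, F (τ • x) = (τ ^ 2)⁻¹ * ∫ x, F x := by
  rw [Measure.integral_comp_smul]
  simp [abs_of_pos hτ]

theorem integrable_comp_smul_plane {F : Plane → ℝ} (hF : Integrable F) {τ : ℝ} (hτ : 0 < τ) :
    Integrable (fun x => F (τ • x)) :=
  (integrable_comp_smul_iff volume F hτ.ne').2 hF

/-- The mass-preserving dilation of a real profile, multiplied by `c`. -/
def scaleFun (c τ : ℝ) (v : Plane → ℝ) (x : Plane) : ℂ := ((c * τ * v (τ • x) : ℝ) : ℂ)

/-- Real profiles used as trial functions. -/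
structure Profile (v : Plane → ℝ) : Prop where
  diff : Differentiable ℝ v
  sq : Integrable (fun x => v x ^ 2)
  grad : Integrable (gradSqR v)
  mom : Integrable (fun x => ‖x‖ * v x ^ 2)
  four : Integrable (fun x => v x ^ 4)

theorem Profile.logDens {v : Plane → ℝ} (hv : Profile v) : LogDens (fun x => v x ^ 2) where
  int := hv.sq
  mom := hv.mom
  sq := by simpa only [← pow_mul] using hv.four

theorem norm_scaleFun_sq (c τ : ℝ) (v : Plane → ℝ) (x : Plane) :
    ‖scaleFun c τ v x‖ ^ 2 = c ^ 2 * τ ^ 2 * v (τ • x) ^ 2 := by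
  rw [scaleFun, Complex.norm_real, Real.norm_eq_abs, sq_abs]; ring

theorem fderiv_scaleFun {v : Plane → ℝ} (hv : Differentiable ℝ v) (c τ : ℝ) (x e : Plane) :
    fderiv ℝ (scaleFun c τ v) x e = ((c * τ * (τ * fderiv ℝ v (τ • x) e) : ℝ) : ℂ) := by
  have h1 : HasFDerivAt (fun x : Plane => τ • x) (τ • ContinuousLinearMap.id ℝ Plane) x :=
    (hasFDerivAt_id x).const_smul τ
  have h2 := ((hv (τ • x)).hasFDerivAt.comp x h1).const_mul (c * τ)
  have h3 : HasFDerivAt (scaleFun c τ v) _ x := Complex.ofRealCLM.hasFDerivAt.comp x h2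
  rw [h3.fderiv]
  simp

theorem differentiable_scaleFun {v : Plane → ℝ} (hv : Differentiable ℝ v) (c τ : ℝ) :
    Differentiable ℝ (scaleFun c τ v) := by
  have : Differentiable ℝ (fun x => c * τ * v (τ • x)) :=
    (hv.comp (differentiable_id.const_smul τ)).const_mul (c * τ)
  exact Complex.ofRealCLM.differentiable.comp this

theorem gradSq_scaleFun {v : Plane → ℝ} (hv : Differentiable ℝ v) (c τ : ℝ) (x : Plane) :
    gradSq (scaleFun c τ v) x = c ^ 2 * τ ^ 4 * gradSqR v (τ • x) := by
  rw [gradSq, d0, d1, fderiv_scaleFun hv, fderiv_scaleFun hv, Complex.norm_real, Complex.norm_real,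
    Real.norm_eq_abs, Real.norm_eq_abs, sq_abs, sq_abs, gradSqR, d0R, d1R]
  ring

theorem momentum_scaleFun {v : Plane → ℝ} (hv : Differentiable ℝ v) (c τ : ℝ) (x : Plane) :
    momentum (scaleFun c τ v) x = 0 := by
  rw [momentum, d0, d1, fderiv_scaleFun hv, fderiv_scaleFun hv, scaleFun]
  simp only [Complex.conj_ofReal, ← Complex.ofReal_mul, Complex.ofReal_im]
  ring

theorem scaleFun_mem {V : Plane → ℝ} {v : Plane → ℝ} (hv : Profile v) (c : ℝ) {τ : ℝ}
    (hτ : 0 < τ) (hV : Integrable (fun x => V (τ⁻¹ • x) * v x ^ 2)) :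
    scaleFun c τ v ∈ Sset V (c ^ 2 * ∫ x, v x ^ 2) := by
  refine ⟨⟨⟨differentiable_scaleFun hv.diff c τ, ?_, ?_⟩, ?_⟩, ?_⟩
  · simp only [norm_scaleFun_sq]
    exact (integrable_comp_smul_plane hv.sq hτ).const_mul _
  · have : gradSq (scaleFun c τ v) = fun x => c ^ 2 * τ ^ 4 * gradSqR v (τ • x) :=
      funext (gradSq_scaleFun hv.diff c τ)
    rw [this]
    exact (integrable_comp_smul_plane hv.grad hτ).const_mul _
  · refine ((integrable_comp_smul_plane hV hτ).const_mul (c ^ 2 * τ ^ 2)).congr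
      (Eventually.of_forall fun x => ?_)
    simp only [norm_scaleFun_sq, inv_smul_smul₀ hτ.ne']
    ring
  · simp only [norm_scaleFun_sq]
    rw [integral_const_mul, integral_comp_smul_plane (fun x => v x ^ 2) hτ]
    field_simp

theorem logConv_scaleFun {v : Plane → ℝ} (hv : Profile v) (c : ℝ) {τ : ℝ} (hτ : 0 < τ) :
    logConv (scaleFun c τ v) = c ^ 4 * (logForm (fun x => v x ^ 2) (fun x => v x ^ 2)
      - Real.log τ * (∫ x, v x ^ 2) ^ 2) := by
  have hd := hv.logDens
  have inner : ∀ x : Plane, ∫ y, Real.log ‖x - y‖ * ‖scaleFun c τ v x‖ ^ 2 *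
      ‖scaleFun c τ v y‖ ^ 2 = c ^ 4 * τ ^ 2 * (v (τ • x) ^ 2 *
        (logPot (fun x => v x ^ 2) (τ • x) - Real.log τ * ∫ y, v y ^ 2)) := by
    intro x
    have e1 : ∀ᵐ y : Plane, Real.log ‖x - y‖ * ‖scaleFun c τ v x‖ ^ 2 * ‖scaleFun c τ v y‖ ^ 2 =
        c ^ 4 * τ ^ 4 * v (τ • x) ^ 2 * ((Real.log ‖τ • x - τ • y‖ - Real.log τ) * v (τ • y) ^ 2)
          := by
      have h1 : ∀ᵐ y : Plane, y ≠ x := by simp [ae_iff]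
      filter_upwards [h1] with y hy
      have : 0 < ‖x - y‖ := norm_pos_iff.2 (sub_ne_zero.2 hy.symm)
      rw [← smul_sub, norm_smul, Real.norm_of_nonneg hτ.le, Real.log_mul hτ.ne' this.ne',
        norm_scaleFun_sq, norm_scaleFun_sq]
      ring
    rw [integral_congr_ae e1, integral_const_mul, integral_comp_smul_plane
      (fun y => (Real.log ‖τ • x - y‖ - Real.log τ) * v y ^ 2) hτ]
    simp only [sub_mul]
    rw [integral_sub (hd.integrable_section _) (hv.sq.const_mul _), integral_const_mul, logPot]
    field_simp
  unfold logConv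
  simp only [inner]
  rw [integral_const_mul, integral_comp_smul_plane (fun x => v x ^ 2 *
        (logPot (fun x => v x ^ 2) x - Real.log τ * ∫ y, v y ^ 2)) hτ, logForm_eq]
  simp only [mul_sub]
  rw [integral_sub (hd.integrable_mul_logPot hd) (hv.sq.mul_const _), integral_mul_const]
  field_simp

theorem Ea_scaleFun {V : Plane → ℝ} (Ω : ℝ) {v : Plane → ℝ} (hv : Profile v) (c : ℝ) {τ : ℝ}
    (hτ : 0 < τ) (hV : Integrable (fun x => V (τ⁻¹ • x) * v x ^ 2)) :
    Ea V Ω (scaleFun c τ v) = c ^ 2 * τ ^ 2 * (∫ x, gradSqR v x)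
      + c ^ 2 * (∫ x, V (τ⁻¹ • x) * v x ^ 2)
      + 1 / 2 * (c ^ 4 * (logForm (fun x => v x ^ 2) (fun x => v x ^ 2)
      - Real.log τ * (∫ x, v x ^ 2) ^ 2)) - 1 / 2 * (c ^ 4 * τ ^ 2 * ∫ x, v x ^ 4) := by
  have e1 : ∀ x, gradSq (scaleFun c τ v) x + V x * ‖scaleFun c τ v x‖ ^ 2 =
      c ^ 2 * τ ^ 4 * gradSqR v (τ • x) + c ^ 2 * τ ^ 2 * (V (τ⁻¹ • (τ • x)) * v (τ • x) ^ 2) := by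
    intro x
    rw [gradSq_scaleFun hv.diff, norm_scaleFun_sq, inv_smul_smul₀ hτ.ne']
    ring
  have e2 : ∀ x, ‖scaleFun c τ v x‖ ^ 4 = c ^ 4 * τ ^ 4 * v (τ • x) ^ 4 := by
    intro x
    have := norm_scaleFun_sq c τ v x
    calc _ = (‖scaleFun c τ v x‖ ^ 2) ^ 2 := by ring
      _ = _ := by rw [this]; ring
  unfold Ea
  simp only [e1, e2, momentum_scaleFun hv.diff]
  rw [logConv_scaleFun hv c hτ, integral_add ((integrable_comp_smul_plane hv.grad hτ).const_mul _)
    ((integrable_comp_smul_plane hV hτ).const_mul _), integral_const_mul, integral_const_mul,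
    integral_const_mul, integral_comp_smul_plane (gradSqR v) hτ,
    integral_comp_smul_plane (fun x => V (τ⁻¹ • x) * v x ^ 2) hτ,
    integral_comp_smul_plane (fun x => v x ^ 4) hτ]
  simp only [integral_zero, mul_zero, sub_zero]
  field_simp

theorem gradSqR_eq (v : Plane → ℝ) (x : Plane) : gradSqR v x = ‖fderiv ℝ v x‖ ^ 2 := by
  rw [clm_norm_sq]; rfl

theorem measurable_gradSqR (v : Plane → ℝ) : Measurable (gradSqR v) := by
  have : gradSqR v = fun x => ‖fderiv ℝ v x‖ ^ 2 := funext (gradSqR_eq v)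
  rw [this]
  exact (measurable_fderiv ℝ v).norm.pow_const 2

theorem integrable_pow_of_hasCompactSupport {v : Plane → ℝ} (hv : Continuous v)
    (hc : HasCompactSupport v) {n : ℕ} (hn : n ≠ 0) : Integrable (fun x => v x ^ n) := by
  have h : HasCompactSupport (fun x => v x ^ n) :=
    hc.mono fun x hx => by
      rw [Function.mem_support] at hx ⊢
      exact fun h0 => hx (by rw [h0, zero_pow hn])
  exact (hv.pow n).integrable_of_hasCompactSupport h

theorem Profile.of_hasCompactSupport {v : Plane → ℝ} (hv : Differentiable ℝ v)
    (hc : HasCompactSupport v) (hg : Integrable (gradSqR v)) : Profile v where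
  diff := hv
  sq := integrable_pow_of_hasCompactSupport hv.continuous hc two_ne_zero
  grad := hg
  mom := by
    have h : HasCompactSupport (fun x => ‖x‖ * v x ^ 2) :=
      hc.mono fun x hx => by
        rw [Function.mem_support] at hx ⊢
        exact fun h0 => hx (by rw [h0]; simp)
    exact (continuous_norm.mul (hv.continuous.pow 2)).integrable_of_hasCompactSupport h
  four := integrable_pow_of_hasCompactSupport hv.continuous hc four_ne_zero

theorem integrable_potential_scaled {V : Plane → ℝ} (hV : V110 V) {v : Plane → ℝ}
    (hv : Continuous v) (hc : HasCompactSupport v) :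
    ∃ K, ∀ τ : ℝ, 1 ≤ τ → Integrable (fun x => V (τ⁻¹ • x) * v x ^ 2) ∧
      ∫ x, V (τ⁻¹ • x) * v x ^ 2 ≤ K := by
  obtain ⟨R, hR⟩ := hc.isBounded.subset_closedBall 0
  obtain ⟨C, hC⟩ := hV.2.2.1 R
  have hi : Integrable (fun x => v x ^ 2) := integrable_pow_of_hasCompactSupport hv hc two_ne_zero
  refine ⟨∫ x, C * v x ^ 2, fun τ hτ => ?_⟩
  have hb : ∀ x, V (τ⁻¹ • x) * v x ^ 2 ≤ C * v x ^ 2 := by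
    intro x
    by_cases hx : x ∈ tsupport v
    · refine mul_le_mul_of_nonneg_right (hC _ ?_) (sq_nonneg _)
      have h1 : ‖x‖ ≤ R := by simpa using hR hx
      rw [norm_smul, norm_inv, Real.norm_of_nonneg (by linarith)]
      exact (mul_le_of_le_one_left (norm_nonneg _) (inv_le_one_of_one_le₀ hτ)).trans h1
    · simp [image_eq_zero_of_notMem_tsupport hx]
  have hI : Integrable (fun x => V (τ⁻¹ • x) * v x ^ 2) := by
    refine (hi.const_mul C).mono' ?_ (Eventually.of_forall fun x => ?_)
    · exact ((hV.1.comp (measurable_const_smul τ⁻¹)).mul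
        (hv.measurable.pow_const 2)).aestronglyMeasurable
    · rw [Real.norm_of_nonneg (mul_nonneg (hV.2.1 _) (sq_nonneg _))]
      exact hb x
  exact ⟨hI, integral_mono hI (hi.const_mul C) hb⟩

theorem nonneg_of_bddBelow_quadratic {B L : ℝ} (h : ∀ τ : ℝ, 1 ≤ τ → L ≤ τ ^ 2 * B) : 0 ≤ B := by
  by_contra hB
  push Not at hB
  have ht : Tendsto (fun τ : ℝ => τ ^ 2 * B) atTop atBot :=
    (tendsto_pow_atTop two_ne_zero).atTop_mul_const_of_neg hB
  obtain ⟨τ, h1, h2⟩ := ((ht.eventually_lt_atBot L).and (eventually_ge_atTop 1)).exists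
  linarith [h τ h2]

/-- Boundedness from below of the energy at every mass below `A` forces the
Gagliardo–Nirenberg inequality with constant `2 / A`. -/
theorem gagliardo_of_hasCompactSupport {V : Plane → ℝ} {Ω A : ℝ} (hV : V110 V)
    (hE : ∀ a ∈ Ioo 0 A, ∃ L, ∀ v ∈ Sset V a, L ≤ Ea V Ω v) {v : Plane → ℝ}
    (hv : Differentiable ℝ v) (hc : HasCompactSupport v) (hg : Integrable (gradSqR v)) :
    A * ∫ x, v x ^ 4 ≤ 2 * (∫ x, v x ^ 2) * ∫ x, gradSqR v x := by
  have hp := Profile.of_hasCompactSupport hv hc hg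
  have hP : 0 ≤ ∫ x, v x ^ 4 := integral_nonneg fun x => by positivity
  have hG : 0 ≤ ∫ x, gradSqR v x := integral_nonneg fun x => by unfold gradSqR; positivity
  rcases (integral_nonneg (fun x => sq_nonneg (v x)) : 0 ≤ ∫ x, v x ^ 2).eq_or_lt with hm | hm
  · have : (fun x => v x ^ 2) =ᵐ[volume] 0 :=
      (integral_eq_zero_iff_of_nonneg (fun x => sq_nonneg (v x)) hp.sq).1 hm.symm
    have h4 : ∫ x, v x ^ 4 = 0 := by
      rw [integral_eq_zero_of_ae]
      filter_upwards [this] with x hx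
      have : v x = 0 := by simpa using hx
      simp [this]
    rw [h4, ← hm]; simp
  set m := ∫ x, v x ^ 2
  set P := ∫ x, v x ^ 4
  set G := ∫ x, gradSqR v x
  obtain ⟨K, hK⟩ := integrable_potential_scaled hV hv.continuous hc
  rcases le_or_gt A 0 with hA | hA
  · have : 0 ≤ m * G := by positivity
    nlinarith
  have key : ∀ a ∈ Ioo 0 A, a * P ≤ 2 * m * G := by
    intro a ha
    obtain ⟨L, hL⟩ := hE a ha
    set c := √(a / m)
    have hc2 : c ^ 2 = a / m := Real.sq_sqrt (by have := ha.1; positivity)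
    set W := logForm (fun x => v x ^ 2) (fun x => v x ^ 2)
    have hq : 0 ≤ c ^ 2 * (G - 1 / 2 * c ^ 2 * P) := by
      refine nonneg_of_bddBelow_quadratic (L := L - c ^ 2 * K - 1 / 2 * (c ^ 4 * W)) fun τ hτ => ?_
      have hτ0 : 0 < τ := by linarith
      have h1 := hL _ (by
        have := scaleFun_mem hp c hτ0 (hK τ hτ).1
        rwa [hc2, div_mul_cancel₀ _ hm.ne'] at this)
      rw [Ea_scaleFun Ω hp c hτ0 (hK τ hτ).1] at h1
      have h2 := mul_le_mul_of_nonneg_left (hK τ hτ).2 (sq_nonneg c)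
      have h3 : 0 ≤ c ^ 4 * (Real.log τ * m ^ 2) := by
        have := Real.log_nonneg hτ
        positivity
      linear_combination h1 + h2 + 1 / 2 * h3
    have h4 : 0 < c ^ 2 := by rw [hc2]; exact div_pos ha.1 hm
    have h5 := nonneg_of_mul_nonneg_right hq h4
    rw [hc2] at h5
    have h6 : m * (G - 1 / 2 * (a / m) * P) = m * G - 1 / 2 * (a * P) := by field_simp
    have := mul_nonneg hm.le h5
    rw [h6] at this
    linarith
  have ht : Tendsto (fun a => a * P) (𝓝[<] A) (𝓝 (A * P)) :=
    ((continuous_id.mul continuous_const).tendsto A).mono_left nhdsWithin_le_nhds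
  refine le_of_tendsto ht ?_
  filter_upwards [Ioo_mem_nhdsLT hA] with a ha using key a ha

/-- A dilated smooth cutoff. -/
theorem exists_cutoff : ∃ C, 0 ≤ C ∧ ∀ n : ℕ, ∃ η : Plane → ℝ, Differentiable ℝ η ∧
    HasCompactSupport η ∧ (∀ x, 0 ≤ η x ∧ η x ≤ 1) ∧ (∀ x, ‖x‖ ≤ n + 1 → η x = 1) ∧
    ∀ x, ‖fderiv ℝ η x‖ ≤ C / (n + 1) := by
  let f : ContDiffBump (0 : Plane) := ⟨1, 2, one_pos, one_lt_two⟩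
  have hfd : Differentiable ℝ f := f.contDiff.differentiable (n := 1) (by simp)
  have hf1 : Continuous (fderiv ℝ f) := f.contDiff.continuous_fderiv (n := 1) (by simp)
  obtain ⟨C, hC⟩ := (f.hasCompactSupport.fderiv (𝕜 := ℝ)).exists_bound_of_continuous hf1
  refine ⟨C, (norm_nonneg _).trans (hC 0), fun n => ?_⟩
  have hn : (0 : ℝ) < n + 1 := by positivity
  have hd : ∀ x, HasFDerivAt (fun x : Plane => f ((n + 1 : ℝ)⁻¹ • x))
      ((fderiv ℝ f ((n + 1 : ℝ)⁻¹ • x)).comp ((n + 1 : ℝ)⁻¹ • ContinuousLinearMap.id ℝ Plane)) x :=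
    fun x => by
      have h1 : HasFDerivAt (fun x : Plane => (n + 1 : ℝ)⁻¹ • x)
        ((n + 1 : ℝ)⁻¹ • ContinuousLinearMap.id ℝ Plane) x :=
        ((n + 1 : ℝ)⁻¹ • ContinuousLinearMap.id ℝ Plane).hasFDerivAt
      exact (hfd _).hasFDerivAt.comp x h1
  refine ⟨fun x => f ((n + 1 : ℝ)⁻¹ • x), fun x => (hd x).differentiableAt, ?_, fun x =>
    ⟨f.nonneg, f.le_one⟩, fun x hx => ?_, fun x => ?_⟩
  · exact f.hasCompactSupport.comp_smul (inv_ne_zero hn.ne')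
  · apply f.one_of_mem_closedBall
    rw [mem_closedBall_zero_iff, norm_smul, norm_inv, Real.norm_of_nonneg hn.le]
    rw [inv_mul_le_iff₀ hn]
    simpa [f] using hx
  · rw [(hd x).fderiv, ContinuousLinearMap.comp_smul, ContinuousLinearMap.comp_id, norm_smul,
      norm_inv, Real.norm_of_nonneg hn.le, inv_mul_eq_div]
    gcongr
    exact hC _

theorem hasFDerivAt_sqrt_norm_sq {u : Plane → ℂ} {x : Plane} (hu : DifferentiableAt ℝ u x)
    {δ : ℝ} (hδ : 0 < δ) :
    HasFDerivAt (fun y => √(‖u y‖ ^ 2 + δ ^ 2) - δ)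
      ((‖u x‖ / √(‖u x‖ ^ 2 + δ ^ 2)) • fderiv ℝ (fun y => ‖u y‖) x) x := by
  have hs : 0 < ‖u x‖ ^ 2 + δ ^ 2 := by positivity
  by_cases hx : u x = 0
  · have h := (((hu.hasFDerivAt.norm_sq).add_const (δ ^ 2)).sqrt hs.ne').sub_const δ
    convert! h using 1
    simp [hx]
  · have h := ((((hu.norm ℝ hx).hasFDerivAt.pow 2).add_const (δ ^ 2)).sqrt hs.ne').sub_const δ
    convert! h using 1
    ext v
    simp
    field_simp

theorem sqrt_norm_sq_sub_le {t δ : ℝ} (ht : 0 ≤ t) (hδ : 0 ≤ δ) :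
    0 ≤ √(t ^ 2 + δ ^ 2) - δ ∧ √(t ^ 2 + δ ^ 2) - δ ≤ t := by
  constructor
  · rw [sub_nonneg]; exact Real.le_sqrt_of_sq_le (by nlinarith)
  · rw [sub_le_iff_le_add, Real.sqrt_le_left (by positivity)]; nlinarith

/-- Gagliardo–Nirenberg for the modulus of a differentiable function. -/
theorem gagliardo_abs {V : Plane → ℝ} {Ω A : ℝ} (hV : V110 V) (hA : 0 < A)
    (hE : ∀ a ∈ Ioo 0 A, ∃ L, ∀ v ∈ Sset V a, L ≤ Ea V Ω v) {u : Plane → ℂ}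
    (hu : InH1 u) : Integrable (fun x => ‖u x‖ ^ 4) ∧
    A * ∫ x, ‖u x‖ ^ 4 ≤ 2 * (∫ x, ‖u x‖ ^ 2) * ∫ x, gradAbsSq u x := by
  obtain ⟨hd, h2, hgr⟩ := hu
  have hga : Integrable (gradAbsSq u) := by
    refine hgr.mono' (measurable_gradAbsSq u).aestronglyMeasurable
      (Eventually.of_forall fun x => ?_)
    rw [Real.norm_of_nonneg (gradAbsSq_nonneg u x)]
    exact gradAbsSq_le_gradSq (hd x)
  obtain ⟨C, hC0, hC⟩ := exists_cutoff
  choose η hηd hηc hη01 hη1 hηg using hC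
  set a := ∫ x, ‖u x‖ ^ 2
  set D := ∫ x, gradAbsSq u x
  have ha : 0 ≤ a := integral_nonneg fun x => by positivity
  set δ : ℕ → ℝ := fun n => 1 / (n + 1 : ℝ)
  have hδ : ∀ n, 0 < δ n := fun n => by positivity
  set v : ℕ → Plane → ℝ := fun n x => η n x * (√(‖u x‖ ^ 2 + δ n ^ 2) - δ n)
  have hvd : ∀ n x, HasFDerivAt (v n) _ x := fun n x =>
    ((hηd n) x).hasFDerivAt.mul (hasFDerivAt_sqrt_norm_sq (hd x) (hδ n))
  have hv0 : ∀ n x, 0 ≤ v n x ∧ v n x ≤ ‖u x‖ := fun n x => by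
    have h1 := sqrt_norm_sq_sub_le (norm_nonneg (u x)) (hδ n).le
    have h2 := hη01 n x
    exact ⟨mul_nonneg h2.1 h1.1, (mul_le_of_le_one_left h1.1 h2.2).trans h1.2⟩
  have hgrad : ∀ n x, ‖fderiv ℝ (v n) x‖ ≤
      ‖fderiv ℝ (fun y => ‖u y‖) x‖ + C * δ n * ‖u x‖ := by
    intro n x
    rw [(hvd n x).fderiv]
    refine (norm_add_le _ _).trans (add_le_add ?_ ?_)
    · rw [norm_smul, norm_smul]
      have h3 : ‖‖u x‖ / √(‖u x‖ ^ 2 + δ n ^ 2)‖ ≤ 1 := by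
        rw [Real.norm_of_nonneg (by positivity)]
        refine div_le_one_of_le₀ (Real.le_sqrt_of_sq_le (by nlinarith [hδ n])) (by positivity)
      have h4 : ‖η n x‖ ≤ 1 := by
        rw [Real.norm_of_nonneg (hη01 n x).1]; exact (hη01 n x).2
      calc _ ≤ 1 * (1 * ‖fderiv ℝ (fun y => ‖u y‖) x‖) := by gcongr
        _ = _ := by ring
    · rw [norm_smul, mul_comm]
      have h1 := sqrt_norm_sq_sub_le (norm_nonneg (u x)) (hδ n).le
      rw [Real.norm_of_nonneg h1.1]
      have h5 : ‖fderiv ℝ (η n) x‖ ≤ C * δ n := by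
        have := hηg n x
        simpa [δ, div_eq_mul_inv] using this
      exact mul_le_mul h5 h1.2 h1.1 (by have := hδ n; positivity)
  set B : ℕ → Plane → ℝ := fun n x => gradAbsSq u x + C * δ n * (gradAbsSq u x + ‖u x‖ ^ 2)
    + (C * δ n) ^ 2 * ‖u x‖ ^ 2
  have hBi : ∀ n, Integrable (B n) := fun n =>
    (hga.add ((hga.add h2).const_mul _)).add (h2.const_mul _)
  have hgB : ∀ n x, gradSqR (v n) x ≤ B n x := by
    intro n x
    rw [gradSqR_eq]
    refine (pow_le_pow_left₀ (norm_nonneg _) (hgrad n x) 2).trans ?_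
    simp only [B, gradAbsSq]
    have : 0 ≤ C * δ n := by have := hδ n; positivity
    nlinarith [mul_nonneg this (sq_nonneg (‖fderiv ℝ (fun y => ‖u y‖) x‖ - ‖u x‖))]
  have hgi : ∀ n, Integrable (gradSqR (v n)) := fun n => by
    refine (hBi n).mono' (measurable_gradSqR _).aestronglyMeasurable
      (Eventually.of_forall fun x => ?_)
    rw [Real.norm_of_nonneg (by unfold gradSqR; positivity)]
    exact hgB n x
  have hvc : ∀ n, HasCompactSupport (v n) := fun n => (hηc n).mul_right
  have hvD : ∀ n, Differentiable ℝ (v n) := fun n x => (hvd n x).differentiableAt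
  have hbound : ∀ n, ∫ x, v n x ^ 4 ≤
      2 * a * (D + C * δ n * (D + a) + (C * δ n) ^ 2 * a) / A := by
    intro n
    have h1 := gagliardo_of_hasCompactSupport hV hE (hvD n) (hvc n) (hgi n)
    have h2' : ∫ x, v n x ^ 2 ≤ a := by
      refine integral_mono (Profile.of_hasCompactSupport (hvD n) (hvc n) (hgi n)).sq h2 fun x => ?_
      exact pow_le_pow_left₀ (hv0 n x).1 (hv0 n x).2 2
    have h3 : ∫ x, gradSqR (v n) x ≤ D + C * δ n * (D + a) + (C * δ n) ^ 2 * a := by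
      refine (integral_mono (hgi n) (hBi n) (hgB n)).trans (le_of_eq ?_)
      simp only [B]
      have i1 : Integrable (fun x => gradAbsSq u x + ‖u x‖ ^ 2) := hga.add h2
      have i2 : Integrable (fun x => gradAbsSq u x + C * δ n * (gradAbsSq u x + ‖u x‖ ^ 2)) :=
        hga.add (i1.const_mul _)
      rw [integral_add i2 (h2.const_mul _), integral_add hga (i1.const_mul _),
        integral_const_mul, integral_const_mul, integral_add hga h2]
    rw [le_div_iff₀ hA, mul_comm]
    refine h1.trans ?_
    have h4 : 0 ≤ ∫ x, gradSqR (v n) x := integral_nonneg fun x => by unfold gradSqR; positivity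
    gcongr
  have hδ0 : Tendsto δ atTop (𝓝 0) := tendsto_one_div_add_atTop_nhds_zero_nat
  have hlim : Tendsto (fun n => 2 * a * (D + C * δ n * (D + a) + (C * δ n) ^ 2 * a) / A) atTop
      (𝓝 (2 * a * D / A)) := by
    have hcont : Continuous fun t : ℝ => 2 * a * (D + C * t * (D + a) + (C * t) ^ 2 * a) / A := by
      fun_prop
    have := (hcont.tendsto 0).comp hδ0
    simpa [Function.comp_def] using this
  have hpt : ∀ x, Tendsto (fun n => v n x) atTop (𝓝 ‖u x‖) := by
    intro x
    have hcont : Continuous fun t : ℝ => √(‖u x‖ ^ 2 + t ^ 2) - t := by fun_prop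
    have h1 := (hcont.tendsto 0).comp hδ0
    simp only [ne_eq, OfNat.ofNat_ne_zero, not_false_eq_true, zero_pow, add_zero, sub_zero,
      Real.sqrt_sq (norm_nonneg (u x))] at h1
    refine h1.congr' ?_
    obtain ⟨N, hN⟩ := exists_nat_ge ‖x‖
    filter_upwards [eventually_ge_atTop N] with n hn
    have : ‖x‖ ≤ n + 1 := by
      have : (N : ℝ) ≤ n := by exact_mod_cast hn
      linarith
    simp [v, hη1 n x this]
  have hv4 : ∀ n, Integrable (fun x => v n x ^ 4) := fun n =>
    (Profile.of_hasCompactSupport (hvD n) (hvc n) (hgi n)).four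
  have hfatou : ∫⁻ x, ENNReal.ofReal (‖u x‖ ^ 4) ≤ ENNReal.ofReal (2 * a * D / A) := by
    calc ∫⁻ x, ENNReal.ofReal (‖u x‖ ^ 4)
        = ∫⁻ x, liminf (fun n => ENNReal.ofReal (v n x ^ 4)) atTop := by
          congr 1 with x
          exact ((ENNReal.continuous_ofReal.tendsto _).comp ((hpt x).pow 4)).liminf_eq.symm
      _ ≤ liminf (fun n => ∫⁻ x, ENNReal.ofReal (v n x ^ 4)) atTop :=
          lintegral_liminf_le fun n => ((hvD n).continuous.measurable.pow_const 4).ennreal_ofReal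
      _ ≤ liminf (fun n => ENNReal.ofReal
            (2 * a * (D + C * δ n * (D + a) + (C * δ n) ^ 2 * a) / A)) atTop := by
          refine liminf_le_liminf (Eventually.of_forall fun n => ?_)
          rw [← ofReal_integral_eq_lintegral_ofReal (hv4 n)
            (Eventually.of_forall fun x => by positivity)]
          exact ENNReal.ofReal_le_ofReal (hbound n)
      _ = _ := ((ENNReal.continuous_ofReal.tendsto _).comp hlim).liminf_eq
  have hint4 : Integrable (fun x => ‖u x‖ ^ 4) := by
    refine ⟨(hd.continuous.norm.pow 4).aestronglyMeasurable, ?_⟩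
    rw [hasFiniteIntegral_iff_ofReal (Eventually.of_forall fun x => by positivity)]
    exact hfatou.trans_lt ENNReal.ofReal_lt_top
  refine ⟨hint4, ?_⟩
  rw [← ofReal_integral_eq_lintegral_ofReal hint4 (Eventually.of_forall fun x => by positivity)]
    at hfatou
  have hD : 0 ≤ D := integral_nonneg (gradAbsSq_nonneg u)
  rw [ENNReal.ofReal_le_ofReal_iff (by positivity), le_div_iff₀ hA] at hfatou
  linarith

theorem tendsto_zero_of_integrableOn_div {f f' : ℝ → ℝ}
    (hd : ∀ r ∈ Ioi (1 : ℝ), HasDerivAt f (f' r) r) (hi : IntegrableOn f' (Ioi 1))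
    (hf : IntegrableOn (fun r => f r / r) (Ioi 1)) : Tendsto f atTop (𝓝 0) := by
  have hl := tendsto_limUnder_of_hasDerivAt_of_integrableOn_Ioi hd hi
  set m := limUnder atTop f
  suffices m = 0 by rwa [this] at hl
  by_contra hm
  have hm2 : 0 < |m| / 2 := by positivity
  have hev : ∀ᶠ r in atTop, |m| / 2 ≤ |f r| :=
    (hl.abs.eventually (lt_mem_nhds (show |m| / 2 < |m| by linarith))).mono fun _ h => h.le
  obtain ⟨R, hR⟩ := (hev.and (eventually_ge_atTop 1)).exists_forall_of_atTop
  have hR1 : 1 ≤ R := (hR R le_rfl).2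
  refine not_integrableOn_Ioi_inv (a := R) ?_
  have h1 : IntegrableOn (fun r => (|m| / 2)⁻¹ * (f r / r)) (Ioi R) :=
    (hf.mono_set (Ioi_subset_Ioi hR1)).const_mul _
  refine Integrable.mono h1 measurable_inv.aestronglyMeasurable ?_
  filter_upwards [ae_restrict_mem measurableSet_Ioi] with r hr
  have hr0 : 0 < r := zero_lt_one.trans_le (hR1.trans (le_of_lt hr))
  rw [norm_mul, norm_div, norm_inv, Real.norm_of_nonneg hr0.le, norm_inv,
    Real.norm_of_nonneg hm2.le, Real.norm_eq_abs (f r), inv_eq_one_div, div_eq_mul_one_div |f r|,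
    ← mul_assoc]
  refine le_mul_of_one_le_left (by positivity) ?_
  rw [inv_mul_eq_div, one_le_div hm2]
  exact (hR r (le_of_lt hr)).1

/-- The radial profile of a ground state, with `p = q'`. -/
structure RadialProfile (q p : ℝ → ℝ) : Prop where
  cq : Continuous q
  cp : Continuous p
  dq : ∀ r, 0 < r → HasDerivAt q (p r) r
  dp : ∀ r, 0 < r → HasDerivAt p (q r - q r ^ 3 - p r / r) r
  pos : ∀ r, 0 < q r
  iq : IntegrableOn (fun r => r * q r ^ 2) (Ioi 0)
  ip : IntegrableOn (fun r => r * p r ^ 2) (Ioi 0)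

namespace RadialProfile

variable {q p : ℝ → ℝ}

theorem integrableOn_mul (h : RadialProfile q p) :
    IntegrableOn (fun r => r * (q r * p r)) (Ioi 0) := by
  refine (h.iq.add h.ip).mono'
    (continuous_id.mul (h.cq.mul h.cp)).aestronglyMeasurable ?_
  filter_upwards [ae_restrict_mem measurableSet_Ioi] with r hr
  have hr : 0 < r := hr
  simp only [Pi.add_apply]
  rw [Real.norm_eq_abs, abs_le]
  constructor <;> nlinarith [mul_nonneg hr.le (sq_nonneg (q r + p r)),
    mul_nonneg hr.le (sq_nonneg (q r - p r)), mul_nonneg hr.le (sq_nonneg (q r)),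
    mul_nonneg hr.le (sq_nonneg (p r))]

theorem integrableOn_div {f : ℝ → ℝ} (hf : IntegrableOn (fun r => r * f r) (Ioi 0))
    (hc : Continuous f) : IntegrableOn f (Ioi 1) := by
  refine Integrable.mono (hf.mono_set (Ioi_subset_Ioi zero_le_one)) hc.aestronglyMeasurable ?_
  filter_upwards [ae_restrict_mem measurableSet_Ioi] with r hr
  have hr : 1 < r := hr
  rw [norm_mul, Real.norm_of_nonneg (by linarith : (0 : ℝ) ≤ r)]
  exact le_mul_of_one_le_left (norm_nonneg _) hr.le

theorem tendsto_zero (h : RadialProfile q p) : Tendsto q atTop (𝓝 0) := by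
  have h1 : Tendsto (fun r => r * q r ^ 2) atTop (𝓝 0) := by
    refine tendsto_zero_of_integrableOn_div (f' := fun r => q r ^ 2 + 2 * (r * (q r * p r)))
      (fun r hr => ?_) ?_ ?_
    · have := (hasDerivAt_id r).mul ((h.dq r (zero_lt_one.trans hr)).pow 2)
      convert! this using 1
      simp; ring
    · exact (integrableOn_div h.iq (h.cq.pow 2)).add
        ((h.integrableOn_mul.mono_set (Ioi_subset_Ioi zero_le_one)).const_mul 2)
    · refine (integrableOn_div h.iq (h.cq.pow 2)).congr_fun (fun r hr => ?_) measurableSet_Ioi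
      have hr : (1 : ℝ) < r := hr
      simp; field_simp
  have h2 : Tendsto (fun r => q r ^ 2) atTop (𝓝 0) := by
    refine tendsto_of_tendsto_of_tendsto_of_le_of_le' tendsto_const_nhds h1
      (Eventually.of_forall fun r => sq_nonneg _) ?_
    filter_upwards [eventually_ge_atTop 1] with r hr
    exact le_mul_of_one_le_left (sq_nonneg _) hr
  have h3 := h2.sqrt
  simpa [Real.sqrt_sq (h.pos _).le] using h3

theorem bounded (h : RadialProfile q p) : ∃ K, ∀ r, 0 ≤ r → q r ≤ K := by
  obtain ⟨R, hR⟩ := (h.tendsto_zero.eventually (gt_mem_nhds one_pos)).exists_forall_of_atTop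
  obtain ⟨K, hK⟩ := isCompact_Icc.bddAbove_image (h.cq.continuousOn (s := Icc 0 R))
  refine ⟨max K 1, fun r hr => ?_⟩
  rcases le_total r R with h1 | h1
  · exact (hK ⟨r, ⟨hr, h1⟩, rfl⟩).trans (le_max_left _ _)
  · exact (hR r h1).le.trans (le_max_right _ _)

theorem integrableOn_four (h : RadialProfile q p) :
    IntegrableOn (fun r => r * q r ^ 4) (Ioi 0) := by
  obtain ⟨K, hK⟩ := h.bounded
  refine (h.iq.const_mul (K ^ 2)).mono' (continuous_id.mul (h.cq.pow 4)).aestronglyMeasurable ?_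
  filter_upwards [ae_restrict_mem measurableSet_Ioi] with r hr
  have hr : 0 < r := hr
  have h1 : q r ^ 2 ≤ K ^ 2 := pow_le_pow_left₀ (h.pos r).le (hK r hr.le) 2
  rw [Real.norm_of_nonneg (by positivity)]
  have := mul_le_mul_of_nonneg_left h1 (show 0 ≤ r * q r ^ 2 by positivity)
  linarith

theorem nehari (h : RadialProfile q p) :
    (∫ r in Ioi 0, r * p r ^ 2) + (∫ r in Ioi 0, r * q r ^ 2) = ∫ r in Ioi 0, r * q r ^ 4 := by
  have hi : IntegrableOn (fun r => r * p r ^ 2 + r * q r ^ 2 - r * q r ^ 4) (Ioi 0) :=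
    (h.ip.add h.iq).sub h.integrableOn_four
  have hd : ∀ r, 0 < r → HasDerivAt (fun r => r * (q r * p r))
      (r * p r ^ 2 + r * q r ^ 2 - r * q r ^ 4) r := fun r hr => by
    have := (hasDerivAt_id r).mul ((h.dq r hr).mul (h.dp r hr))
    convert! this using 1
    simp; field_simp; ring
  have hc := h.cq.mul h.cp
  have h0 : Tendsto (fun r => r * (q r * p r)) atTop (𝓝 0) := by
    refine tendsto_zero_of_integrableOn_div (fun r hr => hd r (zero_lt_one.trans hr))
      (hi.mono_set (Ioi_subset_Ioi zero_le_one)) ?_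
    refine (integrableOn_div h.integrableOn_mul hc).congr_fun (fun r hr => ?_) measurableSet_Ioi
    have hr : (1 : ℝ) < r := hr
    simp only; field_simp
  have := integral_Ioi_of_hasDerivAt_of_tendsto
    (continuous_id.mul hc).continuousWithinAt (fun r hr => hd r hr) hi h0
  have i1 : IntegrableOn (fun r => r * p r ^ 2 + r * q r ^ 2) (Ioi 0) := h.ip.add h.iq
  rw [integral_sub i1 h.integrableOn_four, integral_add h.ip h.iq] at this
  simp at this
  linarith

theorem pohozaev (h : RadialProfile q p) :
    2 * (∫ r in Ioi 0, r * q r ^ 2) = ∫ r in Ioi 0, r * q r ^ 4 := by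
  have hi : IntegrableOn (fun r => 1 / 2 * (r * q r ^ 4) - r * q r ^ 2) (Ioi 0) :=
    (h.integrableOn_four.const_mul _).sub h.iq
  have hd : ∀ r, 0 < r → HasDerivAt
      (fun r => r * (r * (p r ^ 2 / 2 - q r ^ 2 / 2 + q r ^ 4 / 4)))
      (1 / 2 * (r * q r ^ 4) - r * q r ^ 2) r := fun r hr => by
    have := (hasDerivAt_id r).mul ((hasDerivAt_id r).mul
      (((((h.dp r hr).pow 2).div_const 2).sub (((h.dq r hr).pow 2).div_const 2)).add
        (((h.dq r hr).pow 4).div_const 4)))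
    convert! this using 1
    simp; field_simp; ring
  have hc : Continuous fun r => p r ^ 2 / 2 - q r ^ 2 / 2 + q r ^ 4 / 4 :=
    (((h.cp.pow 2).div_const 2).sub ((h.cq.pow 2).div_const 2)).add ((h.cq.pow 4).div_const 4)
  have hF : IntegrableOn (fun r => r * (p r ^ 2 / 2 - q r ^ 2 / 2 + q r ^ 4 / 4)) (Ioi 0) := by
    have : IntegrableOn (fun r => 1 / 2 * (r * p r ^ 2) - 1 / 2 * (r * q r ^ 2)
      + 1 / 4 * (r * q r ^ 4)) (Ioi 0) :=
      ((h.ip.const_mul _).sub (h.iq.const_mul _)).add (h.integrableOn_four.const_mul _)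
    refine this.congr_fun (fun r _ => ?_) measurableSet_Ioi
    simp only; ring
  have h0 : Tendsto (fun r => r * (r * (p r ^ 2 / 2 - q r ^ 2 / 2 + q r ^ 4 / 4))) atTop (𝓝 0) := by
    refine tendsto_zero_of_integrableOn_div (fun r hr => hd r (zero_lt_one.trans hr))
      (hi.mono_set (Ioi_subset_Ioi zero_le_one)) ?_
    refine (hF.mono_set (Ioi_subset_Ioi zero_le_one)).congr_fun (fun r hr => ?_) measurableSet_Ioi
    have hr : (1 : ℝ) < r := hr
    simp only; field_simp
  have := integral_Ioi_of_hasDerivAt_of_tendsto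
    (continuous_id.mul (continuous_id.mul hc)).continuousWithinAt (fun r hr => hd r hr) hi h0
  rw [integral_sub (h.integrableOn_four.const_mul _) h.iq, integral_const_mul] at this
  simp at this
  linarith

theorem deriv_nonpos (h : RadialProfile q p) : ∃ R, 1 ≤ R ∧ (∀ r, R ≤ r → q r ≤ 1 / 2) ∧
    ∀ r, R ≤ r → p r ≤ 0 := by
  obtain ⟨R, hR⟩ := ((h.tendsto_zero.eventually (gt_mem_nhds one_half_pos)).and
    (eventually_ge_atTop 1)).exists_forall_of_atTop
  have hR1 := (hR R le_rfl).2
  refine ⟨R, hR1, fun r hr => (hR r hr).1.le, fun r hr => ?_⟩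
  by_contra hp
  push Not at hp
  have hr0 : 0 < r := by linarith
  have hm : MonotoneOn (fun s => s * p s) (Ici r) := by
    have hd : ∀ s, r < s → HasDerivAt (fun s => s * p s) (s * (q s - q s ^ 3)) s := fun s hs => by
      have hs0 : 0 < s := hr0.trans hs
      have := (hasDerivAt_id s).mul (h.dp s hs0)
      convert! this using 1
      simp; field_simp; ring
    refine monotoneOn_of_deriv_nonneg (convex_Ici r) (continuous_id.mul h.cp).continuousOn ?_ ?_
    · rw [interior_Ici]
      exact fun s hs => (hd s hs).differentiableAt.differentiableWithinAt
    · rw [interior_Ici]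
      intro s hs
      rw [(hd s hs).deriv]
      have h1 := (hR s (hr.trans (le_of_lt hs))).1
      have h2 := h.pos s
      have hs0 : 0 < s := hr0.trans hs
      refine mul_nonneg hs0.le ?_
      nlinarith [mul_pos h2 h2]
  have hpp : ∀ s, r ≤ s → 0 ≤ p s := fun s hs => by
    have h1 : r * p r ≤ s * p s := hm self_mem_Ici hs hs
    have hs0 : 0 < s := hr0.trans_le hs
    exact nonneg_of_mul_nonneg_right ((mul_pos hr0 hp).le.trans h1) hs0
  have hq : MonotoneOn q (Ici r) := by
    refine monotoneOn_of_deriv_nonneg (convex_Ici r) h.cq.continuousOn ?_ ?_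
    · rw [interior_Ici]
      exact fun s hs => (h.dq s (hr0.trans hs)).differentiableAt.differentiableWithinAt
    · rw [interior_Ici]
      intro s hs
      rw [(h.dq s (hr0.trans hs)).deriv]
      exact hpp s (le_of_lt hs)
  have : q r ≤ 0 := by
    refine ge_of_tendsto h.tendsto_zero ?_
    filter_upwards [eventually_ge_atTop r] with s hs using hq self_mem_Ici hs hs
  linarith [h.pos r]

theorem exp_decay (h : RadialProfile q p) :
    ∃ C, ∀ r, 0 ≤ r → q r ≤ C * Real.exp (-(r / 2)) := by
  obtain ⟨R, hR1, hqR, hpR⟩ := h.deriv_nonpos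
  have hdz : ∀ r, R ≤ r → HasDerivAt (fun r => (p r + q r / 2) * Real.exp (-(r / 2)))
      ((q r - q r ^ 3 - p r / r + p r / 2 - (p r + q r / 2) / 2) * Real.exp (-(r / 2))) r := by
    intro r hr
    have hr0 : 0 < r := by linarith
    have := ((h.dp r hr0).add ((h.dq r hr0).div_const 2)).mul
      (((hasDerivAt_id r).div_const 2).neg.exp)
    convert! this using 1
    simp; ring
  have hmono : MonotoneOn (fun r => (p r + q r / 2) * Real.exp (-(r / 2))) (Ici R) := by
    refine monotoneOn_of_deriv_nonneg (convex_Ici R)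
      (fun r hr => (hdz r hr).continuousAt.continuousWithinAt) ?_ ?_
    · rw [interior_Ici]
      exact fun r hr => (hdz r (le_of_lt hr)).differentiableAt.differentiableWithinAt
    · rw [interior_Ici]
      intro r hr
      have hr : R < r := hr
      rw [(hdz r hr.le).deriv]
      refine mul_nonneg ?_ (Real.exp_pos _).le
      have h1 := hqR r hr.le
      have h2 := h.pos r
      have h3 : p r / r ≤ 0 := div_nonpos_of_nonpos_of_nonneg (hpR r hr.le) (by linarith)
      nlinarith [mul_pos h2 h2]
  have hz : ∀ r, R ≤ r → p r + q r / 2 ≤ 0 := by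
    intro r hr
    by_contra hz
    push Not at hz
    have hlim : p r + q r / 2 ≤ 0 := by
      have : Tendsto (fun s => q s / 2) atTop (𝓝 0) := by simpa using h.tendsto_zero.div_const 2
      refine ge_of_tendsto this ?_
      filter_upwards [eventually_ge_atTop r] with s hs
      have h1 : (p r + q r / 2) * Real.exp (-(r / 2)) ≤ (p s + q s / 2) * Real.exp (-(s / 2)) :=
        hmono hr (hr.trans hs) hs
      have h2 : Real.exp (-(s / 2)) ≤ Real.exp (-(r / 2)) := Real.exp_le_exp.2 (by linarith)
      have h3 := hpR s (hr.trans hs)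
      have h4 : 0 < Real.exp (-(r / 2)) := Real.exp_pos _
      have h6 : (p s + q s / 2) * Real.exp (-(s / 2)) ≤ q s / 2 * Real.exp (-(r / 2)) := by
        have := h.pos s
        have h7 := mul_le_mul_of_nonneg_left h2 (show 0 ≤ q s / 2 by positivity)
        nlinarith [Real.exp_pos (-(s / 2))]
      exact le_of_mul_le_mul_right (h1.trans h6) h4
    linarith
  have hdw : ∀ r, R ≤ r → HasDerivAt (fun r => q r * Real.exp (r / 2))
      ((p r + q r / 2) * Real.exp (r / 2)) r := by
    intro r hr
    have := (h.dq r (by linarith)).mul (((hasDerivAt_id r).div_const 2).exp)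
    convert! this using 1
    simp; ring
  have hanti : AntitoneOn (fun r => q r * Real.exp (r / 2)) (Ici R) := by
    refine antitoneOn_of_deriv_nonpos (convex_Ici R)
      (fun r hr => (hdw r hr).continuousAt.continuousWithinAt) ?_ ?_
    · rw [interior_Ici]
      exact fun r hr => (hdw r (le_of_lt hr)).differentiableAt.differentiableWithinAt
    · rw [interior_Ici]
      intro r hr
      rw [(hdw r (le_of_lt hr)).deriv]
      exact mul_nonpos_of_nonpos_of_nonneg (hz r (le_of_lt hr)) (Real.exp_pos _).le
  obtain ⟨K, hK⟩ := h.bounded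
  have hK0 : 0 ≤ K := (h.pos 0).le.trans (hK 0 le_rfl)
  refine ⟨K * Real.exp (R / 2), fun r hr => ?_⟩
  have key : q r * Real.exp (r / 2) ≤ K * Real.exp (R / 2) := by
    rcases le_total r R with h1 | h1
    · exact mul_le_mul (hK r hr) (Real.exp_le_exp.2 (by linarith)) (Real.exp_pos _).le hK0
    · exact (hanti self_mem_Ici h1 h1).trans
        (mul_le_mul_of_nonneg_right (hK R (by linarith)) (Real.exp_pos _).le)
  rw [Real.exp_neg, ← div_eq_mul_inv, le_div_iff₀ (Real.exp_pos _)]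
  exact key

end RadialProfile

theorem hasFDerivAt_norm_plane {x : Plane} (hx : x ≠ 0) :
    HasFDerivAt (fun y : Plane => ‖y‖) (‖x‖⁻¹ • innerSL ℝ x) x := by
  have hx0 : 0 < ‖x‖ := norm_pos_iff.2 hx
  have h := (hasStrictFDerivAt_norm_sq x).hasFDerivAt.sqrt (by positivity)
  have h2 : (fun y : Plane => √(‖y‖ ^ 2)) = fun y => ‖y‖ := by
    ext y; exact Real.sqrt_sq (norm_nonneg y)
  rw [h2, Real.sqrt_sq hx0.le] at h
  convert! h using 1
  ext v
  simp
  field_simp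

theorem integrable_radial (f : ℝ → ℝ) :
    Integrable (fun x : Plane => f ‖x‖) ↔ IntegrableOn (fun r => r * f r) (Ioi 0) := by
  have := integrable_fun_norm_addHaar (volume : Measure Plane) (f := f)
  simpa using this

theorem integral_radial (f : ℝ → ℝ) :
    ∫ x : Plane, f ‖x‖ = 2 * (volume.real (ball (0 : Plane) 1) * ∫ r in Ioi (0 : ℝ), r * f r) := by
  have := integral_fun_norm_addHaar (volume : Measure Plane) f
  simpa using this

namespace IsGroundState

variable {Q : Plane → ℝ}

theorem eq_radial (hQ : IsGroundState Q) (x : Plane) : Q x = Q (‖x‖ • e0) :=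
  hQ.2.2.1 _ _ (by rw [norm_smul, norm_e0]; simp)

theorem hasDerivAt_ray (hQ : IsGroundState Q) (r : ℝ) :
    HasDerivAt (fun r : ℝ => Q (r • e0)) (d0R Q (r • e0)) r := by
  have h1 : HasDerivAt (fun r : ℝ => r • e0) e0 r := by
    simpa using (hasDerivAt_id r).smul_const e0
  exact ((hQ.1.differentiable (by norm_num)) (r • e0)).hasFDerivAt.comp_hasDerivAt r h1

theorem hasFDerivAt (hQ : IsGroundState Q) {x : Plane} (hx : x ≠ 0) :
    HasFDerivAt Q ((d0R Q (‖x‖ • e0) * ‖x‖⁻¹) • innerSL ℝ x) x := by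
  have h := (hQ.hasDerivAt_ray ‖x‖).comp_hasFDerivAt x (hasFDerivAt_norm_plane hx)
  have h2 : ((fun r : ℝ => Q (r • e0)) ∘ fun y : Plane => ‖y‖) = Q := by
    ext y; exact (hQ.eq_radial y).symm
  rw [h2, smul_smul] at h
  exact h

theorem contDiff_d0R (hQ : IsGroundState Q) : ContDiff ℝ 1 (d0R Q) :=
  (hQ.1.fderiv_right (m := 1) (by norm_num)).clm_apply contDiff_const

theorem contDiff_d1R (hQ : IsGroundState Q) : ContDiff ℝ 1 (d1R Q) :=
  (hQ.1.fderiv_right (m := 1) (by norm_num)).clm_apply contDiff_const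

theorem norm_fderiv (hQ : IsGroundState Q) {x : Plane} (hx : x ≠ 0) :
    ‖fderiv ℝ Q x‖ ^ 2 = d0R Q (‖x‖ • e0) ^ 2 := by
  have hx0 : 0 < ‖x‖ := norm_pos_iff.2 hx
  rw [(hQ.hasFDerivAt hx).fderiv, norm_smul, innerSL_apply_norm]
  rw [mul_pow, Real.norm_eq_abs, sq_abs]
  field_simp

theorem fderiv_d1R (hQ : IsGroundState Q) {r : ℝ} (hr : 0 < r) :
    fderiv ℝ (d1R Q) (r • e0) e1 = d0R Q (r • e0) / r := by
  have h1 : HasDerivAt (fun s : ℝ => r • e0 + s • e1) e1 0 := by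
    simpa using ((hasDerivAt_id (0 : ℝ)).smul_const e1).const_add (r • e0)
  have hd := (hQ.contDiff_d1R.differentiable (by norm_num) (r • e0)).hasFDerivAt
  have h2 : HasDerivAt (fun s : ℝ => d1R Q (r • e0 + s • e1)) (fderiv ℝ (d1R Q) (r • e0) e1) 0 :=
    by
    refine HasFDerivAt.comp_hasDerivAt (l := d1R Q) (f := fun s : ℝ => r • e0 + s • e1) (0 : ℝ) ?_
      h1
    simpa using hd
  set g : ℝ → ℝ := fun s => d0R Q (‖r • e0 + s • e1‖ • e0) * ‖r • e0 + s • e1‖⁻¹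
  have hne : ∀ s : ℝ, r • e0 + s • e1 ≠ 0 := fun s h0 => by
    have := congrArg (fun z : Plane => z 0) h0
    simp [e0, e1] at this
    exact hr.ne' this
  have h3 : (fun s : ℝ => d1R Q (r • e0 + s • e1)) = fun s => g s * s := by
    ext s
    unfold d1R
    rw [(hQ.hasFDerivAt (hne s)).fderiv]
    simp [g, e0, e1, PiLp.inner_apply]
  have hg : ContinuousAt g 0 := by
    have hc : Continuous fun s : ℝ => r • e0 + s • e1 := by fun_prop
    have := hQ.contDiff_d0R.continuous
    refine ContinuousAt.mul (Continuous.continuousAt (by fun_prop)) ?_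
    exact hc.norm.continuousAt.inv₀ (norm_ne_zero_iff.2 (hne 0))
  have h4 : HasDerivAt (fun s => g s * s) (g 0) 0 := by
    rw [hasDerivAt_iff_tendsto_slope]
    have : Tendsto g (𝓝[≠] 0) (𝓝 (g 0)) := hg.tendsto.mono_left nhdsWithin_le_nhds
    refine this.congr' ?_
    filter_upwards [self_mem_nhdsWithin] with s hs
    have hs : s ≠ 0 := hs
    simp [slope_def_field, hs]
  rw [h3] at h2
  rw [h2.unique h4]
  simp [g, norm_smul, norm_e0, abs_of_pos hr, div_eq_mul_inv]

theorem radialProfile (hQ : IsGroundState Q) :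
    RadialProfile (fun r : ℝ => Q (r • e0)) (fun r : ℝ => d0R Q (r • e0)) where
  cq := by have := hQ.1.continuous; fun_prop
  cp := by have := hQ.contDiff_d0R.continuous; fun_prop
  dq r _ := hQ.hasDerivAt_ray r
  dp r hr := by
    have h1 : HasDerivAt (fun r : ℝ => r • e0) e0 r := by
      simpa using (hasDerivAt_id r).smul_const e0
    have h2 := ((hQ.contDiff_d0R.differentiable (by norm_num)) (r • e0)).hasFDerivAt.comp_hasDerivAt
      r h1
    have h3 := hQ.2.2.2.2.2 (r • e0)
    unfold lapR at h3
    rw [hQ.fderiv_d1R hr] at h3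
    convert! h2 using 1
    linarith
  pos r := hQ.2.1 _
  iq := by
    have h := hQ.2.2.2.1
    have h1 : (fun x => Q x ^ 2) = fun x : Plane => (fun r : ℝ => Q (r • e0) ^ 2) ‖x‖ := by
      ext x; rw [hQ.eq_radial x]
    rw [h1] at h
    exact (integrable_radial _).1 h
  ip := by
    have h := hQ.2.2.2.2.1
    have h1 : (fun x => ‖fderiv ℝ Q x‖ ^ 2) =ᵐ[volume]
        fun x : Plane => (fun r : ℝ => d0R Q (r • e0) ^ 2) ‖x‖ := by
      filter_upwards [Measure.ae_ne volume (0 : Plane)] with x hx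
      exact hQ.norm_fderiv hx
    exact (integrable_radial _).1 ((integrable_congr h1).1 h)

theorem integral_grad (hQ : IsGroundState Q) : ∫ x, gradSqR Q x = ∫ x, Q x ^ 2 := by
  have h1 : gradSqR Q =ᵐ[volume]
      fun x : Plane => (fun r : ℝ => d0R Q (r • e0) ^ 2) ‖x‖ := by
    filter_upwards [Measure.ae_ne volume (0 : Plane)] with x hx
    rw [gradSqR_eq]
    exact hQ.norm_fderiv hx
  have h2 : (fun x => Q x ^ 2) = fun x : Plane => (fun r : ℝ => Q (r • e0) ^ 2) ‖x‖ := by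
    ext x; rw [hQ.eq_radial x]
  rw [integral_congr_ae h1, h2, integral_radial fun r => d0R Q (r • e0) ^ 2,
    integral_radial fun r => Q (r • e0) ^ 2]
  have := hQ.radialProfile.nehari
  have := hQ.radialProfile.pohozaev
  have h3 : (∫ r in Ioi 0, r * d0R Q (r • e0) ^ 2) = ∫ r in Ioi (0 : ℝ), r * Q (r • e0) ^ 2 := by
    linarith
  rw [h3]

theorem integral_four (hQ : IsGroundState Q) : ∫ x, Q x ^ 4 = 2 * ∫ x, Q x ^ 2 := by
  have h1 : (fun x => Q x ^ 4) = fun x : Plane => (fun r : ℝ => Q (r • e0) ^ 4) ‖x‖ := by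
    ext x; rw [hQ.eq_radial x]
  have h2 : (fun x => Q x ^ 2) = fun x : Plane => (fun r : ℝ => Q (r • e0) ^ 2) ‖x‖ := by
    ext x; rw [hQ.eq_radial x]
  rw [h1, h2, integral_radial fun r => Q (r • e0) ^ 4, integral_radial fun r => Q (r • e0) ^ 2]
  rw [← hQ.radialProfile.pohozaev]
  ring

theorem exp_decay (hQ : IsGroundState Q) : ∃ C, 0 ≤ C ∧ ∀ x, Q x ≤ C * Real.exp (-(‖x‖ / 2)) := by
  obtain ⟨C, hC⟩ := hQ.radialProfile.exp_decay
  refine ⟨C, ?_, fun x => (hQ.eq_radial x).trans_le (hC _ (norm_nonneg x))⟩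
  have := (hQ.2.1 _).le.trans (hC 0 le_rfl)
  simpa using this

end IsGroundState

theorem integrable_exp_neg_norm {b : ℝ} (hb : 0 < b) :
    Integrable (fun x : Plane => Real.exp (-(b * ‖x‖))) := by
  refine (integrable_radial fun r => Real.exp (-(b * r))).2 ?_
  have := integrableOn_rpow_mul_exp_neg_mul_rpow (p := 1) (s := 1) (by norm_num) one_pos hb
  simpa using this

namespace IsGroundState

variable {Q : Plane → ℝ}

theorem sq_le (hQ : IsGroundState Q) : ∃ C, 0 ≤ C ∧ ∀ x, Q x ^ 2 ≤ C * Real.exp (-‖x‖) := by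
  obtain ⟨C, hC0, hC⟩ := hQ.exp_decay
  refine ⟨C ^ 2, sq_nonneg C, fun x => ?_⟩
  refine (pow_le_pow_left₀ (hQ.2.1 x).le (hC x) 2).trans (le_of_eq ?_)
  rw [mul_pow, ← Real.exp_nat_mul]
  congr 2
  push_cast
  ring

theorem profile (hQ : IsGroundState Q) : Profile Q := by
  obtain ⟨C, hC0, hC⟩ := hQ.sq_le
  have hc := hQ.1.continuous
  refine ⟨hQ.1.differentiable (by norm_num), hQ.2.2.2.1, ?_, ?_, ?_⟩
  · exact hQ.2.2.2.2.1.congr (Eventually.of_forall fun x => (gradSqR_eq Q x).symm)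
  · refine ((integrable_exp_neg_norm (b := 1 / 2) (by norm_num)).const_mul (2 * C)).mono'
      (by fun_prop) (Eventually.of_forall fun x => ?_)
    rw [Real.norm_of_nonneg (by positivity)]
    have h1 : ‖x‖ ≤ 2 * Real.exp (1 / 2 * ‖x‖) := by
      have := Real.add_one_le_exp (1 / 2 * ‖x‖)
      linarith
    calc ‖x‖ * Q x ^ 2 ≤ (2 * Real.exp (1 / 2 * ‖x‖)) * (C * Real.exp (-‖x‖)) :=
          mul_le_mul h1 (hC x) (sq_nonneg _) (by positivity)
      _ = 2 * C * (Real.exp (1 / 2 * ‖x‖) * Real.exp (-‖x‖)) := by ring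
      _ = _ := by rw [← Real.exp_add]; congr 2; ring
  · refine (hQ.2.2.2.1.const_mul C).mono' (by fun_prop) (Eventually.of_forall fun x => ?_)
    rw [Real.norm_of_nonneg (by positivity)]
    have h1 : Q x ^ 2 ≤ C := (hC x).trans (mul_le_of_le_one_right hC0
      (Real.exp_le_one_iff.2 (by linarith [norm_nonneg x])))
    have := mul_le_mul_of_nonneg_right h1 (sq_nonneg (Q x))
    linarith

theorem potential_scaled (hQ : IsGroundState Q) {V : Plane → ℝ} (hV : V110 V) {C₀ γ : ℝ}
    (hγ : ∀ x, V x ≤ C₀ * Real.exp (γ * ‖x‖)) : ∃ K, ∀ τ : ℝ, 1 ≤ τ → 2 * γ ≤ τ →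
      Integrable (fun x => V (τ⁻¹ • x) * Q x ^ 2) ∧ ∫ x, V (τ⁻¹ • x) * Q x ^ 2 ≤ K := by
  obtain ⟨C, hC0, hC⟩ := hQ.sq_le
  have hc := hQ.1.continuous
  have hC₀ : 0 ≤ C₀ := by
    have := (hV.2.1 0).trans (hγ 0)
    simpa using this
  have hi := (integrable_exp_neg_norm (b := 1 / 2) (by norm_num)).const_mul (C₀ * C)
  refine ⟨∫ x : Plane, C₀ * C * Real.exp (-(1 / 2 * ‖x‖)), fun τ h1 hτ => ?_⟩
  have hb : ∀ x, V (τ⁻¹ • x) * Q x ^ 2 ≤ C₀ * C * Real.exp (-(1 / 2 * ‖x‖)) := by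
    intro x
    have hτ0 : 0 < τ := by linarith
    have h2 : V (τ⁻¹ • x) ≤ C₀ * Real.exp (1 / 2 * ‖x‖) := by
      refine (hγ _).trans (mul_le_mul_of_nonneg_left (Real.exp_le_exp.2 ?_) hC₀)
      rw [norm_smul, norm_inv, Real.norm_of_nonneg hτ0.le, ← mul_assoc]
      refine mul_le_mul_of_nonneg_right ?_ (norm_nonneg x)
      rw [← div_eq_mul_inv, div_le_iff₀ hτ0]
      linarith
    calc V (τ⁻¹ • x) * Q x ^ 2 ≤ (C₀ * Real.exp (1 / 2 * ‖x‖)) * (C * Real.exp (-‖x‖)) :=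
          mul_le_mul h2 (hC x) (sq_nonneg _) (by positivity)
      _ = C₀ * C * (Real.exp (1 / 2 * ‖x‖) * Real.exp (-‖x‖)) := by ring
      _ = _ := by rw [← Real.exp_add]; congr 2; ring
  have hI : Integrable (fun x => V (τ⁻¹ • x) * Q x ^ 2) := by
    refine hi.mono' ?_ (Eventually.of_forall fun x => ?_)
    · exact ((hV.1.comp (measurable_const_smul τ⁻¹)).mul
        (hc.measurable.pow_const 2)).aestronglyMeasurable
    · rw [Real.norm_of_nonneg (mul_nonneg (hV.2.1 _) (sq_nonneg _))]
      exact hb x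
  exact ⟨hI, integral_mono hI hi hb⟩

theorem astar_pos (hQ : IsGroundState Q) : 0 < ∫ x, Q x ^ 2 := by
  have hc := hQ.1.continuous
  refine (integral_pos_iff_support_of_nonneg (fun x => sq_nonneg (Q x)) hQ.2.2.2.1).2 ?_
  have : Function.support (fun x => Q x ^ 2) = univ := by
    ext x; simp [(hQ.2.1 x).ne']
  rw [this]
  exact (isOpen_univ (X := Plane)).measure_pos _ univ_nonempty

/-- The energy of concentrating ground states is arbitrarily negative near the critical mass. -/
theorem exists_energy_le (hQ : IsGroundState Q) {V : Plane → ℝ} (hV : V110 V) {Ω α : ℝ}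
    (hCV : CondV V Ω α) (M : ℝ) :
    ∀ᶠ a in 𝓝[<] (∫ x, Q x ^ 2), ∃ v ∈ Sset V a, Ea V Ω v ≤ M := by
  obtain ⟨C₀, γ, -, hγ⟩ := hCV.2.2.2.2
  obtain ⟨K, hK⟩ := hQ.potential_scaled hV hγ
  have hm := hQ.astar_pos
  have hG := hQ.integral_grad
  have hP := hQ.integral_four
  set A := ∫ x, Q x ^ 2
  set W := logForm (fun x => Q x ^ 2) (fun x => Q x ^ 2)
  have hlog : Tendsto (fun τ : ℝ => K + 1 / 2 * (W - Real.log τ * A ^ 2)) atTop atBot := by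
    have h1 : Tendsto (fun τ : ℝ => Real.log τ * A ^ 2) atTop atTop :=
      Real.tendsto_log_atTop.atTop_mul_const (by positivity)
    have h2 : Tendsto (fun τ : ℝ => -(1 / 2 * (Real.log τ * A ^ 2))) atTop atBot :=
      tendsto_neg_atTop_atBot.comp (h1.const_mul_atTop one_half_pos)
    refine (tendsto_atBot_add_const_left _ (K + 1 / 2 * W) h2).congr fun τ => ?_
    ring
  obtain ⟨τ, ⟨hτM, hτ1⟩, hτγ⟩ := (((hlog.eventually_lt_atBot M).and
    (eventually_ge_atTop 1)).and (eventually_ge_atTop (2 * γ))).exists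
  have hτ0 : 0 < τ := by linarith
  set F : ℝ → ℝ := fun a => (a / A) * τ ^ 2 * A + (a / A) * K +
    1 / 2 * ((a / A) ^ 2 * (W - Real.log τ * A ^ 2)) - 1 / 2 * ((a / A) ^ 2 * τ ^ 2 * (2 * A))
  have hF : Continuous F := by fun_prop
  have hFA : F A < M := by
    simp only [F, div_self hm.ne']
    linarith
  have h1 : ∀ᶠ a in 𝓝[<] A, F a < M :=
    ((hF.tendsto A).mono_left nhdsWithin_le_nhds).eventually (gt_mem_nhds hFA)
  filter_upwards [h1, Ioo_mem_nhdsLT hm] with a ha ha0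
  obtain ⟨hVi, hVK⟩ := hK τ hτ1 hτγ
  have hc2 : √(a / A) ^ 2 = a / A := Real.sq_sqrt (div_pos ha0.1 hm).le
  have hc4 : √(a / A) ^ 4 = (a / A) ^ 2 := by
    rw [show 4 = 2 * 2 from rfl, pow_mul, hc2]
  refine ⟨scaleFun (√(a / A)) τ Q, ?_, ?_⟩
  · have := scaleFun_mem hQ.profile (√(a / A)) hτ0 hVi
    rwa [hc2, div_mul_cancel₀ _ hm.ne'] at this
  · rw [Ea_scaleFun Ω hQ.profile _ hτ0 hVi, hc2, hc4, hG, hP]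
    refine le_trans ?_ ha.le
    have := mul_le_mul_of_nonneg_left hVK (div_pos ha0.1 hm).le
    simp only [F]
    linarith

end IsGroundState

/-- The interaction form `½ ∫∫ ln|x-y| f(x) g(y) - ½ ∫ f g`. -/
def interForm (f g : Plane → ℝ) : ℝ := 1 / 2 * logForm f g - 1 / 2 * ∫ x, f x * g x

theorem interForm_symm {f g : Plane → ℝ} (hf : LogDens f) (hg : LogDens g) :
    interForm f g = interForm g f := by
  simp only [interForm, logForm_symm hf hg, mul_comm (f _)]

theorem interForm_add_left {f f' g : Plane → ℝ} (hf : LogDens f) (hf' : LogDens f')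
    (hg : LogDens g) : interForm (fun x => f x + f' x) g = interForm f g + interForm f' g := by
  simp only [interForm, logForm_add_left hf hf' hg, add_mul]
  rw [integral_add (hf.integrable_mul hg) (hf'.integrable_mul hg)]
  ring

theorem interForm_smul_left (c : ℝ) (f g : Plane → ℝ) :
    interForm (fun x => c * f x) g = c * interForm f g := by
  simp only [interForm, logForm_smul_left, mul_assoc]
  rw [integral_const_mul]
  ring

theorem interForm_add_smul_self {f g : Plane → ℝ} (hf : LogDens f) (hg : LogDens g) (t : ℝ) :
    interForm (fun x => f x + t * g x) (fun x => f x + t * g x) =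
      interForm f f + 2 * t * interForm g f + t ^ 2 * interForm g g := by
  have h1 := hg.smul t
  have h2 := hf.add h1
  rw [interForm_add_left hf h1 h2, interForm_smul_left, interForm_symm hf h2,
    interForm_symm hg h2, interForm_add_left hf h1 hf, interForm_add_left hf h1 hg,
    interForm_smul_left, interForm_smul_left, interForm_symm hf hg]
  ring

/-- The density of the quadratic part of the energy. -/
def kinDens (V : Plane → ℝ) (Ω : ℝ) (u : Plane → ℂ) (x : Plane) : ℝ :=
  gradSq u x + V x * ‖u x‖ ^ 2 - Ω * momentum u x

theorem InH.integrable_norm_sq_mul {V : Plane → ℝ} (hV : V110 V) {u : Plane → ℂ} (hu : InH V u) :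
    Integrable (fun x => ‖x‖ ^ 2 * ‖u x‖ ^ 2) := by
  obtain ⟨c, hc, R, hR⟩ := hV.2.2.2
  refine ((hu.1.2.1.const_mul (R ^ 2)).add (hu.2.const_mul c⁻¹)).mono' ?_
    (Eventually.of_forall fun x => ?_)
  · have := hu.1.1.continuous
    fun_prop
  · rw [Real.norm_of_nonneg (by positivity)]
    have hVx := hV.2.1 x
    simp only [Pi.add_apply]
    rw [← mul_assoc, ← add_mul]
    refine mul_le_mul_of_nonneg_right ?_ (sq_nonneg _)
    rcases le_total R ‖x‖ with h | h
    · have := hR x h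
      have h1 : ‖x‖ ^ 2 ≤ c⁻¹ * V x := by rwa [le_inv_mul_iff₀ hc]
      linarith [sq_nonneg R]
    · have h1 : ‖x‖ ^ 2 ≤ R ^ 2 := pow_le_pow_left₀ (norm_nonneg x) h 2
      have h2 : 0 ≤ c⁻¹ * V x := by positivity
      linarith

theorem abs_mul_im_le (s : ℝ) (a b : ℂ) :
    |s * ((starRingEnd ℂ) a * b).im| ≤ s ^ 2 * ‖a‖ ^ 2 + ‖b‖ ^ 2 := by
  have h1 : |((starRingEnd ℂ) a * b).im| ≤ ‖a‖ * ‖b‖ := by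
    refine (Complex.abs_im_le_norm _).trans ?_
    rw [norm_mul, RCLike.norm_conj]
  rw [abs_mul]
  have h2 := mul_le_mul_of_nonneg_left h1 (abs_nonneg s)
  have h3 : s ^ 2 = |s| ^ 2 := (sq_abs s).symm
  rw [h3]
  nlinarith [sq_nonneg (|s| * ‖a‖ - ‖b‖), sq_nonneg (|s| * ‖a‖), sq_nonneg ‖b‖]

theorem measurable_momentum {u : Plane → ℂ} (hu : Differentiable ℝ u) :
    Measurable (momentum u) := by
  have h0 := measurable_d0 u
  have h1 := measurable_d1 u
  have hc : Measurable fun x => (starRingEnd ℂ) (u x) :=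
    Complex.continuous_conj.measurable.comp hu.continuous.measurable
  have c0 : Measurable fun x : Plane => x 0 := by fun_prop
  have c1 : Measurable fun x : Plane => x 1 := by fun_prop
  exact (c1.neg.mul (Complex.measurable_im.comp (hc.mul h0))).add
    (c0.mul (Complex.measurable_im.comp (hc.mul h1)))

theorem abs_momentum_le (u : Plane → ℂ) (x : Plane) :
    |momentum u x| ≤ ‖x‖ ^ 2 * ‖u x‖ ^ 2 + gradSq u x := by
  have h0 := abs_mul_im_le (-(x 1)) (u x) (d0 u x)
  have h1 := abs_mul_im_le (x 0) (u x) (d1 u x)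
  refine (abs_add_le _ _).trans ((add_le_add h0 h1).trans (le_of_eq ?_))
  rw [plane_norm_sq, gradSq]
  ring

theorem InH.integrable_momentum {V : Plane → ℝ} (hV : V110 V) {u : Plane → ℂ} (hu : InH V u) :
    Integrable (momentum u) :=
  ((hu.integrable_norm_sq_mul hV).add hu.1.2.2).mono'
    (measurable_momentum hu.1.1).aestronglyMeasurable
    (Eventually.of_forall fun x => abs_momentum_le u x)

theorem InH.integrable_kinDens {V : Plane → ℝ} (hV : V110 V) {u : Plane → ℂ} (hu : InH V u)
    (Ω : ℝ) : Integrable (kinDens V Ω u) :=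
  (hu.1.2.2.add hu.2).sub ((hu.integrable_momentum hV).const_mul Ω)

theorem InH.logDens {V : Plane → ℝ} (hV : V110 V) {u : Plane → ℂ} (hu : InH V u)
    (h4 : Integrable (fun x => ‖u x‖ ^ 4)) : LogDens (fun x => ‖u x‖ ^ 2) where
  int := hu.1.2.1
  mom := by
    refine (hu.1.2.1.add (hu.integrable_norm_sq_mul hV)).mono' ?_ (Eventually.of_forall fun x => ?_)
    · have := hu.1.1.continuous
      fun_prop
    · rw [Real.norm_of_nonneg (by positivity)]
      simp only [Pi.add_apply]
      nlinarith [mul_nonneg (sq_nonneg (‖x‖ - 1)) (sq_nonneg ‖u x‖), sq_nonneg (‖x‖ * ‖u x‖),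
        sq_nonneg ‖u x‖]
  sq := by simpa only [← pow_mul] using h4

theorem Ea_eq_kinDens {V : Plane → ℝ} (hV : V110 V) {u : Plane → ℂ} (hu : InH V u) (Ω : ℝ) :
    Ea V Ω u = (∫ x, kinDens V Ω u x) +
      interForm (fun x => ‖u x‖ ^ 2) (fun x => ‖u x‖ ^ 2) := by
  have h1 : Integrable (fun x => gradSq u x + V x * ‖u x‖ ^ 2) := hu.1.2.2.add hu.2
  simp only [kinDens]
  rw [integral_sub h1 ((hu.integrable_momentum hV).const_mul Ω), integral_const_mul, Ea, interForm]
  have : ∀ x, ‖u x‖ ^ 4 = ‖u x‖ ^ 2 * ‖u x‖ ^ 2 := fun x => by ring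
  simp only [this]
  change _ + 1 / 2 * logForm _ _ - _ - _ = _
  ring

theorem d0_const_mul {u : Plane → ℂ} (hu : Differentiable ℝ u) (c : ℂ) (x : Plane) :
    d0 (fun y => c * u y) x = c * d0 u x := by
  rw [d0, fderiv_const_mul (hu x)]; rfl

theorem d1_const_mul {u : Plane → ℂ} (hu : Differentiable ℝ u) (c : ℂ) (x : Plane) :
    d1 (fun y => c * u y) x = c * d1 u x := by
  rw [d1, fderiv_const_mul (hu x)]; rfl

theorem gradSq_const_mul {u : Plane → ℂ} (hu : Differentiable ℝ u) (c : ℂ) (x : Plane) :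
    gradSq (fun y => c * u y) x = ‖c‖ ^ 2 * gradSq u x := by
  rw [gradSq, d0_const_mul hu, d1_const_mul hu, norm_mul, norm_mul, gradSq]; ring

theorem im_conj_mul_const (c a b : ℂ) :
    ((starRingEnd ℂ) (c * a) * (c * b)).im = ‖c‖ ^ 2 * ((starRingEnd ℂ) a * b).im := by
  rw [Complex.sq_norm, Complex.normSq_apply]
  simp
  ring

theorem kinDens_const_mul {u : Plane → ℂ} (hu : Differentiable ℝ u) (V : Plane → ℝ) (Ω : ℝ) (c : ℂ)
    (x : Plane) : kinDens V Ω (fun y => c * u y) x = ‖c‖ ^ 2 * kinDens V Ω u x := by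
  rw [kinDens, gradSq_const_mul hu, momentum, d0_const_mul hu, d1_const_mul hu, im_conj_mul_const,
    im_conj_mul_const, norm_mul, kinDens, momentum]
  ring

theorem InH.const_mul {V : Plane → ℝ} {u : Plane → ℂ} (hu : InH V u) (c : ℂ) :
    InH V (fun y => c * u y) := by
  refine ⟨⟨hu.1.1.const_mul c, ?_, ?_⟩, ?_⟩
  · simp only [norm_mul, mul_pow]
    exact hu.1.2.1.const_mul _
  · have : gradSq (fun y => c * u y) = fun x => ‖c‖ ^ 2 * gradSq u x :=
      funext (gradSq_const_mul hu.1.1 c)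
    rw [this]
    exact hu.1.2.2.const_mul _
  · refine (hu.2.const_mul (‖c‖ ^ 2)).congr (Eventually.of_forall fun x => ?_)
    simp only [norm_mul]
    ring

theorem Ea_const_mul {V : Plane → ℝ} (hV : V110 V) {u : Plane → ℂ} (hu : InH V u) (Ω : ℝ) (c : ℂ) :
    Ea V Ω (fun y => c * u y) = ‖c‖ ^ 2 * (∫ x, kinDens V Ω u x) +
      ‖c‖ ^ 4 * interForm (fun x => ‖u x‖ ^ 2) (fun x => ‖u x‖ ^ 2) := by
  rw [Ea_eq_kinDens hV (hu.const_mul c)]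
  simp only [kinDens_const_mul hu.1.1, integral_const_mul, norm_mul, mul_pow]
  congr 1
  simp only [interForm, logForm_eq, logPot]
  simp only [mul_left_comm _ (‖c‖ ^ 2), integral_const_mul, mul_assoc]
  ring

theorem IsMinimizer.const_mul {V : Plane → ℝ} (hV : V110 V) {Ω a : ℝ} {u : Plane → ℂ}
    (hu : IsMinimizer V Ω a u) {c : ℂ} (hc : ‖c‖ = 1) :
    IsMinimizer V Ω a (fun y => c * u y) := by
  refine ⟨⟨hu.1.1.const_mul c, ?_⟩, fun v hv => ?_⟩
  · simpa only [norm_mul, hc, one_mul] using hu.1.2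
  · rw [Ea_const_mul hV hu.1.1, hc]
    have := hu.2 v hv
    rw [Ea_eq_kinDens hV hu.1.1] at this
    simpa using this

/-- The homogeneous form of minimality. -/
theorem IsMinimizer.homogeneous {V : Plane → ℝ} (hV : V110 V) {Ω a : ℝ} (ha : 0 < a)
    {u : Plane → ℂ} (hu : IsMinimizer V Ω a u) {v : Plane → ℂ} (hv : InH V v)
    (hm : 0 < ∫ x, ‖v x‖ ^ 2) :
    Ea V Ω u * (∫ x, ‖v x‖ ^ 2) ^ 2 ≤ a * (∫ x, ‖v x‖ ^ 2) * (∫ x, kinDens V Ω v x) +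
      a ^ 2 * interForm (fun x => ‖v x‖ ^ 2) (fun x => ‖v x‖ ^ 2) := by
  set m := ∫ x, ‖v x‖ ^ 2
  set c : ℂ := ((√(a / m) : ℝ) : ℂ)
  have hc : ‖c‖ ^ 2 = a / m := by
    rw [Complex.norm_real, Real.norm_eq_abs, sq_abs, Real.sq_sqrt (by positivity)]
  have h := hu.2 (fun y => c * v y) ⟨hv.const_mul c, by
    simp only [norm_mul, mul_pow, hc]
    rw [integral_const_mul]
    exact div_mul_cancel₀ _ hm.ne'⟩
  rw [Ea_const_mul hV hv, show 4 = 2 * 2 from rfl, pow_mul, hc] at h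
  have := mul_le_mul_of_nonneg_right h (sq_nonneg m)
  refine this.trans (le_of_eq ?_)
  field_simp

theorem d0R_re {u : Plane → ℂ} {x : Plane} (hu : DifferentiableAt ℝ u x) :
    d0R (fun y => (u y).re) x = (d0 u x).re := by
  have h := Complex.reCLM.hasFDerivAt.comp x hu.hasFDerivAt
  have h2 : fderiv ℝ (fun y => (u y).re) x = Complex.reCLM.comp (fderiv ℝ u x) := h.fderiv
  rw [d0R, h2]; rfl

theorem d1R_re {u : Plane → ℂ} {x : Plane} (hu : DifferentiableAt ℝ u x) :
    d1R (fun y => (u y).re) x = (d1 u x).re := by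
  have h := Complex.reCLM.hasFDerivAt.comp x hu.hasFDerivAt
  have h2 : fderiv ℝ (fun y => (u y).re) x = Complex.reCLM.comp (fderiv ℝ u x) := h.fderiv
  rw [d1R, h2]; rfl

theorem d0R_im {u : Plane → ℂ} {x : Plane} (hu : DifferentiableAt ℝ u x) :
    d0R (fun y => (u y).im) x = (d0 u x).im := by
  have h := Complex.imCLM.hasFDerivAt.comp x hu.hasFDerivAt
  have h2 : fderiv ℝ (fun y => (u y).im) x = Complex.imCLM.comp (fderiv ℝ u x) := h.fderiv
  rw [d0R, h2]; rfl

theorem d1R_im {u : Plane → ℂ} {x : Plane} (hu : DifferentiableAt ℝ u x) :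
    d1R (fun y => (u y).im) x = (d1 u x).im := by
  have h := Complex.imCLM.hasFDerivAt.comp x hu.hasFDerivAt
  have h2 : fderiv ℝ (fun y => (u y).im) x = Complex.imCLM.comp (fderiv ℝ u x) := h.fderiv
  rw [d1R, h2]; rfl

/-- Variation of `u` in a real direction `ψ`. -/
def perturb (u : Plane → ℂ) (ψ : Plane → ℝ) (t : ℝ) (x : Plane) : ℂ := u x + ((t * ψ x : ℝ) : ℂ)

theorem hasFDerivAt_perturb {u : Plane → ℂ} {ψ : Plane → ℝ} (hu : Differentiable ℝ u)
    (hψ : Differentiable ℝ ψ) (t : ℝ) (x : Plane) :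
    HasFDerivAt (perturb u ψ t) (fderiv ℝ u x + Complex.ofRealCLM.comp (t • fderiv ℝ ψ x)) x := by
  have h1 : HasFDerivAt (fun x => t * ψ x) (t • fderiv ℝ ψ x) x := (hψ x).hasFDerivAt.const_mul t
  exact (hu x).hasFDerivAt.add (Complex.ofRealCLM.hasFDerivAt.comp x h1)

theorem d0_perturb {u : Plane → ℂ} {ψ : Plane → ℝ} (hu : Differentiable ℝ u)
    (hψ : Differentiable ℝ ψ) (t : ℝ) (x : Plane) :
    d0 (perturb u ψ t) x = d0 u x + ((t * d0R ψ x : ℝ) : ℂ) := by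
  rw [d0, (hasFDerivAt_perturb hu hψ t x).fderiv]; rfl

theorem d1_perturb {u : Plane → ℂ} {ψ : Plane → ℝ} (hu : Differentiable ℝ u)
    (hψ : Differentiable ℝ ψ) (t : ℝ) (x : Plane) :
    d1 (perturb u ψ t) x = d1 u x + ((t * d1R ψ x : ℝ) : ℂ) := by
  rw [d1, (hasFDerivAt_perturb hu hψ t x).fderiv]; rfl

theorem norm_sq_add_ofReal (z : ℂ) (s : ℝ) :
    ‖z + (s : ℂ)‖ ^ 2 = ‖z‖ ^ 2 + 2 * (z.re * s) + s ^ 2 := by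
  rw [Complex.sq_norm, Complex.sq_norm, Complex.normSq_apply, Complex.normSq_apply]
  simp
  ring

/-- The linearised gradient density. -/
def gradCross (u : Plane → ℂ) (ψ : Plane → ℝ) (x : Plane) : ℝ :=
  (d0 u x).re * d0R ψ x + (d1 u x).re * d1R ψ x

/-- The linearised momentum density. -/
def momCross (u : Plane → ℂ) (ψ : Plane → ℝ) (x : Plane) : ℝ :=
  -(x 1) * (ψ x * (d0 u x).im - (u x).im * d0R ψ x) +
    x 0 * (ψ x * (d1 u x).im - (u x).im * d1R ψ x)

/-- The linearised density of the quadratic part of the energy. -/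
def kinCross (V : Plane → ℝ) (Ω : ℝ) (u : Plane → ℂ) (ψ : Plane → ℝ) (x : Plane) : ℝ :=
  gradCross u ψ x + V x * ((u x).re * ψ x) - Ω / 2 * momCross u ψ x

theorem norm_sq_perturb (u : Plane → ℂ) (ψ : Plane → ℝ) (t : ℝ) (x : Plane) :
    ‖perturb u ψ t x‖ ^ 2 = ‖u x‖ ^ 2 + t * (2 * ((u x).re * ψ x) + t * ψ x ^ 2) := by
  rw [perturb, norm_sq_add_ofReal]; ring

theorem gradSq_perturb {u : Plane → ℂ} {ψ : Plane → ℝ} (hu : Differentiable ℝ u)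
    (hψ : Differentiable ℝ ψ) (t : ℝ) (x : Plane) :
    gradSq (perturb u ψ t) x = gradSq u x + 2 * t * gradCross u ψ x + t ^ 2 * gradSqR ψ x := by
  rw [gradSq, d0_perturb hu hψ, d1_perturb hu hψ, norm_sq_add_ofReal, norm_sq_add_ofReal, gradSq,
    gradCross, gradSqR]
  ring

theorem kinDens_perturb {u : Plane → ℂ} {ψ : Plane → ℝ} (hu : Differentiable ℝ u)
    (hψ : Differentiable ℝ ψ) (V : Plane → ℝ) (Ω t : ℝ) (x : Plane) :
    kinDens V Ω (perturb u ψ t) x = kinDens V Ω u x + 2 * t * kinCross V Ω u ψ x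
      + t ^ 2 * (gradSqR ψ x + V x * ψ x ^ 2) := by
  rw [kinDens, gradSq_perturb hu hψ, norm_sq_perturb, momentum, d0_perturb hu hψ,
    d1_perturb hu hψ, kinDens, kinCross, momentum, momCross, perturb]
  simp
  ring

/-- Test functions of class `C¹` with compact support. -/
structure TestFun (ψ : Plane → ℝ) : Prop where
  smooth : ContDiff ℝ 1 ψ
  supp : HasCompactSupport ψ

namespace TestFun

variable {ψ : Plane → ℝ}

theorem diff (h : TestFun ψ) : Differentiable ℝ ψ := h.smooth.differentiable (by norm_num)

theorem continuous_d0R (h : TestFun ψ) : Continuous (d0R ψ) :=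
  (h.smooth.continuous_fderiv (by norm_num)).clm_apply continuous_const

theorem continuous_d1R (h : TestFun ψ) : Continuous (d1R ψ) :=
  (h.smooth.continuous_fderiv (by norm_num)).clm_apply continuous_const

theorem supp_d0R (h : TestFun ψ) : HasCompactSupport (d0R ψ) :=
  (h.supp.fderiv (𝕜 := ℝ)).mono fun x hx => by
    rw [Function.mem_support] at hx ⊢
    exact fun h0 => hx (by rw [d0R, h0]; rfl)

theorem supp_d1R (h : TestFun ψ) : HasCompactSupport (d1R ψ) :=
  (h.supp.fderiv (𝕜 := ℝ)).mono fun x hx => by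
    rw [Function.mem_support] at hx ⊢
    exact fun h0 => hx (by rw [d1R, h0]; rfl)

end TestFun

theorem integrable_mul_of_hasCompactSupport {f g : Plane → ℝ} (hf : Continuous f)
    (hg : Continuous g) (hc : HasCompactSupport g) : Integrable (fun x => f x * g x) :=
  (hf.mul hg).integrable_of_hasCompactSupport hc.mul_left

theorem LogDens.of_hasCompactSupport {g : Plane → ℝ} (hg : Continuous g)
    (hc : HasCompactSupport g) : LogDens g where
  int := hg.integrable_of_hasCompactSupport hc
  mom := integrable_mul_of_hasCompactSupport continuous_norm hg hc
  sq := integrable_pow_of_hasCompactSupport hg hc two_ne_zero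

theorem integrable_mul_of_locallyBounded {V : Plane → ℝ} (hV : V110 V) {g : Plane → ℝ}
    (hg : Continuous g) (hc : HasCompactSupport g) : Integrable (fun x => V x * g x) := by
  obtain ⟨R, hR⟩ := hc.isBounded.subset_closedBall 0
  obtain ⟨C, hC⟩ := hV.2.2.1 R
  refine ((hg.integrable_of_hasCompactSupport hc).norm.const_mul C).mono'
    (hV.1.mul hg.measurable).aestronglyMeasurable (Eventually.of_forall fun x => ?_)
  rw [norm_mul, Real.norm_of_nonneg (hV.2.1 x)]
  by_cases hx : x ∈ tsupport g
  · exact mul_le_mul_of_nonneg_right (hC x (by simpa using hR hx)) (norm_nonneg _)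
  · simp [image_eq_zero_of_notMem_tsupport hx]

theorem integrable_mul_of_sq {f g : Plane → ℝ} (hf : Measurable f) (hg : Measurable g)
    {F : Plane → ℝ} (hF : Integrable F) (hfF : ∀ x, f x ^ 2 ≤ F x)
    (hg2 : Integrable (fun x => g x ^ 2)) : Integrable (fun x => f x * g x) := by
  refine (hF.add hg2).mono' (hf.mul hg).aestronglyMeasurable (Eventually.of_forall fun x => ?_)
  have := hfF x
  simp only [Pi.add_apply]
  rw [Real.norm_eq_abs, abs_le]
  constructor <;> nlinarith [sq_nonneg (f x + g x), sq_nonneg (f x - g x), sq_nonneg (g x),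
    sq_nonneg (f x)]

section

variable {u : Plane → ℂ} {ψ : Plane → ℝ}

theorem re_sq_le_gradSq (u : Plane → ℂ) (x : Plane) : (d0 u x).re ^ 2 ≤ gradSq u x ∧
    (d1 u x).re ^ 2 ≤ gradSq u x ∧ (d0 u x).im ^ 2 ≤ gradSq u x ∧ (d1 u x).im ^ 2 ≤ gradSq u x := by
  rw [gradSq, Complex.sq_norm, Complex.sq_norm, Complex.normSq_apply, Complex.normSq_apply]
  refine ⟨?_, ?_, ?_, ?_⟩ <;> nlinarith [sq_nonneg (d0 u x).re, sq_nonneg (d0 u x).im,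
    sq_nonneg (d1 u x).re, sq_nonneg (d1 u x).im]

theorem integrable_gradCross (hu : InH1 u) (hψ : TestFun ψ) : Integrable (gradCross u ψ) :=
  (integrable_mul_of_sq (Complex.measurable_re.comp (measurable_d0 u))
    hψ.continuous_d0R.measurable hu.2.2 (fun x => (re_sq_le_gradSq u x).1)
    (integrable_pow_of_hasCompactSupport hψ.continuous_d0R hψ.supp_d0R two_ne_zero)).add
  (integrable_mul_of_sq (Complex.measurable_re.comp (measurable_d1 u))
    hψ.continuous_d1R.measurable hu.2.2 (fun x => (re_sq_le_gradSq u x).2.1)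
    (integrable_pow_of_hasCompactSupport hψ.continuous_d1R hψ.supp_d1R two_ne_zero))

/-- The rotational part of the Euler–Lagrange equation. -/
def rotIm (u : Plane → ℂ) (x : Plane) : ℝ := -(x 1) * (d0 u x).im + x 0 * (d1 u x).im

theorem integrable_rotIm_mul (hu : InH1 u) (hψ : TestFun ψ) :
    Integrable (fun x => rotIm u x * ψ x) := by
  have c0 : Continuous fun x : Plane => x 0 := by fun_prop
  have c1 : Continuous fun x : Plane => -(x 1) := by fun_prop
  have s0 : HasCompactSupport (fun x : Plane => -(x 1) * ψ x) := hψ.supp.mul_left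
  have s1 : HasCompactSupport (fun x : Plane => x 0 * ψ x) := hψ.supp.mul_left
  have hc := hψ.smooth.continuous
  have h0 := integrable_mul_of_sq (Complex.measurable_im.comp (measurable_d0 u))
    (c1.mul hc).measurable hu.2.2 (fun x => (re_sq_le_gradSq u x).2.2.1)
    (integrable_pow_of_hasCompactSupport (c1.mul hc) s0 two_ne_zero)
  have h1 := integrable_mul_of_sq (Complex.measurable_im.comp (measurable_d1 u))
    (c0.mul hc).measurable hu.2.2 (fun x => (re_sq_le_gradSq u x).2.2.2)
    (integrable_pow_of_hasCompactSupport (c0.mul hc) s1 two_ne_zero)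
  refine (h0.add h1).congr (Eventually.of_forall fun x => ?_)
  simp [rotIm]
  ring

theorem integral_fderiv_eq_zero {f : Plane → ℝ} (hf : Differentiable ℝ f) (v : Plane)
    (hi : Integrable f) (hi' : Integrable (fun x => fderiv ℝ f x v)) :
    ∫ x, fderiv ℝ f x v = 0 := by
  have := integral_mul_fderiv_eq_neg_fderiv_mul_of_integrable (μ := (volume : Measure Plane))
    (f := fun _ => (1 : ℝ)) (g := f) (v := v) (by simp) (by simpa using hi') (by simpa using hi)
    (fun x _ => by fun_prop) (fun x _ => hf x)
  simpa using this

theorem integral_momCross (hu : InH1 u) (hψ : TestFun ψ) :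
    Integrable (momCross u ψ) ∧ ∫ x, momCross u ψ x = 2 * ∫ x, rotIm u x * ψ x := by
  have c0 : Continuous fun x : Plane => x 0 := by fun_prop
  have c1 : Continuous fun x : Plane => -(x 1) := by fun_prop
  have hui : Continuous fun x => (u x).im := Complex.continuous_im.comp hu.1.continuous
  have hdu : Differentiable ℝ fun x => (u x).im := Complex.imCLM.differentiable.comp hu.1
  have hr := integrable_rotIm_mul hu hψ
  have p0 : Differentiable ℝ fun x : Plane => x 0 := by fun_prop
  have p1 : Differentiable ℝ fun x : Plane => -(x 1) := by fun_prop
  have hw : Differentiable ℝ fun x => (u x).im * ψ x := hdu.mul hψ.diff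
  set F0 : Plane → ℝ := fun x => -(x 1) * ((u x).im * ψ x)
  set F1 : Plane → ℝ := fun x => x 0 * ((u x).im * ψ x)
  have hF0 : Differentiable ℝ F0 := p1.mul hw
  have hF1 : Differentiable ℝ F1 := p0.mul hw
  have hw' : ∀ x v, fderiv ℝ (fun x => (u x).im * ψ x) x v =
      (u x).im * fderiv ℝ ψ x v + ψ x * (fderiv ℝ (fun x => (u x).im) x v) := fun x v => by
    rw [fderiv_fun_mul (hdu x) (hψ.diff x)]; simp
  have e0 : ∀ x, fderiv ℝ F0 x e0 = -(x 1) * ((u x).im * d0R ψ x + ψ x * (d0 u x).im) := by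
    intro x
    rw [fderiv_fun_mul (p1 x) (hw x)]
    have : fderiv ℝ (fun x : Plane => -(x 1)) x e0 = 0 := by
      have : HasFDerivAt (fun x : Plane => -(x 1))
        (-(EuclideanSpace.proj (1 : Fin 2) : Plane →L[ℝ] ℝ)) x :=
        (EuclideanSpace.proj (1 : Fin 2) : Plane →L[ℝ] ℝ).hasFDerivAt.neg
      rw [this.fderiv]
      simp [_root_.e0]
    simp only [add_apply, smul_apply, smul_eq_mul, this, hw',
      ← d0R_im (hu.1 x), d0R, mul_zero, add_zero]
  have e1 : ∀ x, fderiv ℝ F1 x e1 = x 0 * ((u x).im * d1R ψ x + ψ x * (d1 u x).im) := by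
    intro x
    rw [fderiv_fun_mul (p0 x) (hw x)]
    have : fderiv ℝ (fun x : Plane => x 0) x e1 = 0 := by
      have : HasFDerivAt (fun x : Plane => x 0) ((EuclideanSpace.proj (0 : Fin 2) : Plane →L[ℝ] ℝ))
        x :=
        (EuclideanSpace.proj (0 : Fin 2) : Plane →L[ℝ] ℝ).hasFDerivAt
      rw [this.fderiv]
      simp [_root_.e1]
    simp only [add_apply, smul_apply, smul_eq_mul, this, hw',
      ← d1R_im (hu.1 x), d1R, mul_zero, add_zero]
  have hcψ := hψ.smooth.continuous
  have s0 : HasCompactSupport (fun x : Plane => -(x 1) * ψ x) := hψ.supp.mul_left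
  have s1 : HasCompactSupport (fun x : Plane => x 0 * ψ x) := hψ.supp.mul_left
  have a0 := integrable_mul_of_sq (Complex.measurable_im.comp (measurable_d0 u))
    (c1.mul hcψ).measurable hu.2.2 (fun x => (re_sq_le_gradSq u x).2.2.1)
    (integrable_pow_of_hasCompactSupport (c1.mul hcψ) s0 two_ne_zero)
  have a1 := integrable_mul_of_sq (Complex.measurable_im.comp (measurable_d1 u))
    (c0.mul hcψ).measurable hu.2.2 (fun x => (re_sq_le_gradSq u x).2.2.2)
    (integrable_pow_of_hasCompactSupport (c0.mul hcψ) s1 two_ne_zero)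
  have b0 := integrable_mul_of_hasCompactSupport (c1.mul hui) hψ.continuous_d0R hψ.supp_d0R
  have b1 := integrable_mul_of_hasCompactSupport (c0.mul hui) hψ.continuous_d1R hψ.supp_d1R
  have i0 : Integrable (fun x => fderiv ℝ F0 x _root_.e0) :=
    (a0.add b0).congr (Eventually.of_forall fun x => by simp [e0]; ring)
  have i1 : Integrable (fun x => fderiv ℝ F1 x _root_.e1) :=
    (a1.add b1).congr (Eventually.of_forall fun x => by simp [e1]; ring)
  have z0 := integral_fderiv_eq_zero hF0 _ ((integrable_mul_of_hasCompactSupport (c1.mul hui)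
    hcψ hψ.supp).congr (Eventually.of_forall fun x => by simp [F0]; ring)) i0
  have z1 := integral_fderiv_eq_zero hF1 _ ((integrable_mul_of_hasCompactSupport (c0.mul hui)
    hcψ hψ.supp).congr (Eventually.of_forall fun x => by simp [F1]; ring)) i1
  have hid : momCross u ψ = fun x => 2 * (rotIm u x * ψ x) -
      (fderiv ℝ F0 x _root_.e0 + fderiv ℝ F1 x _root_.e1) := by
    ext x
    rw [e0, e1, momCross, rotIm]
    ring
  have i01 : Integrable (fun x => fderiv ℝ F0 x _root_.e0 + fderiv ℝ F1 x _root_.e1) := i0.add i1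
  rw [hid]
  refine ⟨(hr.const_mul 2).sub i01, ?_⟩
  rw [integral_sub (hr.const_mul 2) i01, integral_add i0 i1, z0, z1, integral_const_mul]
  ring

end

theorem InH.perturb {V : Plane → ℝ} (hV : V110 V) {u : Plane → ℂ} (hu : InH V u) {ψ : Plane → ℝ}
    (hψ : TestFun ψ) (t : ℝ) : InH V (perturb u ψ t) := by
  have hc := hψ.smooth.continuous
  have hur : Continuous fun x => (u x).re := Complex.continuous_re.comp hu.1.1.continuous
  refine ⟨⟨fun x => (hasFDerivAt_perturb hu.1.1 hψ.diff t x).differentiableAt, ?_, ?_⟩, ?_⟩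
  · refine (hu.1.2.1.add (((integrable_mul_of_hasCompactSupport hur hc hψ.supp).const_mul
      (t * 2)).add ((integrable_pow_of_hasCompactSupport hc hψ.supp two_ne_zero).const_mul
      (t * t)))).congr (Eventually.of_forall fun x => ?_)
    simp [norm_sq_perturb]; ring
  · have i0 := integrable_pow_of_hasCompactSupport hψ.continuous_d0R hψ.supp_d0R two_ne_zero
    have i1 := integrable_pow_of_hasCompactSupport hψ.continuous_d1R hψ.supp_d1R two_ne_zero
    refine ((hu.1.2.2.add ((integrable_gradCross hu.1 hψ).const_mul (2 * t))).add
      ((i0.add i1).const_mul (t ^ 2))).congr (Eventually.of_forall fun x => ?_)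
    simp [gradSq_perturb hu.1.1 hψ.diff, gradSqR]
  · have h1 := integrable_mul_of_locallyBounded hV (hur.mul hc) hψ.supp.mul_left
    have h2 := integrable_mul_of_locallyBounded hV (hc.mul hc) hψ.supp.mul_left
    refine (hu.2.add ((h1.const_mul (t * 2)).add (h2.const_mul (t * t)))).congr
      (Eventually.of_forall fun x => ?_)
    simp [norm_sq_perturb]; ring

theorem eq_zero_of_local_min_polynomial {f : ℝ → ℝ} {c : ℝ} (hd : HasDerivAt f c 0)
    (h0 : f 0 = 0) (h : ∀ᶠ t in 𝓝 0, 0 ≤ f t) : c = 0 :=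
  IsLocalMin.hasDerivAt_eq_zero (by filter_upwards [h] with t ht; rwa [h0]) hd

/-- The Lagrange multiplier produced by the homogeneous form of minimality. -/
def lagr (V : Plane → ℝ) (Ω a : ℝ) (u : Plane → ℂ) : ℝ :=
  (Ea V Ω u + interForm (fun x => ‖u x‖ ^ 2) (fun x => ‖u x‖ ^ 2)) / a

/-- The zeroth-order coefficient of the linearised Euler–Lagrange equation. -/
def coeffEL (V : Plane → ℝ) (Ω a : ℝ) (u : Plane → ℂ) (x : Plane) : ℝ :=
  V x + logPot (fun y => ‖u y‖ ^ 2) x - ‖u x‖ ^ 2 - lagr V Ω a u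

theorem IsMinimizer.first_variation {V : Plane → ℝ} (hV : V110 V) {Ω a : ℝ} (ha : 0 < a)
    {u : Plane → ℂ} (hu : IsMinimizer V Ω a u) (h4 : Integrable (fun x => ‖u x‖ ^ 4))
    {ψ : Plane → ℝ} (hψ : TestFun ψ) :
    (∫ x, kinCross V Ω u ψ x) + 2 * interForm (fun x => (u x).re * ψ x) (fun x => ‖u x‖ ^ 2) =
      lagr V Ω a u * ∫ x, (u x).re * ψ x := by
  have hc := hψ.smooth.continuous
  have hH := hu.1.1
  have hur : Continuous fun x => (u x).re := Complex.continuous_re.comp hH.1.1.continuous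
  have hρ := hH.logDens hV h4
  have hσ : LogDens (fun x => (u x).re * ψ x) :=
    LogDens.of_hasCompactSupport (hur.mul hc) hψ.supp.mul_left
  have hχ : LogDens (fun x => ψ x ^ 2) := by
    refine LogDens.of_hasCompactSupport (hc.pow 2) ?_
    simp only [pow_two]
    exact hψ.supp.mul_left
  have hk1 : Integrable (kinCross V Ω u ψ) :=
    ((integrable_gradCross hH.1 hψ).add (integrable_mul_of_locallyBounded hV (hur.mul hc)
      hψ.supp.mul_left)).sub ((integral_momCross hH.1 hψ).1.const_mul (Ω / 2))
  have hk2 : Integrable (fun x => gradSqR ψ x + V x * ψ x ^ 2) := by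
    have i0 := integrable_pow_of_hasCompactSupport hψ.continuous_d0R hψ.supp_d0R two_ne_zero
    have i1 := integrable_pow_of_hasCompactSupport hψ.continuous_d1R hψ.supp_d1R two_ne_zero
    have h2 := integrable_mul_of_locallyBounded hV (hc.mul hc) hψ.supp.mul_left
    simp only [← pow_two] at h2
    exact (i0.add i1).add h2
  have hk0 := hH.integrable_kinDens hV Ω
  set A0 := ∫ x, kinDens V Ω u x
  set A1 := ∫ x, kinCross V Ω u ψ x
  set A2 := ∫ x, (gradSqR ψ x + V x * ψ x ^ 2)
  set ρ : Plane → ℝ := fun x => ‖u x‖ ^ 2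
  set σ : Plane → ℝ := fun x => (u x).re * ψ x
  set χ : Plane → ℝ := fun x => ψ x ^ 2
  set M1 := ∫ x, σ x
  set M2 := ∫ x, χ x
  set B0 := interForm ρ ρ
  set B1 := interForm σ ρ
  have hE : Ea V Ω u = A0 + B0 := Ea_eq_kinDens hV hH Ω
  have hM : ∀ t, ∫ x, ‖perturb u ψ t x‖ ^ 2 = a + t * (2 * M1 + t * M2) := by
    intro t
    have i1 : Integrable (fun x => 2 * σ x + t * χ x) :=
      (hσ.int.const_mul 2).add (hχ.int.const_mul t)
    simp only [norm_sq_perturb]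
    rw [integral_add hH.1.2.1 (i1.const_mul t), hu.1.2, integral_const_mul,
      integral_add (hσ.int.const_mul 2) (hχ.int.const_mul t), integral_const_mul,
      integral_const_mul]
  have hA : ∀ t, ∫ x, kinDens V Ω (perturb u ψ t) x = A0 + 2 * t * A1 + t ^ 2 * A2 := by
    intro t
    simp only [kinDens_perturb hH.1.1 hψ.diff]
    have i1 : Integrable (fun x => kinDens V Ω u x + 2 * t * kinCross V Ω u ψ x) :=
      hk0.add (hk1.const_mul _)
    rw [integral_add i1 (hk2.const_mul _), integral_add hk0 (hk1.const_mul _),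
      integral_const_mul, integral_const_mul]
  have hB : ∀ t, interForm (fun x => ‖perturb u ψ t x‖ ^ 2) (fun x => ‖perturb u ψ t x‖ ^ 2) =
      B0 + 2 * t * (2 * B1 + t * interForm χ ρ) + t ^ 2 * (2 ^ 2 * interForm σ σ
        + 2 * t * (2 * interForm χ σ) + t ^ 2 * interForm χ χ) := by
    intro t
    have h2σ := hσ.smul 2
    have htχ := hχ.smul t
    have hh := h2σ.add htχ
    simp only [norm_sq_perturb]
    rw [interForm_add_smul_self hρ hh t, interForm_add_left h2σ htχ hρ, interForm_smul_left,
      interForm_smul_left, interForm_add_smul_self h2σ hχ t, interForm_smul_left,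
      interForm_symm hσ h2σ, interForm_smul_left, interForm_symm hχ h2σ, interForm_smul_left,
      interForm_symm hσ hχ]
    ring
  set J : ℝ → ℝ := fun t => a * (a + t * (2 * M1 + t * M2)) * (A0 + 2 * t * A1 + t ^ 2 * A2) +
    a ^ 2 * (B0 + 2 * t * (2 * B1 + t * interForm χ ρ) + t ^ 2 * (2 ^ 2 * interForm σ σ
        + 2 * t * (2 * interForm χ σ) + t ^ 2 * interForm χ χ)) -
    (A0 + B0) * (a + t * (2 * M1 + t * M2)) ^ 2
  have hJ0 : J 0 = 0 := by simp only [J]; ring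
  have hev : ∀ᶠ t in 𝓝 (0 : ℝ), 0 ≤ J t := by
    have hcont : Continuous fun t : ℝ => a + t * (2 * M1 + t * M2) := by fun_prop
    have : ∀ᶠ t in 𝓝 (0 : ℝ), 0 < a + t * (2 * M1 + t * M2) :=
      (hcont.tendsto 0).eventually (lt_mem_nhds (by simpa using ha))
    filter_upwards [this] with t ht
    have := hu.homogeneous hV ha (hH.perturb hV hψ t) (by rw [hM]; exact ht)
    rw [hM, hA, hB, hE] at this
    simp only [J]
    linarith
  have hder : HasDerivAt J (a * (2 * M1) * A0 + a * a * (2 * A1) + a ^ 2 * (2 * (2 * B1)) -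
      (A0 + B0) * (2 * a * (2 * M1))) 0 := by
    have hM' : HasDerivAt (fun t : ℝ => a + t * (2 * M1 + t * M2)) (2 * M1) 0 := by
      have := (((hasDerivAt_id (0 : ℝ)).mul (((hasDerivAt_id (0 : ℝ)).mul_const M2).const_add
        (2 * M1)))).const_add a
      convert! this using 1
      simp
    have hA' : HasDerivAt (fun t : ℝ => A0 + 2 * t * A1 + t ^ 2 * A2) (2 * A1) 0 := by
      have := ((((hasDerivAt_id (0 : ℝ)).const_mul 2).mul_const A1).const_add A0).add
        (((hasDerivAt_id (0 : ℝ)).pow 2).mul_const A2)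
      convert! this using 1
      simp
    have hB' : HasDerivAt (fun t : ℝ => B0 + 2 * t * (2 * B1 + t * interForm χ ρ) +
        t ^ 2 * (2 ^ 2 * interForm σ σ + 2 * t * (2 * interForm χ σ) + t ^ 2 * interForm χ χ))
        (2 * (2 * B1)) 0 := by
      have h1 := (((hasDerivAt_id (0 : ℝ)).const_mul 2).mul
        (((hasDerivAt_id (0 : ℝ)).mul_const (interForm χ ρ)).const_add (2 * B1))).const_add B0
      have h2 : DifferentiableAt ℝ (fun t : ℝ => 2 ^ 2 * interForm σ σ +
        2 * t * (2 * interForm χ σ) + t ^ 2 * interForm χ χ) 0 := by fun_prop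
      have := h1.add (((hasDerivAt_id (0 : ℝ)).pow 2).mul h2.hasDerivAt)
      convert! this using 1
      simp
    have := ((hM'.const_mul a).mul hA').add (hB'.const_mul (a ^ 2)) |>.sub
      ((hM'.pow 2).const_mul (A0 + B0))
    convert! this using 1
    simp
  have hz := eq_zero_of_local_min_polynomial hder hJ0 hev
  rw [lagr, hE]
  field_simp
  have h5 : (2 * a) * ((A1 + 2 * B1) * a - M1 * (A0 + B0 + B0)) = 0 := by linarith
  rcases mul_eq_zero.1 h5 with h | h
  · exact absurd h (by positivity)
  · linarith

/-- The weak Euler–Lagrange equation for the real part. -/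
theorem IsMinimizer.weak_re {V : Plane → ℝ} (hV : V110 V) {Ω a : ℝ} (ha : 0 < a)
    {u : Plane → ℂ} (hu : IsMinimizer V Ω a u) (h4 : Integrable (fun x => ‖u x‖ ^ 4))
    {ψ : Plane → ℝ} (hψ : TestFun ψ) :
    ∫ x, (gradCross u ψ x + (coeffEL V Ω a u x * (u x).re - Ω * rotIm u x) * ψ x) = 0 := by
  have h := hu.first_variation hV ha h4 hψ
  have hc := hψ.smooth.continuous
  have hH := hu.1.1
  have hur : Continuous fun x => (u x).re := Complex.continuous_re.comp hH.1.1.continuous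
  have hρ := hH.logDens hV h4
  have hσ : LogDens (fun x => (u x).re * ψ x) :=
    LogDens.of_hasCompactSupport (hur.mul hc) hψ.supp.mul_left
  have i1 := integrable_gradCross hH.1 hψ
  have i2 : Integrable (fun x => V x * ((u x).re * ψ x)) :=
    integrable_mul_of_locallyBounded hV (hur.mul hc) hψ.supp.mul_left
  have i3 := (integral_momCross hH.1 hψ).1
  have i4 := integrable_rotIm_mul hH.1 hψ
  have i5 := hσ.integrable_mul_logPot hρ
  have i6 := hσ.integrable_mul hρ
  have e1 : ∫ x, kinCross V Ω u ψ x = (∫ x, gradCross u ψ x) + (∫ x, V x * ((u x).re * ψ x))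
      - Ω * ∫ x, rotIm u x * ψ x := by
    have i12 : Integrable (fun x => gradCross u ψ x + V x * ((u x).re * ψ x)) := i1.add i2
    simp only [kinCross]
    rw [integral_sub i12 (i3.const_mul _), integral_add i1 i2, integral_const_mul,
      (integral_momCross hH.1 hψ).2]
    ring
  rw [e1, interForm, logForm_eq] at h
  have e2 : ∀ x, gradCross u ψ x + (coeffEL V Ω a u x * (u x).re - Ω * rotIm u x) * ψ x =
      (gradCross u ψ x + V x * ((u x).re * ψ x) - Ω * (rotIm u x * ψ x)) +
      ((u x).re * ψ x * logPot (fun y => ‖u y‖ ^ 2) x - (u x).re * ψ x * ‖u x‖ ^ 2 -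
      lagr V Ω a u * ((u x).re * ψ x)) := fun x => by rw [coeffEL]; ring
  simp only [e2]
  have i7 : Integrable (fun x => gradCross u ψ x + V x * ((u x).re * ψ x)) := i1.add i2
  have i8 : Integrable (fun x => gradCross u ψ x + V x * ((u x).re * ψ x) -
    Ω * (rotIm u x * ψ x)) := i7.sub (i4.const_mul _)
  have i9 : Integrable (fun x => (u x).re * ψ x * logPot (fun y => ‖u y‖ ^ 2) x -
    (u x).re * ψ x * ‖u x‖ ^ 2) := i5.sub i6
  have i10 : Integrable (fun x => (u x).re * ψ x * logPot (fun y => ‖u y‖ ^ 2) x -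
    (u x).re * ψ x * ‖u x‖ ^ 2 - lagr V Ω a u * ((u x).re * ψ x)) :=
    i9.sub (hσ.int.const_mul _)
  rw [integral_add i8 i10, integral_sub i7 (i4.const_mul _), integral_add i1 i2,
    integral_sub i9 (hσ.int.const_mul _), integral_sub i5 i6, integral_const_mul,
    integral_const_mul]
  linarith

theorem integrable_mul_of_bounded_ball {m c : Plane → ℝ} {x₀ : Plane} {r M : ℝ}
    (hm : Measurable m) (hb : ∀ x ∈ ball x₀ r, |m x| ≤ M) (hc : Continuous c)
    (h0 : ∀ x ∉ ball x₀ r, c x = 0) : Integrable (fun x => m x * c x) := by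
  obtain ⟨C, hC⟩ := (isCompact_closedBall x₀ r).exists_bound_of_continuousOn hc.continuousOn
  have hi : Integrable ((ball x₀ r).indicator fun _ => M * C) :=
    (integrable_indicator_iff measurableSet_ball).2 (integrableOn_const (by finiteness))
  refine hi.mono' (hm.mul hc.measurable).aestronglyMeasurable (Eventually.of_forall fun x => ?_)
  by_cases hx : x ∈ ball x₀ r
  · rw [indicator_of_mem hx, norm_mul]
    exact mul_le_mul (hb x hx) (hC x (ball_subset_closedBall hx)) (norm_nonneg _)
      ((abs_nonneg _).trans (hb x hx))
  · rw [indicator_of_notMem hx, h0 x hx, mul_zero, norm_zero]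

/-- `w` is differentiable with bounded gradient on a ball, and solves `Δ w = g` weakly. -/
structure WeakLap (w g : Plane → ℝ) (x₀ : Plane) (r M : ℝ) : Prop where
  diff : Differentiable ℝ w
  meas : Measurable g
  grad_le : ∀ x ∈ ball x₀ r, ‖fderiv ℝ w x‖ ≤ M
  le : ∀ x ∈ ball x₀ r, |g x| ≤ M
  weak : ∀ ψ, TestFun ψ → tsupport ψ ⊆ ball x₀ r →
    ∫ x, (d0R w x * d0R ψ x + d1R w x * d1R ψ x + g x * ψ x) = 0

theorem measurable_d0R (w : Plane → ℝ) : Measurable (d0R w) :=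
  measurable_fderiv_apply_const ℝ w e0

theorem measurable_d1R (w : Plane → ℝ) : Measurable (d1R w) :=
  measurable_fderiv_apply_const ℝ w e1

theorem abs_d0R_le (w : Plane → ℝ) (x : Plane) : |d0R w x| ≤ ‖fderiv ℝ w x‖ := by
  simpa [d0R] using (fderiv ℝ w x).le_opNorm e0

theorem abs_d1R_le (w : Plane → ℝ) (x : Plane) : |d1R w x| ≤ ‖fderiv ℝ w x‖ := by
  simpa [d1R] using (fderiv ℝ w x).le_opNorm e1

/-- The source term of the equation for `η w`. -/
def cutSource (η w g : Plane → ℝ) (x : Plane) : ℝ :=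
  2 * (d0R w x * d0R η x + d1R w x * d1R η x) + g x * η x + w x * lapR η x

theorem contDiff_d0R' {η : Plane → ℝ} {n : ℕ} (h : ContDiff ℝ (n + 1) η) : ContDiff ℝ n (d0R η) :=
  (h.fderiv_right le_rfl).clm_apply contDiff_const

theorem contDiff_d1R' {η : Plane → ℝ} {n : ℕ} (h : ContDiff ℝ (n + 1) η) : ContDiff ℝ n (d1R η) :=
  (h.fderiv_right le_rfl).clm_apply contDiff_const

theorem d0R_mul {f g : Plane → ℝ} {x : Plane} (hf : DifferentiableAt ℝ f x)
    (hg : DifferentiableAt ℝ g x) :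
    d0R (fun y => f y * g y) x = d0R f x * g x + f x * d0R g x := by
  rw [d0R, fderiv_fun_mul hf hg]; simp [d0R]; ring

theorem d1R_mul {f g : Plane → ℝ} {x : Plane} (hf : DifferentiableAt ℝ f x)
    (hg : DifferentiableAt ℝ g x) :
    d1R (fun y => f y * g y) x = d1R f x * g x + f x * d1R g x := by
  rw [d1R, fderiv_fun_mul hf hg]; simp [d1R]; ring

set_option maxHeartbeats 1000000 in
theorem WeakLap.integral_cutoff {w g : Plane → ℝ} {x₀ : Plane} {r M : ℝ}
    (h : WeakLap w g x₀ r M) {η : Plane → ℝ} (hη : ContDiff ℝ 2 η) (hs : tsupport η ⊆ ball x₀ r)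
    {φ : Plane → ℝ} (hφ : ContDiff ℝ 2 φ) :
    ∫ x, η x * w x * lapR φ x = ∫ x, cutSource η w g x * φ x := by
  have hw := h.diff
  have hwc := hw.continuous
  have hηd : Differentiable ℝ η := hη.differentiable (by norm_num)
  have hφd : Differentiable ℝ φ := hφ.differentiable (by norm_num)
  have hη0 : ContDiff ℝ 1 (d0R η) := contDiff_d0R' (n := 1) hη
  have hη1 : ContDiff ℝ 1 (d1R η) := contDiff_d1R' (n := 1) hη
  have hφ0 : ContDiff ℝ 1 (d0R φ) := contDiff_d0R' (n := 1) hφ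
  have hφ1 : ContDiff ℝ 1 (d1R φ) := contDiff_d1R' (n := 1) hφ
  have cη := hη.continuous
  have cφ := hφ.continuous
  have cη0 := hη0.continuous
  have cη1 := hη1.continuous
  have cφ0 := hφ0.continuous
  have cφ1 := hφ1.continuous
  have cη00 : Continuous (d0R (d0R η)) := (contDiff_d0R' (n := 0) hη0).continuous
  have cη11 : Continuous (d1R (d1R η)) := (contDiff_d1R' (n := 0) hη1).continuous
  have cφ00 : Continuous (d0R (d0R φ)) := (contDiff_d0R' (n := 0) hφ0).continuous
  have cφ11 : Continuous (d1R (d1R φ)) := (contDiff_d1R' (n := 0) hφ1).continuous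
  have dη0 : Differentiable ℝ (d0R η) := hη0.differentiable (by norm_num)
  have dη1 : Differentiable ℝ (d1R η) := hη1.differentiable (by norm_num)
  have dφ0 : Differentiable ℝ (d0R φ) := hφ0.differentiable (by norm_num)
  have dφ1 : Differentiable ℝ (d1R φ) := hφ1.differentiable (by norm_num)
  have z : ∀ x ∉ ball x₀ r, η =ᶠ[𝓝 x] 0 := fun x hx =>
    notMem_tsupport_iff_eventuallyEq.1 fun hx' => hx (hs hx')
  have z0 : ∀ x ∉ ball x₀ r, η x = 0 := fun x hx => (z x hx).self_of_nhds
  have zd : ∀ x ∉ ball x₀ r, ∀ v, fderiv ℝ η x v = 0 := fun x hx v => by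
    rw [(z x hx).fderiv_eq]; simp
  have zd0 : ∀ x ∉ ball x₀ r, d0R η x = 0 := fun x hx => zd x hx _
  have zd1 : ∀ x ∉ ball x₀ r, d1R η x = 0 := fun x hx => zd x hx _
  have zdd : ∀ x ∉ ball x₀ r, d0R η =ᶠ[𝓝 x] 0 ∧ d1R η =ᶠ[𝓝 x] 0 := fun x hx => by
    have := (z x hx).eventuallyEq_nhds
    constructor
    · filter_upwards [this] with y hy
      rw [d0R, hy.fderiv_eq]; simp
    · filter_upwards [this] with y hy
      rw [d1R, hy.fderiv_eq]; simp
  have zd00 : ∀ x ∉ ball x₀ r, d0R (d0R η) x = 0 := fun x hx => by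
    rw [d0R, (zdd x hx).1.fderiv_eq]; simp
  have zd11 : ∀ x ∉ ball x₀ r, d1R (d1R η) x = 0 := fun x hx => by
    rw [d1R, (zdd x hx).2.fderiv_eq]; simp
  have b0 : ∀ x ∈ ball x₀ r, |d0R w x| ≤ M := fun x hx => (abs_d0R_le w x).trans (h.grad_le x hx)
  have b1 : ∀ x ∈ ball x₀ r, |d1R w x| ≤ M := fun x hx => (abs_d1R_le w x).trans (h.grad_le x hx)
  have I : ∀ {m c : Plane → ℝ}, Measurable m → (∀ x ∈ ball x₀ r, |m x| ≤ M) → Continuous c →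
      (∀ x ∉ ball x₀ r, c x = 0) → Integrable (fun x => m x * c x) :=
    fun hm hb hc h0 => integrable_mul_of_bounded_ball hm hb hc h0
  have Ic : ∀ {c : Plane → ℝ}, Continuous c → (∀ x ∉ ball x₀ r, c x = 0) → Integrable c := by
    intro c hc h0
    have := integrable_mul_of_bounded_ball (m := fun _ => 1) (M := 1) measurable_const (by simp)
      hc h0
    simpa using this
  have hsη : HasCompactSupport η := (isCompact_closedBall x₀ r).of_isClosed_subset
    (isClosed_tsupport η) (hs.trans ball_subset_closedBall)
  have hψ : TestFun (fun x => η x * φ x) := ⟨(hη.mul hφ).of_le (by norm_num), hsη.mul_right⟩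
  have mw0 := measurable_d0R w
  have mw1 := measurable_d1R w
  have J1 : Integrable (fun x => d0R w x * (η x * d0R φ x)) :=
    I mw0 b0 (cη.mul cφ0) (by intro x hx; simp [z0 x hx])
  have J2 : Integrable (fun x => d1R w x * (η x * d1R φ x)) :=
    I mw1 b1 (cη.mul cφ1) (by intro x hx; simp [z0 x hx])
  have J3 : Integrable (fun x => d0R w x * (d0R η x * φ x)) :=
    I mw0 b0 (cη0.mul cφ) (by intro x hx; simp [zd0 x hx])
  have J4 : Integrable (fun x => d1R w x * (d1R η x * φ x)) :=
    I mw1 b1 (cη1.mul cφ) (by intro x hx; simp [zd1 x hx])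
  have J5 : Integrable (fun x => g x * (η x * φ x)) :=
    I h.meas h.le (cη.mul cφ) (by intro x hx; simp [z0 x hx])
  have K1 : Integrable (fun x => w x * (d0R η x * d0R φ x)) :=
    Ic (by fun_prop) (by intro x hx; simp [zd0 x hx])
  have K2 : Integrable (fun x => w x * (d1R η x * d1R φ x)) :=
    Ic (by fun_prop) (by intro x hx; simp [zd1 x hx])
  have K3 : Integrable (fun x => w x * (η x * d0R (d0R φ) x)) :=
    Ic (by fun_prop) (by intro x hx; simp [z0 x hx])
  have K4 : Integrable (fun x => w x * (η x * d1R (d1R φ) x)) :=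
    Ic (by fun_prop) (by intro x hx; simp [z0 x hx])
  have K5 : Integrable (fun x => w x * (d0R (d0R η) x * φ x)) :=
    Ic (by fun_prop) (by intro x hx; simp [zd00 x hx])
  have K6 : Integrable (fun x => w x * (d1R (d1R η) x * φ x)) :=
    Ic (by fun_prop) (by intro x hx; simp [zd11 x hx])
  have E1 := h.weak _ hψ ((tsupport_mul_subset_left (f := η) (g := φ)).trans hs)
  have e1' : ∀ x, d0R w x * d0R (fun x => η x * φ x) x + d1R w x * d1R (fun x => η x * φ x) x +
      g x * (η x * φ x) = d0R w x * (d0R η x * φ x) + d0R w x * (η x * d0R φ x) +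
      (d1R w x * (d1R η x * φ x) + d1R w x * (η x * d1R φ x)) + g x * (η x * φ x) := fun x => by
    rw [d0R_mul (hηd x) (hφd x), d1R_mul (hηd x) (hφd x)]; ring
  simp only [e1'] at E1
  have eA : ∀ x, d0R (fun y => w y * (η y * d0R φ y)) x = d0R w x * (η x * d0R φ x) +
      w x * (d0R η x * d0R φ x) + w x * (η x * d0R (d0R φ) x) := fun x => by
    rw [d0R_mul (hw x) ((hηd x).fun_mul (dφ0 x)), d0R_mul (hηd x) (dφ0 x)]; ring
  have eB : ∀ x, d1R (fun y => w y * (η y * d1R φ y)) x = d1R w x * (η x * d1R φ x) +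
      w x * (d1R η x * d1R φ x) + w x * (η x * d1R (d1R φ) x) := fun x => by
    rw [d1R_mul (hw x) ((hηd x).fun_mul (dφ1 x)), d1R_mul (hηd x) (dφ1 x)]; ring
  have eC : ∀ x, d0R (fun y => w y * (d0R η y * φ y)) x = d0R w x * (d0R η x * φ x) +
      w x * (d0R (d0R η) x * φ x) + w x * (d0R η x * d0R φ x) := fun x => by
    rw [d0R_mul (hw x) ((dη0 x).fun_mul (hφd x)), d0R_mul (dη0 x) (hφd x)]; ring
  have eD : ∀ x, d1R (fun y => w y * (d1R η y * φ y)) x = d1R w x * (d1R η x * φ x) +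
      w x * (d1R (d1R η) x * φ x) + w x * (d1R η x * d1R φ x) := fun x => by
    rw [d1R_mul (hw x) ((dη1 x).fun_mul (hφd x)), d1R_mul (dη1 x) (hφd x)]; ring
  have E2 := integral_fderiv_eq_zero (f := fun y => w y * (η y * d0R φ y))
    (hw.mul (hηd.mul dφ0)) e0 (Ic (by fun_prop) (by intro x hx; simp [z0 x hx]))
    (((J1.add K1).add K3).congr (Eventually.of_forall fun x => (eA x).symm))
  have E3 := integral_fderiv_eq_zero (f := fun y => w y * (η y * d1R φ y))
    (hw.mul (hηd.mul dφ1)) e1 (Ic (by fun_prop) (by intro x hx; simp [z0 x hx]))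
    (((J2.add K2).add K4).congr (Eventually.of_forall fun x => (eB x).symm))
  have E4 := integral_fderiv_eq_zero (f := fun y => w y * (d0R η y * φ y))
    (hw.mul (dη0.mul hφd)) e0 (Ic (by fun_prop) (by intro x hx; simp [zd0 x hx]))
    (((J3.add K5).add K1).congr (Eventually.of_forall fun x => (eC x).symm))
  have E5 := integral_fderiv_eq_zero (f := fun y => w y * (d1R η y * φ y))
    (hw.mul (dη1.mul hφd)) e1 (Ic (by fun_prop) (by intro x hx; simp [zd1 x hx]))
    (((J4.add K6).add K2).congr (Eventually.of_forall fun x => (eD x).symm))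
  have E2' : ∫ x, (d0R w x * (η x * d0R φ x) +
      w x * (d0R η x * d0R φ x) + w x * (η x * d0R (d0R φ) x)) = 0 := by
    rw [← E2]; exact integral_congr_ae (Eventually.of_forall fun x => (eA x).symm)
  have E3' : ∫ x, (d1R w x * (η x * d1R φ x) +
      w x * (d1R η x * d1R φ x) + w x * (η x * d1R (d1R φ) x)) = 0 := by
    rw [← E3]; exact integral_congr_ae (Eventually.of_forall fun x => (eB x).symm)
  have E4' : ∫ x, (d0R w x * (d0R η x * φ x) +
      w x * (d0R (d0R η) x * φ x) + w x * (d0R η x * d0R φ x)) = 0 := by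
    rw [← E4]; exact integral_congr_ae (Eventually.of_forall fun x => (eC x).symm)
  have E5' : ∫ x, (d1R w x * (d1R η x * φ x) +
      w x * (d1R (d1R η) x * φ x) + w x * (d1R η x * d1R φ x)) = 0 := by
    rw [← E5]; exact integral_congr_ae (Eventually.of_forall fun x => (eD x).symm)
  have A2 := fun {f g k : Plane → ℝ} (hf : Integrable f) (hg : Integrable g) (hk : Integrable k) =>
    (integral_add (hf.add hg) hk).trans (congrArg (· + ∫ x, k x) (integral_add hf hg))
  have T2 := (A2 J1 K1 K3).symm.trans E2'
  have T3 := (A2 J2 K2 K4).symm.trans E3'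
  have T4 := (A2 J3 K5 K1).symm.trans E4'
  have T5 := (A2 J4 K6 K2).symm.trans E5'
  have T1 := (A2 (J3.add J1) (J4.add J2) J5).symm.trans E1
  rw [integral_add' J3 J1, integral_add' J4 J2] at T1
  have L : ∫ x, η x * w x * lapR φ x = (∫ x, w x * (η x * d0R (d0R φ) x)) +
      ∫ x, w x * (η x * d1R (d1R φ) x) := by
    rw [← integral_add K3 K4]
    exact integral_congr_ae (Eventually.of_forall fun x => by
      simp only [lapR]; rw [show fderiv ℝ (d0R φ) x e0 = d0R (d0R φ) x from rfl,
        show fderiv ℝ (d1R φ) x e1 = d1R (d1R φ) x from rfl]; ring)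
  have Rr : ∫ x, cutSource η w g x * φ x = 2 * ((∫ x, d0R w x * (d0R η x * φ x)) +
      ∫ x, d1R w x * (d1R η x * φ x)) + (∫ x, g x * (η x * φ x)) +
      ((∫ x, w x * (d0R (d0R η) x * φ x)) + ∫ x, w x * (d1R (d1R η) x * φ x)) := by
    rw [← integral_add J3 J4, ← integral_add K5 K6, ← integral_const_mul]
    refine Eq.trans ?_ (A2 ((J3.add J4).const_mul 2) J5 (K5.add K6))
    exact integral_congr_ae (Eventually.of_forall fun x => by
      simp only [Pi.add_apply, cutSource, lapR]
      rw [show fderiv ℝ (d0R η) x e0 = d0R (d0R η) x from rfl,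
        show fderiv ℝ (d1R η) x e1 = d1R (d1R η) x from rfl]; ring)
  rw [L, Rr]
  linarith

theorem exists_riesz_bound {s : ℝ} (hs : -2 < s) (hs0 : s ≤ 0) (x₀ : Plane) (R : ℝ) :
    ∃ C, 0 ≤ C ∧ ∀ x, IntegrableOn (fun z => ‖x - z‖ ^ s) (ball x₀ R) ∧
      ∫ z in ball x₀ R, ‖x - z‖ ^ s ≤ C := by
  set N : Plane → ℝ := (ball (0 : Plane) 1).indicator fun y => ‖y‖ ^ s
  have hN : Integrable N :=
    (integrable_indicator_iff measurableSet_ball).2 (integrableOn_norm_rpow_ball hs 1)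
  have hN0 : ∀ y, 0 ≤ N y := fun y => indicator_nonneg (fun y _ => by positivity) y
  have hle : ∀ y, ‖y‖ ^ s ≤ N y + 1 := by
    intro y
    by_cases hy : y ∈ ball (0 : Plane) 1
    · simp only [N, indicator_of_mem hy]; linarith
    · simp only [N, indicator_of_notMem hy]
      rw [mem_ball_zero_iff, not_lt] at hy
      rw [zero_add]
      exact Real.rpow_le_one_of_one_le_of_nonpos hy hs0
  refine ⟨(∫ y, N y) + volume.real (ball x₀ R), add_nonneg (integral_nonneg hN0) (by positivity),
    fun x => ?_⟩
  have hNx : Integrable (fun z => N (x - z)) := hN.comp_sub_left x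
  have i1 : IntegrableOn (fun z => N (x - z) + 1) (ball x₀ R) :=
    hNx.integrableOn.add (integrableOn_const (by finiteness))
  have i2 : IntegrableOn (fun z => ‖x - z‖ ^ s) (ball x₀ R) :=
    i1.mono' ((measurable_const.sub measurable_id).norm.pow_const s).aestronglyMeasurable
      (Eventually.of_forall fun z => by
      rw [Real.norm_of_nonneg (by positivity)]; exact hle _)
  refine ⟨i2, (integral_mono i2 i1 fun z => hle _).trans ?_⟩
  rw [integral_add hNx.integrableOn (integrableOn_const (by finiteness))]
  refine add_le_add ?_ (by simp [Measure.real])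
  refine (setIntegral_le_integral hNx (Eventually.of_forall fun z => hN0 _)).trans_eq ?_
  exact integral_sub_left_eq_self N volume x

/-- The regularised gradient of the logarithmic kernel in the direction `e`. -/
def kReg (ε : ℝ) (e y : Plane) : ℝ := inner ℝ e y / (‖y‖ ^ 2 + ε ^ 2)

/-- The Laplacian of the regularised logarithmic kernel. -/
def dReg (ε : ℝ) (y : Plane) : ℝ := 2 * ε ^ 2 / (‖y‖ ^ 2 + ε ^ 2) ^ 2

/-- The Laplacian of `kReg`, which is also the `e`-derivative of `dReg`. -/
def mReg (ε : ℝ) (e y : Plane) : ℝ := -8 * ε ^ 2 * inner ℝ e y / (‖y‖ ^ 2 + ε ^ 2) ^ 3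

theorem d0R_eq_of_hasDerivAt {f : Plane → ℝ} {x : Plane} {c : ℝ} (hf : DifferentiableAt ℝ f x)
    (h : HasDerivAt (fun t : ℝ => f (x + t • e0)) c 0) : d0R f x = c :=
  (hf.hasFDerivAt.hasLineDerivAt e0).unique h

theorem d1R_eq_of_hasDerivAt {f : Plane → ℝ} {x : Plane} {c : ℝ} (hf : DifferentiableAt ℝ f x)
    (h : HasDerivAt (fun t : ℝ => f (x + t • e1)) c 0) : d1R f x = c :=
  (hf.hasFDerivAt.hasLineDerivAt e1).unique h

theorem inner_plane (x y : Plane) : inner ℝ x y = x 0 * y 0 + x 1 * y 1 := by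
  simp [PiLp.inner_apply]; ring

theorem contDiff_kReg {ε : ℝ} (hε : 0 < ε) (e x : Plane) :
    ContDiff ℝ 2 (fun z => kReg ε e (x - z)) := by
  unfold kReg
  refine ContDiff.div (contDiff_const.inner ℝ (contDiff_const.sub contDiff_id))
    (((contDiff_const.sub contDiff_id).norm_sq ℝ).add contDiff_const) fun z => by positivity

theorem lapR_kReg {ε : ℝ} (hε : 0 < ε) (e x z : Plane) :
    lapR (fun z => kReg ε e (x - z)) z = mReg ε e (x - z) := by
  have hc := contDiff_kReg hε e x
  have hd := hc.differentiable (n := 2) (by norm_num)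
  have h0 : d0R (fun z => kReg ε e (x - z)) = fun z =>
      (-e 0 * ((x 0 - z 0) ^ 2 + (x 1 - z 1) ^ 2 + ε ^ 2) +
        2 * (x 0 - z 0) * (e 0 * (x 0 - z 0) + e 1 * (x 1 - z 1))) /
        ((x 0 - z 0) ^ 2 + (x 1 - z 1) ^ 2 + ε ^ 2) ^ 2 := by
    funext z
    refine d0R_eq_of_hasDerivAt (hd z) ?_
    have hL : (x 0 - (z 0 + 0)) ^ 2 + (x 1 - z 1) ^ 2 + ε ^ 2 ≠ 0 := by positivity
    have ha : HasDerivAt (fun t : ℝ => x 0 - (z 0 + t)) (-1) 0 :=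
      ((hasDerivAt_id (0 : ℝ)).const_add (z 0)).const_sub (x 0)
    have := ((ha.const_mul (e 0)).add_const (e 1 * (x 1 - z 1))).div
      (((ha.pow 2).add_const ((x 1 - z 1) ^ 2)).add_const (ε ^ 2)) hL
    convert! this using 1
    · ext t; simp [kReg, inner_plane, plane_norm_sq, e0]
    · simp; ring
  have h1 : d1R (fun z => kReg ε e (x - z)) = fun z =>
      (-e 1 * ((x 0 - z 0) ^ 2 + (x 1 - z 1) ^ 2 + ε ^ 2) +
        2 * (x 1 - z 1) * (e 0 * (x 0 - z 0) + e 1 * (x 1 - z 1))) /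
        ((x 0 - z 0) ^ 2 + (x 1 - z 1) ^ 2 + ε ^ 2) ^ 2 := by
    funext z
    refine d1R_eq_of_hasDerivAt (hd z) ?_
    have hL : (x 0 - z 0) ^ 2 + (x 1 - (z 1 + 0)) ^ 2 + ε ^ 2 ≠ 0 := by positivity
    have ha : HasDerivAt (fun t : ℝ => x 1 - (z 1 + t)) (-1) 0 :=
      ((hasDerivAt_id (0 : ℝ)).const_add (z 1)).const_sub (x 1)
    have := ((ha.const_mul (e 1)).const_add (e 0 * (x 0 - z 0))).div
      (((ha.pow 2).const_add ((x 0 - z 0) ^ 2)).add_const (ε ^ 2)) hL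
    convert! this using 1
    · ext t; simp [kReg, inner_plane, plane_norm_sq, e1]
    · simp; ring
  have c0 := (contDiff_d0R' (n := 1) hc).differentiable (n := 1) (by norm_num)
  have c1 := (contDiff_d1R' (n := 1) hc).differentiable (n := 1) (by norm_num)
  have hL0 : 0 < (x 0 - z 0) ^ 2 + (x 1 - z 1) ^ 2 + ε ^ 2 := by positivity
  have g0 : d0R (d0R (fun z => kReg ε e (x - z))) z =
      (-2 * (e 0 * (x 0 - z 0) + e 1 * (x 1 - z 1)) *
        ((x 0 - z 0) ^ 2 + (x 1 - z 1) ^ 2 + ε ^ 2) + 4 * (x 0 - z 0) *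
        (-e 0 * ((x 0 - z 0) ^ 2 + (x 1 - z 1) ^ 2 + ε ^ 2) +
        2 * (x 0 - z 0) * (e 0 * (x 0 - z 0) + e 1 * (x 1 - z 1)))) /
        ((x 0 - z 0) ^ 2 + (x 1 - z 1) ^ 2 + ε ^ 2) ^ 3 := by
    refine d0R_eq_of_hasDerivAt (c0 z) ?_
    rw [h0]
    have hL : ((x 0 - (z 0 + 0)) ^ 2 + (x 1 - z 1) ^ 2 + ε ^ 2) ^ 2 ≠ 0 := by positivity
    have ha : HasDerivAt (fun t : ℝ => x 0 - (z 0 + t)) (-1) 0 :=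
      ((hasDerivAt_id (0 : ℝ)).const_add (z 0)).const_sub (x 0)
    have hLd := ((ha.pow 2).add_const ((x 1 - z 1) ^ 2)).add_const (ε ^ 2)
    have := ((hLd.const_mul (-e 0)).add ((ha.const_mul 2).mul
      ((ha.const_mul (e 0)).add_const (e 1 * (x 1 - z 1))))).div (hLd.pow 2) hL
    convert! this using 1
    · ext t; simp [e0]
    · simp only [Pi.pow_apply, Pi.add_apply, Pi.mul_apply, add_zero]; simp; field_simp; ring
  have g1 : d1R (d1R (fun z => kReg ε e (x - z))) z =
      (-2 * (e 0 * (x 0 - z 0) + e 1 * (x 1 - z 1)) *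
        ((x 0 - z 0) ^ 2 + (x 1 - z 1) ^ 2 + ε ^ 2) + 4 * (x 1 - z 1) *
        (-e 1 * ((x 0 - z 0) ^ 2 + (x 1 - z 1) ^ 2 + ε ^ 2) +
        2 * (x 1 - z 1) * (e 0 * (x 0 - z 0) + e 1 * (x 1 - z 1)))) /
        ((x 0 - z 0) ^ 2 + (x 1 - z 1) ^ 2 + ε ^ 2) ^ 3 := by
    refine d1R_eq_of_hasDerivAt (c1 z) ?_
    rw [h1]
    have hL : ((x 0 - z 0) ^ 2 + (x 1 - (z 1 + 0)) ^ 2 + ε ^ 2) ^ 2 ≠ 0 := by positivity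
    have ha : HasDerivAt (fun t : ℝ => x 1 - (z 1 + t)) (-1) 0 :=
      ((hasDerivAt_id (0 : ℝ)).const_add (z 1)).const_sub (x 1)
    have hLd := ((ha.pow 2).const_add ((x 0 - z 0) ^ 2)).add_const (ε ^ 2)
    have := ((hLd.const_mul (-e 1)).add ((ha.const_mul 2).mul
      ((ha.const_mul (e 1)).const_add (e 0 * (x 0 - z 0))))).div (hLd.pow 2) hL
    convert! this using 1
    · ext t; simp [e1]
    · simp only [Pi.pow_apply, Pi.add_apply, Pi.mul_apply, add_zero]; simp; field_simp; ring
  change d0R (d0R _) z + d1R (d1R _) z = _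
  rw [g0, g1, mReg, inner_plane, plane_norm_sq]
  simp only [PiLp.sub_apply]
  rw [← add_div]
  congr 1
  ring

theorem hasDerivAt_dReg {ε : ℝ} (hε : 0 < ε) (e y : Plane) (t : ℝ) :
    HasDerivAt (fun t : ℝ => dReg ε (y + t • e)) (mReg ε e (y + t • e)) t := by
  have h1 : HasDerivAt (fun t : ℝ => y + t • e) e t := by
    simpa using ((hasDerivAt_id t).smul_const e).const_add y
  have h2 := h1.norm_sq
  have := (hasDerivAt_const t (2 * ε ^ 2)).div ((h2.add_const (ε ^ 2)).pow 2)
    (by simp only [Pi.pow_apply]; positivity)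
  convert! this using 1
  have hL : 0 < ‖y + t • e‖ ^ 2 + ε ^ 2 := by positivity
  simp only [mReg, Pi.pow_apply, real_inner_comm]
  rw [real_inner_comm]
  field_simp
  ring

theorem abs_kReg_le {ε : ℝ} (hε : 0 < ε) (e y : Plane) : |kReg ε e y| ≤ ‖e‖ / ε := by
  have hL : 0 < ‖y‖ ^ 2 + ε ^ 2 := by positivity
  rw [kReg, abs_div, abs_of_pos hL, div_le_div_iff₀ hL hε]
  calc |inner ℝ e y| * ε ≤ ‖e‖ * ‖y‖ * ε := by gcongr; exact abs_real_inner_le_norm e y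
    _ = ‖e‖ * (‖y‖ * ε) := by ring
    _ ≤ ‖e‖ * (‖y‖ ^ 2 + ε ^ 2) := by
      gcongr; nlinarith [sq_nonneg (‖y‖ - ε), norm_nonneg y]

theorem abs_kReg_le_norm (ε : ℝ) (e y : Plane) : |kReg ε e y| ≤ ‖e‖ * ‖y‖ ^ (-1 : ℝ) := by
  rw [Real.rpow_neg_one]
  rcases eq_or_ne y 0 with rfl | hy
  · simp [kReg]
  have hy0 : 0 < ‖y‖ := norm_pos_iff.2 hy
  have hL : 0 < ‖y‖ ^ 2 + ε ^ 2 := by positivity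
  rw [kReg, abs_div, abs_of_pos hL, ← div_eq_mul_inv, div_le_div_iff₀ hL hy0]
  calc |inner ℝ e y| * ‖y‖ ≤ ‖e‖ * ‖y‖ * ‖y‖ := by gcongr; exact abs_real_inner_le_norm e y
    _ = ‖e‖ * (‖y‖ ^ 2) := by ring
    _ ≤ ‖e‖ * (‖y‖ ^ 2 + ε ^ 2) := by gcongr; nlinarith [sq_nonneg ε]

theorem abs_mReg_le {ε : ℝ} (hε : 0 < ε) (e y : Plane) : |mReg ε e y| ≤ 8 * ‖e‖ / ε ^ 3 := by
  have hL : 0 < ‖y‖ ^ 2 + ε ^ 2 := by positivity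
  have h1 : mReg ε e y = -(8 * ε ^ 2 / (‖y‖ ^ 2 + ε ^ 2) ^ 2 * kReg ε e y) := by
    rw [mReg, kReg]; field_simp
  rw [h1, abs_neg, abs_mul, abs_of_pos (by positivity : 0 < 8 * ε ^ 2 / (‖y‖ ^ 2 + ε ^ 2) ^ 2)]
  have h2 : 8 * ε ^ 2 / (‖y‖ ^ 2 + ε ^ 2) ^ 2 ≤ 8 * ε ^ 2 / (ε ^ 2) ^ 2 := by
    gcongr; nlinarith [sq_nonneg ‖y‖]
  refine (mul_le_mul h2 (abs_kReg_le hε e y) (abs_nonneg _) (by positivity)).trans_eq ?_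
  field_simp

theorem abs_kReg_zero_sub_le (e y y' : Plane) :
    |kReg 0 e y - kReg 0 e y'| ≤ 2 * ‖e‖ * √‖y - y'‖ *
      (‖y‖ ^ (-3 / 2 : ℝ) + ‖y'‖ ^ (-3 / 2 : ℝ)) := by
  have key : ∀ y : Plane, y ≠ 0 → |kReg 0 e y - kReg 0 e 0| ≤ 2 * ‖e‖ * √‖y - 0‖ *
      (‖y‖ ^ (-3 / 2 : ℝ) + ‖(0 : Plane)‖ ^ (-3 / 2 : ℝ)) := by
    intro y hy
    have hy0 : 0 < ‖y‖ := norm_pos_iff.2 hy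
    have h1 := abs_kReg_le_norm 0 e y
    have h2 : ‖y‖ ^ (-1 : ℝ) = √‖y‖ * ‖y‖ ^ (-3 / 2 : ℝ) := by
      rw [Real.sqrt_eq_rpow, ← Real.rpow_add hy0]; norm_num
    have h3 : kReg 0 e 0 = 0 := by simp [kReg]
    rw [h3, sub_zero, sub_zero, norm_zero, Real.zero_rpow (by norm_num), add_zero]
    rw [h2] at h1
    have : 0 ≤ ‖e‖ * (√‖y‖ * ‖y‖ ^ (-3 / 2 : ℝ)) := by positivity
    nlinarith
  rcases eq_or_ne y' 0 with rfl | hy'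
  · rcases eq_or_ne y 0 with rfl | hy
    · simp
    · exact key y hy
  rcases eq_or_ne y 0 with rfl | hy
  · have := key y' hy'
    rw [abs_sub_comm, norm_sub_rev, add_comm (‖(0:Plane)‖ ^ (-3 / 2 : ℝ))]
    exact this
  have hy0 : 0 < ‖y‖ := norm_pos_iff.2 hy
  have hy0' : 0 < ‖y'‖ := norm_pos_iff.2 hy'
  have hk : ∀ z : Plane, kReg 0 e z = inner ℝ e ((1 / ‖z‖) ^ 2 • z) := by
    intro z; rw [kReg, inner_smul_right]; simp [div_eq_inv_mul]
  have h1 : |kReg 0 e y - kReg 0 e y'| ≤ ‖e‖ * (1 / (‖y‖ * ‖y'‖) * ‖y - y'‖) := by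
    rw [hk, hk, ← inner_sub_right]
    refine (abs_real_inner_le_norm _ _).trans ?_
    rw [← dist_eq_norm, dist_div_norm_sq_smul hy hy', one_pow, dist_eq_norm]
  refine h1.trans ?_
  have h2 : √‖y - y'‖ ≤ √‖y‖ + √‖y'‖ :=
    (Real.sqrt_le_sqrt (norm_sub_le y y')).trans (by
      rw [Real.sqrt_le_left (by positivity)]
      rw [add_sq, Real.sq_sqrt hy0.le, Real.sq_sqrt hy0'.le]
      nlinarith [mul_nonneg (Real.sqrt_nonneg ‖y‖) (Real.sqrt_nonneg ‖y'‖)])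
  set p := √‖y‖
  set q := √‖y'‖
  set d := √‖y - y'‖
  have hp : 0 < p := Real.sqrt_pos.2 hy0
  have hq : 0 < q := Real.sqrt_pos.2 hy0'
  have hd : 0 ≤ d := Real.sqrt_nonneg _
  have ep : ‖y‖ = p ^ 2 := (Real.sq_sqrt hy0.le).symm
  have eq : ‖y'‖ = q ^ 2 := (Real.sq_sqrt hy0'.le).symm
  have ed : ‖y - y'‖ = d ^ 2 := (Real.sq_sqrt (norm_nonneg _)).symm
  have rp : ‖y‖ ^ (-3 / 2 : ℝ) = (p ^ 3)⁻¹ := by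
    rw [ep, ← Real.rpow_natCast p 2, ← Real.rpow_natCast p 3, ← Real.rpow_mul hp.le,
      ← Real.rpow_neg hp.le]; norm_num
  have rq : ‖y'‖ ^ (-3 / 2 : ℝ) = (q ^ 3)⁻¹ := by
    rw [eq, ← Real.rpow_natCast q 2, ← Real.rpow_natCast q 3, ← Real.rpow_mul hq.le,
      ← Real.rpow_neg hq.le]; norm_num
  rw [rp, rq, ep, eq, ed]
  have h3 : 1 / (p ^ 2 * q ^ 2) * (p + q) ≤ 2 * ((p ^ 3)⁻¹ + (q ^ 3)⁻¹) := by
    have : 2 * ((p ^ 3)⁻¹ + (q ^ 3)⁻¹) - 1 / (p ^ 2 * q ^ 2) * (p + q) =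
        (2 * (p ^ 3 + q ^ 3) - p * q * (p + q)) / (p ^ 3 * q ^ 3) := by field_simp; ring
    have h4 : 0 ≤ 2 * (p ^ 3 + q ^ 3) - p * q * (p + q) := by
      nlinarith [mul_nonneg (add_pos hp hq).le (sq_nonneg (p - q)), pow_pos hp 3, pow_pos hq 3]
    have h5 := div_nonneg h4 (by positivity : 0 ≤ p ^ 3 * q ^ 3)
    linarith
  calc ‖e‖ * (1 / (p ^ 2 * q ^ 2) * d ^ 2) = ‖e‖ * d * (1 / (p ^ 2 * q ^ 2) * d) := by ring
    _ ≤ ‖e‖ * d * (1 / (p ^ 2 * q ^ 2) * (p + q)) := by gcongr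
    _ ≤ ‖e‖ * d * (2 * ((p ^ 3)⁻¹ + (q ^ 3)⁻¹)) := by gcongr
    _ = _ := by ring

/-- `W` is compactly supported and `Δ W = h` weakly, with `h` bounded and compactly supported. -/
structure NewtonData (W h : Plane → ℝ) (x₀ : Plane) (R M : ℝ) : Prop where
  diff : Differentiable ℝ W
  zero : ∀ x ∉ ball x₀ R, W x = 0
  meas : Measurable h
  le : ∀ x, |h x| ≤ M
  source_zero : ∀ x ∉ ball x₀ R, h x = 0
  weak : ∀ φ, ContDiff ℝ 2 φ → ∫ x, W x * lapR φ x = ∫ x, h x * φ x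

/-- The gradient of the (unnormalised) Newtonian potential of `h` in the direction `e`. -/
def newt (e : Plane) (h : Plane → ℝ) (x : Plane) : ℝ := ∫ z, h z * kReg 0 e (x - z)

/-- The total mass of the regularised Dirac measure. -/
def kappa : ℝ := ∫ y : Plane, dReg 1 y

theorem integrable_dReg_one : Integrable (dReg 1) := by
  have h := integrable_rpow_neg_one_add_norm_sq (E := Plane) (μ := volume) (r :=
    4) (by simp; norm_num)
  refine (h.const_mul 2).congr (Eventually.of_forall fun y => ?_)
  have : (0 : ℝ) < 1 + ‖y‖ ^ 2 := by positivity
  simp only [dReg]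
  rw [show (-4 / 2 : ℝ) = -(2 : ℕ) by norm_num, Real.rpow_neg this.le, Real.rpow_natCast]
  rw [add_comm (‖y‖ ^ 2)]; simp [div_eq_mul_inv]

theorem kappa_pos : 0 < kappa := by
  refine (integral_pos_iff_support_of_nonneg (fun y => ?_) integrable_dReg_one).2 ?_
  · simp only [dReg, Pi.zero_apply]; positivity
  · have : Function.support (dReg 1) = univ := by
      ext y
      simp only [Function.mem_support, mem_univ, iff_true, dReg]
      positivity
    rw [this]; simp

theorem measurable_kReg (ε : ℝ) (e : Plane) : Measurable (kReg ε e) := by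
  unfold kReg
  exact (measurable_const.inner measurable_id).div ((measurable_norm.pow_const 2).add_const _)

theorem measurable_dReg (ε : ℝ) : Measurable (dReg ε) := by
  unfold dReg
  exact measurable_const.div (((measurable_norm.pow_const 2).add_const _).pow_const 2)

namespace NewtonData

variable {W h : Plane → ℝ} {x₀ : Plane} {R M : ℝ}

theorem nonneg_bound (H : NewtonData W h x₀ R M) : 0 ≤ M := (abs_nonneg _).trans (H.le 0)

theorem continuous (H : NewtonData W h x₀ R M) : Continuous W := H.diff.continuous

theorem hasCompactSupport (H : NewtonData W h x₀ R M) : HasCompactSupport W :=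
  HasCompactSupport.intro (isCompact_closedBall x₀ R) fun x hx =>
    H.zero x fun hx' => hx (ball_subset_closedBall hx')

theorem integrable (H : NewtonData W h x₀ R M) : Integrable W :=
  H.continuous.integrable_of_hasCompactSupport H.hasCompactSupport

theorem exists_bound (H : NewtonData W h x₀ R M) : ∃ C, ∀ x, ‖W x‖ ≤ C :=
  H.hasCompactSupport.exists_bound_of_continuous H.continuous

theorem abs_mul_le (H : NewtonData W h x₀ R M) {f : Plane → ℝ} {b : Plane → ℝ}
    (hb : ∀ z, |f z| ≤ b z) (z : Plane) :
    ‖h z * f z‖ ≤ (ball x₀ R).indicator (fun z => M * b z) z := by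
  by_cases hz : z ∈ ball x₀ R
  · rw [indicator_of_mem hz, norm_mul]
    exact mul_le_mul (H.le z) (hb z) (norm_nonneg _) H.nonneg_bound
  · rw [indicator_of_notMem hz, H.source_zero z hz]; simp

theorem integrable_mul (H : NewtonData W h x₀ R M) {f : Plane → ℝ} {b : Plane → ℝ}
    (hf : Measurable f) (hb : ∀ z, |f z| ≤ b z) (hi : IntegrableOn b (ball x₀ R)) :
    Integrable (fun z => h z * f z) :=
  ((integrable_indicator_iff measurableSet_ball).2 (hi.const_mul M)).mono'
    (H.meas.mul hf).aestronglyMeasurable (Eventually.of_forall fun z => H.abs_mul_le hb z)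

theorem abs_integral_mul_le (H : NewtonData W h x₀ R M) {f : Plane → ℝ} {b : Plane → ℝ}
    (hb : ∀ z, |f z| ≤ b z) (hi : IntegrableOn b (ball x₀ R)) :
    |∫ z, h z * f z| ≤ M * ∫ z in ball x₀ R, b z := by
  have := norm_integral_le_of_norm_le
    ((integrable_indicator_iff measurableSet_ball).2 (hi.const_mul M))
    (Eventually.of_forall fun z => H.abs_mul_le hb z)
  rwa [integral_indicator measurableSet_ball, integral_const_mul] at this

theorem hasDerivAt_regularised (H : NewtonData W h x₀ R M) {ε : ℝ} (hε : 0 < ε) (e x : Plane)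
    (t : ℝ) : HasDerivAt (fun t : ℝ => ∫ z, W z * dReg ε (x + t • e - z))
      (∫ z, h z * kReg ε e (x + t • e - z)) t := by
  have hw : ∫ z, h z * kReg ε e (x + t • e - z) = ∫ z, W z * mReg ε e (x + t • e - z) := by
    rw [← H.weak _ (contDiff_kReg hε e (x + t • e))]
    exact integral_congr_ae (Eventually.of_forall fun z => by simp only [lapR_kReg hε])
  rw [hw]
  have hd : ∀ z t, HasDerivAt (fun t : ℝ => W z * dReg ε (x + t • e - z))
      (W z * mReg ε e (x + t • e - z)) t := fun z t => by
    have := (hasDerivAt_dReg hε e (x - z) t).const_mul (W z)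
    simpa only [sub_add_eq_add_sub] using this
  have hdb : ∀ y, ‖dReg ε y‖ ≤ 2 * ε ^ 2 / (ε ^ 2) ^ 2 := fun y => by
    have : 0 ≤ dReg ε y := by unfold dReg; positivity
    rw [Real.norm_of_nonneg this, dReg]
    gcongr; nlinarith [sq_nonneg ‖y‖]
  have hm : ∀ t : ℝ, AEStronglyMeasurable (fun z => W z * dReg ε (x + t • e - z)) volume :=
    fun t => (H.continuous.measurable.mul
      ((measurable_dReg ε).comp (measurable_const.sub measurable_id))).aestronglyMeasurable
  have hm' : AEStronglyMeasurable (fun z => W z * mReg ε e (x + t • e - z)) volume := by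
    refine (H.continuous.measurable.mul ?_).aestronglyMeasurable
    unfold mReg
    fun_prop
  refine (hasDerivAt_integral_of_dominated_loc_of_deriv_le (s := univ)
    (F' := fun t z => W z * mReg ε e (x + t • e - z))
    (bound := fun z => ‖W z‖ * (8 * ‖e‖ / ε ^ 3)) univ_mem
    (Eventually.of_forall hm) ?_ hm' ?_ (H.integrable.norm.mul_const _) ?_).2
  · exact (H.integrable.norm.mul_const (2 * ε ^ 2 / (ε ^ 2) ^ 2)).mono' (hm t)
      (Eventually.of_forall fun z => by rw [norm_mul]; gcongr; exact hdb _)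
  · exact Eventually.of_forall fun z s _ => by
      rw [norm_mul]; gcongr; exact abs_mReg_le hε e _
  · exact Eventually.of_forall fun z s _ => hd z s

theorem regularised_eq (W : Plane → ℝ) {ε : ℝ} (hε : 0 < ε) (x : Plane) :
    ∫ z, W z * dReg ε (x - z) = ∫ y, W (x - ε • y) * dReg 1 y := by
  have h1 : ∫ z, W z * dReg ε (x - z) = ∫ y, W (x - y) * dReg ε y := by
    rw [← integral_sub_left_eq_self (fun y => W (x - y) * dReg ε y) volume x]
    simp
  rw [h1]
  have h2 := integral_comp_smul_plane (fun y => W (x - y) * dReg ε y) hε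
  have h3 : ∀ y, dReg ε (ε • y) = (ε ^ 2)⁻¹ * dReg 1 y := fun y => by
    have : (0 : ℝ) < ‖y‖ ^ 2 + 1 := by positivity
    simp only [dReg, norm_smul, mul_pow, Real.norm_eq_abs, sq_abs, one_pow]
    rw [show ε ^ 2 * ‖y‖ ^ 2 + ε ^ 2 = ε ^ 2 * (‖y‖ ^ 2 + 1) by ring]
    field_simp
  simp only [h3] at h2
  have h4 : ∀ y, W (x - ε • y) * ((ε ^ 2)⁻¹ * dReg 1 y) =
    (ε ^ 2)⁻¹ * (W (x - ε • y) * dReg 1 y) := fun y => by ring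
  simp only [h4] at h2
  rw [integral_const_mul] at h2
  exact (mul_left_cancel₀ (by positivity) h2).symm

theorem tendsto_regularised (H : NewtonData W h x₀ R M) (x : Plane) :
    Tendsto (fun n : ℕ => ∫ z, W z * dReg (1 / ((n : ℝ) + 1)) (x - z)) atTop
      (𝓝 (kappa * W x)) := by
  have h1 : ∀ n : ℕ, ∫ z, W z * dReg (1 / ((n : ℝ) + 1)) (x - z) =
      ∫ y, W (x - (1 / ((n : ℝ) + 1)) • y) * dReg 1 y := fun n =>
    regularised_eq W (by positivity) x
  simp only [h1]
  obtain ⟨C, hC⟩ := H.exists_bound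
  have hc := H.continuous
  have h2 : kappa * W x = ∫ y, W x * dReg 1 y := by rw [integral_const_mul, kappa, mul_comm]
  rw [h2]
  refine tendsto_integral_of_dominated_convergence (fun y => C * ‖dReg 1 y‖)
    (fun n => ?_) (integrable_dReg_one.norm.const_mul C)
    (fun n => Eventually.of_forall fun y => ?_) (Eventually.of_forall fun y => ?_)
  · refine Measurable.aestronglyMeasurable (Measurable.mul ?_ (measurable_dReg 1))
    exact (hc.comp (by fun_prop)).measurable
  · rw [norm_mul]; gcongr; exact hC _
  · refine Tendsto.mul_const _ ?_
    have : Tendsto (fun n : ℕ => x - (1 / ((n : ℝ) + 1)) • y) atTop (𝓝 (x - (0 : ℝ) • y)) :=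
      tendsto_const_nhds.sub (tendsto_one_div_add_atTop_nhds_zero_nat.smul_const y)
    rw [zero_smul, sub_zero] at this
    exact (hc.tendsto x).comp this

theorem tendsto_kReg (e y : Plane) :
    Tendsto (fun n : ℕ => kReg (1 / ((n : ℝ) + 1)) e y) atTop (𝓝 (kReg 0 e y)) := by
  rcases eq_or_ne y 0 with rfl | hy
  · simp [kReg]
  have hy0 : 0 < ‖y‖ := norm_pos_iff.2 hy
  unfold kReg
  exact tendsto_const_nhds.div (tendsto_const_nhds.add
    (tendsto_one_div_add_atTop_nhds_zero_nat.pow 2)) (by positivity)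

theorem tendsto_newt (H : NewtonData W h x₀ R M) (e x : Plane) :
    Tendsto (fun n : ℕ => ∫ z, h z * kReg (1 / ((n : ℝ) + 1)) e (x - z)) atTop
      (𝓝 (newt e h x)) := by
  obtain ⟨C, hC, hr⟩ := exists_riesz_bound (s := -1) (by norm_num) (by norm_num) x₀ R
  refine tendsto_integral_of_dominated_convergence
    ((ball x₀ R).indicator fun z => M * (‖e‖ * ‖x - z‖ ^ (-1 : ℝ)))
    (fun n => (H.meas.mul ((measurable_kReg _ e).comp
      (measurable_const.sub measurable_id))).aestronglyMeasurable)
    ((integrable_indicator_iff measurableSet_ball).2 (((hr x).1.const_mul ‖e‖).const_mul M))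
    (fun n => Eventually.of_forall fun z => H.abs_mul_le (fun z => abs_kReg_le_norm _ e _) z)
    (Eventually.of_forall fun z => (tendsto_kReg e _).const_mul _)

theorem exists_newt_bound (H : NewtonData W h x₀ R M) (e : Plane) :
    ∃ C, ∀ ε x, |∫ z, h z * kReg ε e (x - z)| ≤ C := by
  obtain ⟨C, hC, hr⟩ := exists_riesz_bound (s := -1) (by norm_num) (by norm_num) x₀ R
  refine ⟨M * (‖e‖ * C), fun ε x => ?_⟩
  refine (H.abs_integral_mul_le (fun z => abs_kReg_le_norm ε e (x - z))
    ((hr x).1.const_mul ‖e‖)).trans ?_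
  rw [integral_const_mul]
  have := H.nonneg_bound
  gcongr
  exact (hr x).2

theorem integrable_newt (H : NewtonData W h x₀ R M) (e x : Plane) :
    Integrable (fun z => h z * kReg 0 e (x - z)) := by
  obtain ⟨C, hC, hr⟩ := exists_riesz_bound (s := -1) (by norm_num) (by norm_num) x₀ R
  exact H.integrable_mul ((measurable_kReg 0 e).comp (measurable_const.sub measurable_id))
    (fun z => abs_kReg_le_norm 0 e (x - z)) ((hr x).1.const_mul ‖e‖)

theorem newt_holder (H : NewtonData W h x₀ R M) (e : Plane) :
    ∃ C, 0 ≤ C ∧ ∀ x x', |newt e h x - newt e h x'| ≤ C * √‖x - x'‖ := by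
  obtain ⟨C, hC, hr⟩ := exists_riesz_bound (s := -3 / 2) (by norm_num) (by norm_num) x₀ R
  have hM := H.nonneg_bound
  refine ⟨M * (2 * ‖e‖ * (C + C)), by positivity, fun x x' => ?_⟩
  have e1 : newt e h x - newt e h x' =
      ∫ z, h z * (kReg 0 e (x - z) - kReg 0 e (x' - z)) := by
    rw [newt, newt, ← integral_sub (H.integrable_newt e x) (H.integrable_newt e x')]
    simp only [mul_sub]
  rw [e1]
  refine (H.abs_integral_mul_le (fun z => abs_kReg_zero_sub_le e (x - z) (x' - z)) ?_).trans ?_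
  · simp only [sub_sub_sub_cancel_right]
    exact ((hr x).1.add (hr x').1).const_mul _
  · simp only [sub_sub_sub_cancel_right]
    rw [integral_const_mul, integral_add (hr x).1 (hr x').1]
    calc M * (2 * ‖e‖ * √‖x - x'‖ * _) ≤ M * (2 * ‖e‖ * √‖x - x'‖ * (C + C)) := by
          gcongr
          exacts [(hr x).2, (hr x').2]
      _ = _ := by ring

theorem continuous_newt (H : NewtonData W h x₀ R M) (e : Plane) : Continuous (newt e h) := by
  obtain ⟨C, hC, hc⟩ := H.newt_holder e
  refine continuous_iff_continuousAt.2 fun x => ?_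
  rw [ContinuousAt, tendsto_iff_norm_sub_tendsto_zero]
  have h1 : Tendsto (fun y => C * √‖y - x‖) (𝓝 x) (𝓝 0) := by
    have : Continuous fun y => C * √‖y - x‖ := by fun_prop
    simpa using this.tendsto x
  exact squeeze_zero (fun y => norm_nonneg _) (fun y => hc y x) h1

theorem kappa_mul_sub (H : NewtonData W h x₀ R M) (e x : Plane) (t : ℝ) :
    kappa * W (x + t • e) - kappa * W x = ∫ s in (0 : ℝ)..t, newt e h (x + s • e) := by
  obtain ⟨C, hC⟩ := H.exists_newt_bound e
  have hε : ∀ n : ℕ, 0 < 1 / ((n : ℝ) + 1) := fun n => by positivity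
  have hmeas : ∀ n : ℕ, Measurable fun s : ℝ =>
      ∫ z, h z * kReg (1 / ((n : ℝ) + 1)) e (x + s • e - z) := fun n => by
    have : (fun s : ℝ => ∫ z, h z * kReg (1 / ((n : ℝ) + 1)) e (x + s • e - z)) =
        deriv (fun t : ℝ => ∫ z, W z * dReg (1 / ((n : ℝ) + 1)) (x + t • e - z)) :=
      funext fun s => (H.hasDerivAt_regularised (hε n) e x s).deriv.symm
    rw [this]; exact measurable_deriv _
  have hftc : ∀ n : ℕ, ∫ s in (0 : ℝ)..t, ∫ z, h z * kReg (1 / ((n : ℝ) + 1)) e (x + s • e - z) =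
      (∫ z, W z * dReg (1 / ((n : ℝ) + 1)) (x + t • e - z)) -
      ∫ z, W z * dReg (1 / ((n : ℝ) + 1)) (x - z) := fun n => by
    have := intervalIntegral.integral_eq_sub_of_hasDerivAt (a := 0) (b := t)
      (fun s _ => H.hasDerivAt_regularised (hε n) e x s)
      ((intervalIntegrable_const (c := C)).mono_fun' (hmeas n).aestronglyMeasurable
        (Eventually.of_forall fun s => hC _ _))
    simpa using this
  have l1 := (H.tendsto_regularised (x + t • e)).sub (H.tendsto_regularised x)
  have l2 : Tendsto (fun n : ℕ => ∫ s in (0 : ℝ)..t,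
      ∫ z, h z * kReg (1 / ((n : ℝ) + 1)) e (x + s • e - z)) atTop
      (𝓝 (∫ s in (0 : ℝ)..t, newt e h (x + s • e))) :=
    intervalIntegral.tendsto_integral_filter_of_dominated_convergence (fun _ => C)
      (Eventually.of_forall fun n => (hmeas n).aestronglyMeasurable)
      (Eventually.of_forall fun n => Eventually.of_forall fun s _ => hC _ _)
      intervalIntegrable_const (Eventually.of_forall fun s _ => H.tendsto_newt e _)
  simp only [hftc] at l2
  exact tendsto_nhds_unique l1 l2

theorem kappa_mul_fderiv (H : NewtonData W h x₀ R M) (e x : Plane) :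
    kappa * fderiv ℝ W x e = newt e h x := by
  have hc : Continuous fun s : ℝ => newt e h (x + s • e) :=
    (H.continuous_newt e).comp (by fun_prop)
  have h1 := intervalIntegral.integral_hasDerivAt_right (hc.intervalIntegrable 0 0)
    hc.stronglyMeasurable.stronglyMeasurableAtFilter hc.continuousAt
  simp only [← H.kappa_mul_sub e x, zero_smul, add_zero] at h1
  have h2 := (((H.diff x).hasFDerivAt.hasLineDerivAt e).const_mul kappa).sub_const (kappa * W x)
  exact h2.unique h1

end NewtonData

theorem WeakLap.exists_newton {w g : Plane → ℝ} {x₀ : Plane} {r M : ℝ}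
    (H : WeakLap w g x₀ r M) (hr : 0 < r) :
    ∃ W h M', NewtonData W h x₀ r M' ∧ (∀ x ∈ ball x₀ (r / 4), h x = g x) ∧
      ∀ x ∈ ball x₀ (r / 4), ∀ e, kappa * fderiv ℝ w x e = newt e h x := by
  let η : ContDiffBump x₀ := ⟨r / 4, r / 2, by linarith, by linarith⟩
  have hη2 : ContDiff ℝ 2 η := η.contDiff
  have hts : tsupport η = closedBall x₀ (r / 2) := η.tsupport_eq
  have hsub : tsupport η ⊆ ball x₀ r := by
    rw [hts]; exact closedBall_subset_ball (by linarith)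
  have hη0 : ContDiff ℝ 1 (d0R η) := contDiff_d0R' (n := 1) hη2
  have hη1 : ContDiff ℝ 1 (d1R η) := contDiff_d1R' (n := 1) hη2
  have hη00 : Continuous (d0R (d0R η)) := (contDiff_d0R' (n := 0) hη0).continuous
  have hη11 : Continuous (d1R (d1R η)) := (contDiff_d1R' (n := 0) hη1).continuous
  have hlap : Continuous (lapR η) := hη00.add hη11
  have hz : ∀ x ∉ closedBall x₀ (r / 2), ((η : Plane → ℝ) =ᶠ[𝓝 x] fun _ => 0) := by
    intro x hx
    rw [← hts] at hx
    exact notMem_tsupport_iff_eventuallyEq.mp hx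
  have hd0 : ∀ x ∉ closedBall x₀ (r / 2), d0R η =ᶠ[𝓝 x] fun _ => 0 := by
    intro x hx
    filter_upwards [(hz x hx).eventuallyEq_nhds] with y hy
    simp [d0R, hy.fderiv_eq]
  have hd1 : ∀ x ∉ closedBall x₀ (r / 2), d1R η =ᶠ[𝓝 x] fun _ => 0 := by
    intro x hx
    filter_upwards [(hz x hx).eventuallyEq_nhds] with y hy
    simp [d1R, hy.fderiv_eq]
  have hl0 : ∀ x ∉ closedBall x₀ (r / 2), lapR η x = 0 := by
    intro x hx
    simp [lapR, (hd0 x hx).fderiv_eq, (hd1 x hx).fderiv_eq]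
  have hsrc0 : ∀ x ∉ closedBall x₀ (r / 2), cutSource η w g x = 0 := by
    intro x hx
    simp [cutSource, (hd0 x hx).eq_of_nhds, (hd1 x hx).eq_of_nhds, (hz x hx).eq_of_nhds, hl0 x hx]
  have hK : IsCompact (closedBall x₀ (r / 2)) := isCompact_closedBall _ _
  obtain ⟨A, hA⟩ := hK.exists_bound_of_continuousOn hη0.continuous.continuousOn
  obtain ⟨B, hB⟩ := hK.exists_bound_of_continuousOn hη1.continuous.continuousOn
  obtain ⟨L, hL⟩ := hK.exists_bound_of_continuousOn hlap.continuousOn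
  obtain ⟨N, hN⟩ := hK.exists_bound_of_continuousOn H.diff.continuous.continuousOn
  have hx0 : x₀ ∈ closedBall x₀ (r / 2) := mem_closedBall_self (by linarith)
  have hM0 : 0 ≤ M := (norm_nonneg _).trans (H.grad_le x₀ (mem_ball_self hr))
  have hA0 : 0 ≤ A := (norm_nonneg _).trans (hA x₀ hx0)
  have hB0 : 0 ≤ B := (norm_nonneg _).trans (hB x₀ hx0)
  have hL0 : 0 ≤ L := (norm_nonneg _).trans (hL x₀ hx0)
  have hN0 : 0 ≤ N := (norm_nonneg _).trans (hN x₀ hx0)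
  have hbd : ∀ x, |cutSource η w g x| ≤ 2 * (M * A + M * B) + M * 1 + N * L := by
    intro x
    by_cases hx : x ∈ closedBall x₀ (r / 2)
    · have hxb : x ∈ ball x₀ r := closedBall_subset_ball (by linarith) hx
      have e1 : |d0R w x * d0R η x| ≤ M * A := by
        rw [abs_mul]
        exact mul_le_mul ((abs_d0R_le w x).trans (H.grad_le x hxb)) (hA x hx) (abs_nonneg _) hM0
      have e2 : |d1R w x * d1R η x| ≤ M * B := by
        rw [abs_mul]
        exact mul_le_mul ((abs_d1R_le w x).trans (H.grad_le x hxb)) (hB x hx) (abs_nonneg _) hM0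
      have e3 : |g x * η x| ≤ M * 1 := by
        rw [abs_mul]
        exact mul_le_mul (H.le x hxb) (by rw [abs_of_nonneg η.nonneg]; exact η.le_one)
          (abs_nonneg _) hM0
      have e4 : |w x * lapR η x| ≤ N * L := by
        rw [abs_mul]
        exact mul_le_mul (hN x hx) (hL x hx) (abs_nonneg _) hN0
      unfold cutSource
      rw [abs_le] at *
      constructor <;> linarith [e1.1, e1.2, e2.1, e2.2, e3.1, e3.2, e4.1, e4.2]
    · rw [hsrc0 x hx, abs_zero]; positivity
  have hnot : ∀ x ∉ ball x₀ r, x ∉ closedBall x₀ (r / 2) := fun x hx hx' =>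
    hx (closedBall_subset_ball (by linarith) hx')
  have hND : NewtonData (fun x => η x * w x) (cutSource η w g) x₀ r
      (2 * (M * A + M * B) + M * 1 + N * L) :=
    { diff := (hη2.differentiable (by norm_num)).mul H.diff
      zero := fun x hx => by simp [(hz x (hnot x hx)).eq_of_nhds]
      meas := by
        have := measurable_d0R w
        have := measurable_d1R w
        have := hη0.continuous.measurable
        have := hη1.continuous.measurable
        have := hη2.continuous.measurable
        have := hlap.measurable
        have := H.diff.continuous.measurable
        have := H.meas
        unfold cutSource
        fun_prop
      le := hbd
      source_zero := fun x hx => hsrc0 x (hnot x hx)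
      weak := fun φ hφ => H.integral_cutoff hη2 hsub hφ }
  have hone : ∀ x ∈ ball x₀ (r / 4), (η : Plane → ℝ) =ᶠ[𝓝 x] fun _ => 1 := fun x hx =>
    η.eventuallyEq_one_of_mem_ball hx
  refine ⟨_, _, _, hND, fun x hx => ?_, fun x hx e => ?_⟩
  · have h0 : d0R η =ᶠ[𝓝 x] fun _ => 0 := by
      filter_upwards [(hone x hx).eventuallyEq_nhds] with y hy
      simp [d0R, hy.fderiv_eq]
    have h1 : d1R η =ᶠ[𝓝 x] fun _ => 0 := by
      filter_upwards [(hone x hx).eventuallyEq_nhds] with y hy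
      simp [d1R, hy.fderiv_eq]
    have hl : lapR η x = 0 := by simp [lapR, h0.fderiv_eq, h1.fderiv_eq]
    simp [cutSource, h0.eq_of_nhds, h1.eq_of_nhds, hl, (hone x hx).eq_of_nhds]
  · rw [← hND.kappa_mul_fderiv e x]
    have : (fun x => η x * w x) =ᶠ[𝓝 x] w := by
      filter_upwards [hone x hx] with y hy
      rw [hy, one_mul]
    rw [this.fderiv_eq]

/-- Bounded sources give a Hölder continuous gradient. -/
theorem WeakLap.fderiv_holder {w g : Plane → ℝ} {x₀ : Plane} {r M : ℝ}
    (H : WeakLap w g x₀ r M) (hr : 0 < r) :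
    ∃ C, 0 ≤ C ∧ ∀ x ∈ ball x₀ (r / 4), |d0R w x - d0R w x₀| ≤ C * √‖x - x₀‖ ∧
      |d1R w x - d1R w x₀| ≤ C * √‖x - x₀‖ := by
  obtain ⟨W, h, M', hN, -, hk⟩ := H.exists_newton hr
  obtain ⟨C, hC0, hC⟩ := hN.newt_holder e0
  obtain ⟨D, hD0, hD⟩ := hN.newt_holder e1
  have hκ := kappa_pos
  have hx0 : x₀ ∈ ball x₀ (r / 4) := mem_ball_self (by linarith)
  refine ⟨(C + D) / kappa, by positivity, fun x hx => ?_⟩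
  have key : ∀ e, kappa * |fderiv ℝ w x e - fderiv ℝ w x₀ e| = |newt e h x - newt e h x₀| := by
    intro e
    rw [← hk x hx e, ← hk x₀ hx0 e, ← mul_sub, abs_mul, abs_of_pos hκ]
  have hs := Real.sqrt_nonneg ‖x - x₀‖
  constructor
  · unfold d0R
    rw [div_mul_eq_mul_div, le_div_iff₀ hκ, mul_comm, key]
    exact (hC x x₀).trans (by nlinarith)
  · unfold d1R
    rw [div_mul_eq_mul_div, le_div_iff₀ hκ, mul_comm, key]
    exact (hD x x₀).trans (by nlinarith)

theorem rpow_kernel_le {a b c β : ℝ} (ha : 0 < a) (hb : 0 < b) (hc : 0 < c) (hcab : c ≤ a + b)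
    (hβ : 0 < β) (hβ1 : β ≤ 1) :
    a ^ β * (c ^ 2 / (a ^ 2 * b)) ≤ 2 * c ^ (1 + β / 2) * (a ^ (β / 2 - 2) + b ^ (β / 2 - 2)) := by
  have hpow : ∀ m, 0 < m → c ≤ 2 * m → c ^ (1 - β / 2) ≤ 2 * m ^ (1 - β / 2) := by
    intro m hm hcm
    calc c ^ (1 - β / 2) ≤ (2 * m) ^ (1 - β / 2) :=
          Real.rpow_le_rpow hc.le hcm (by linarith)
      _ = 2 ^ (1 - β / 2) * m ^ (1 - β / 2) := Real.mul_rpow (by norm_num) hm.le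
      _ ≤ 2 * m ^ (1 - β / 2) := by
          gcongr
          calc (2 : ℝ) ^ (1 - β / 2) ≤ 2 ^ (1 : ℝ) :=
                Real.rpow_le_rpow_of_exponent_le (by norm_num) (by linarith)
            _ = 2 := by norm_num
  have hc2 : c ^ 2 = c ^ (1 + β / 2) * c ^ (1 - β / 2) := by
    rw [← Real.rpow_add hc, ← Real.rpow_two]; congr 1; ring
  have hl : a ^ β * (c ^ 2 / (a ^ 2 * b)) =
      c ^ (1 + β / 2) * (c ^ (1 - β / 2) * (a ^ (β - 2) * b ^ (-1 : ℝ))) := by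
    rw [hc2, Real.rpow_sub ha, Real.rpow_two, Real.rpow_neg_one]
    field_simp
  rw [hl, mul_comm 2, mul_assoc]
  refine mul_le_mul_of_nonneg_left ?_ (by positivity)
  have ha' : 0 < a ^ (β / 2 - 2) := Real.rpow_pos_of_pos ha _
  have hb' : 0 < b ^ (β / 2 - 2) := Real.rpow_pos_of_pos hb _
  rcases le_total a b with hab | hab
  · calc c ^ (1 - β / 2) * (a ^ (β - 2) * b ^ (-1 : ℝ))
        ≤ 2 * b ^ (1 - β / 2) * (a ^ (β - 2) * b ^ (-1 : ℝ)) := by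
          gcongr; exact hpow b hb (by linarith)
      _ = 2 * (a ^ (β - 2) * b ^ (-(β / 2))) := by
          have : b ^ (-(β / 2)) = b ^ (1 - β / 2) * b ^ (-1 : ℝ) := by
            rw [← Real.rpow_add hb]; congr 1; ring
          rw [this]; ring
      _ ≤ 2 * (a ^ (β - 2) * a ^ (-(β / 2))) := by
          gcongr 2 * (_ * ?_)
          exact Real.rpow_le_rpow_of_nonpos ha hab (by linarith)
      _ = 2 * a ^ (β / 2 - 2) := by
          rw [← Real.rpow_add ha]; congr 2; ring
      _ ≤ _ := by linarith
  · calc c ^ (1 - β / 2) * (a ^ (β - 2) * b ^ (-1 : ℝ))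
        ≤ 2 * a ^ (1 - β / 2) * (a ^ (β - 2) * b ^ (-1 : ℝ)) := by
          gcongr; exact hpow a ha (by linarith)
      _ = 2 * (a ^ (β / 2 - 1) * b ^ (-1 : ℝ)) := by
          have : a ^ (β / 2 - 1) = a ^ (1 - β / 2) * a ^ (β - 2) := by
            rw [← Real.rpow_add ha]; congr 1; ring
          rw [this]; ring
      _ ≤ 2 * (b ^ (β / 2 - 1) * b ^ (-1 : ℝ)) := by
          gcongr 2 * (?_ * _)
          exact Real.rpow_le_rpow_of_nonpos hb hab (by linarith)
      _ = 2 * b ^ (β / 2 - 2) := by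
          rw [← Real.rpow_add hb]; congr 2; ring
      _ ≤ _ := by linarith

/-- The identification of the plane with the complex numbers. -/
def planeZ : Plane →L[ℝ] ℂ :=
  (Complex.orthonormalBasisOneI.repr.symm.toContinuousLinearEquiv : Plane →L[ℝ] ℂ)

theorem planeZ_apply (x : Plane) : planeZ x = (x 0 : ℂ) + (x 1 : ℂ) * Complex.I :=
  Complex.orthonormalBasisOneI_repr_symm_apply x

theorem norm_planeZ (x : Plane) : ‖planeZ x‖ = ‖x‖ :=
  Complex.orthonormalBasisOneI.repr.symm.norm_map x

theorem planeZ_e0 : planeZ e0 = 1 := by simp [planeZ_apply, e0]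

theorem planeZ_e1 : planeZ e1 = Complex.I := by simp [planeZ_apply, e1]

theorem kReg_zero_e0 (y : Plane) : kReg 0 e0 y = (planeZ y)⁻¹.re := by
  rw [kReg, Complex.inv_re, inner_plane, Complex.normSq_eq_norm_sq, norm_planeZ, planeZ_apply]
  simp [e0]

theorem kReg_zero_e1 (y : Plane) : kReg 0 e1 y = -(planeZ y)⁻¹.im := by
  rw [kReg, Complex.inv_im, inner_plane, Complex.normSq_eq_norm_sq, norm_planeZ, planeZ_apply]
  simp [e1, neg_div]

namespace NewtonData

variable {W h : Plane → ℝ} {x₀ : Plane} {R M : ℝ}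

/-- A source vanishing to positive order at `x₀` produces a differentiable gradient at `x₀`. -/
theorem hasFDerivAt_newt (H : NewtonData W h x₀ R M) {β C : ℝ} (hβ : 0 < β) (hβ1 : β ≤ 1)
    (hC : ∀ z, |h z| ≤ C * ‖z - x₀‖ ^ β) :
    ∃ A : ℂ, HasFDerivAt (fun x => ∫ z, (h z : ℂ) * (planeZ (x - z))⁻¹) (A • planeZ) x₀ := by
  obtain ⟨K, hK0, hK⟩ := exists_riesz_bound (s := β / 2 - 2) (by linarith) (by linarith) x₀ R
  obtain ⟨_, _, hK₁⟩ := exists_riesz_bound (s := β - 2) (by linarith) (by linarith) x₀ R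
  obtain ⟨_, _, hK₂⟩ := exists_riesz_bound (s := -1) (by norm_num) (by norm_num) x₀ R
  have hmh : Measurable fun z => (h z : ℂ) := Complex.measurable_ofReal.comp H.meas
  have hmZ : ∀ x, Measurable fun z => planeZ (x - z) := fun x =>
    (planeZ.continuous.comp (continuous_const.sub continuous_id)).measurable
  have hmZ' : Measurable fun z => planeZ (z - x₀) :=
    (planeZ.continuous.comp (continuous_id.sub continuous_const)).measurable
  have hzero : ∀ z ∉ ball x₀ R, (h z : ℂ) = 0 := fun z hz => by
    rw [H.source_zero z hz, Complex.ofReal_zero]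
  have hM := H.nonneg_bound
  have i1 : ∀ x, Integrable (fun z => (h z : ℂ) * (planeZ (x - z))⁻¹) := by
    intro x
    rw [← integrableOn_iff_integrable_of_support_subset (s := ball x₀ R)
      (Function.support_subset_iff'.2 fun z hz => by simp [hzero z hz])]
    refine ((hK₂ x).1.const_mul M).mono' (hmh.mul (hmZ x).inv).aestronglyMeasurable
      (Eventually.of_forall fun z => ?_)
    rw [norm_mul, norm_inv, norm_planeZ, Complex.norm_real, Real.rpow_neg_one]
    gcongr
    exact H.le z
  have i2 : Integrable (fun z => (h z : ℂ) * ((planeZ (z - x₀)) ^ 2)⁻¹) := by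
    rw [← integrableOn_iff_integrable_of_support_subset (s := ball x₀ R)
      (Function.support_subset_iff'.2 fun z hz => by simp [hzero z hz])]
    refine ((hK₁ x₀).1.const_mul C).mono' (hmh.mul (hmZ'.pow_const 2).inv).aestronglyMeasurable
      (Eventually.of_forall fun z => ?_)
    rw [norm_mul, norm_inv, norm_pow, norm_planeZ, Complex.norm_real, norm_sub_rev x₀ z]
    rcases eq_or_ne z x₀ with rfl | hz
    · have := hC z
      rw [sub_self, norm_zero, Real.zero_rpow hβ.ne', mul_zero] at this
      have h0 : h z = 0 := abs_nonpos_iff.1 this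
      simp [h0, Real.zero_rpow (show β - 2 ≠ 0 by linarith)]
    · have hp : 0 < ‖z - x₀‖ := norm_pos_iff.2 (sub_ne_zero.2 hz)
      rw [Real.rpow_sub hp, Real.rpow_two, div_eq_mul_inv, ← mul_assoc]
      gcongr
      exact hC z
  set A : ℂ := -∫ z, (h z : ℂ) * ((planeZ (z - x₀)) ^ 2)⁻¹ with hA
  refine ⟨A, ?_⟩
  have hC0 : 0 ≤ C := by
    have h1 := (abs_nonneg _).trans (hC (x₀ + e0))
    rwa [add_sub_cancel_left, norm_e0, Real.one_rpow, mul_one] at h1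
  have key : ∀ x, ‖(∫ z, (h z : ℂ) * (planeZ (x - z))⁻¹) - (∫ z, (h z : ℂ) * (planeZ (x₀ - z))⁻¹)
      - (A • planeZ) (x - x₀)‖ ≤ C * (2 * ‖x - x₀‖ ^ (1 + β / 2) * (K + K)) := by
    intro x
    rcases eq_or_ne x x₀ with rfl | hx
    · simp only [sub_self, map_zero, norm_zero]; positivity
    have hq : 0 < ‖x - x₀‖ := norm_pos_iff.2 (sub_ne_zero.2 hx)
    have e1 : (∫ z, (h z : ℂ) * (planeZ (x - z))⁻¹) - (∫ z, (h z : ℂ) * (planeZ (x₀ - z))⁻¹)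
        - (A • planeZ) (x - x₀) = ∫ z, (h z : ℂ) * ((planeZ (x - z))⁻¹ - (planeZ (x₀ - z))⁻¹
          + planeZ (x - x₀) * ((planeZ (z - x₀)) ^ 2)⁻¹) := by
      have e2 : (fun z => (h z : ℂ) * ((planeZ (x - z))⁻¹ - (planeZ (x₀ - z))⁻¹
          + planeZ (x - x₀) * ((planeZ (z - x₀)) ^ 2)⁻¹)) = fun z =>
          ((h z : ℂ) * (planeZ (x - z))⁻¹ - (h z : ℂ) * (planeZ (x₀ - z))⁻¹)
          + planeZ (x - x₀) * ((h z : ℂ) * ((planeZ (z - x₀)) ^ 2)⁻¹) := by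
        funext z; ring
      have i4 : Integrable (fun z => (h z : ℂ) * (planeZ (x - z))⁻¹
          - (h z : ℂ) * (planeZ (x₀ - z))⁻¹) := (i1 x).sub (i1 x₀)
      rw [e2, integral_add i4 (i2.const_mul _), integral_sub (i1 x) (i1 x₀),
        integral_const_mul, hA]
      simp only [smul_apply, smul_eq_mul]
      ring
    rw [e1, ← setIntegral_eq_integral_of_forall_compl_eq_zero (s := ball x₀ R)
      (fun z hz => by rw [hzero z hz, zero_mul])]
    have i3 : IntegrableOn (fun z => C * (2 * ‖x - x₀‖ ^ (1 + β / 2) *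
        (‖x₀ - z‖ ^ (β / 2 - 2) + ‖x - z‖ ^ (β / 2 - 2)))) (ball x₀ R) :=
      (((hK x₀).1.add (hK x).1).const_mul _).const_mul _
    have hne : ∀ y : Plane, ∀ᵐ z ∂(volume.restrict (ball x₀ R)), z ≠ y := fun y =>
      ae_restrict_of_ae (Measure.ae_ne volume y)
    refine (norm_integral_le_of_norm_le i3 ?_).trans ?_
    · filter_upwards [hne x₀, hne x] with z hz0 hz1
      have hp0 : planeZ (z - x₀) ≠ 0 := by
        rw [← norm_ne_zero_iff, norm_planeZ, norm_ne_zero_iff]; exact sub_ne_zero.2 hz0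
      have hpq : planeZ (x - z) ≠ 0 := by
        rw [← norm_ne_zero_iff, norm_planeZ, norm_ne_zero_iff]; exact sub_ne_zero.2 hz1.symm
      have e3 : planeZ (x₀ - z) = -planeZ (z - x₀) := by rw [← map_neg, neg_sub]
      have e4 : planeZ (x - x₀) = planeZ (x - z) + planeZ (z - x₀) := by
        rw [← map_add, sub_add_sub_cancel]
      have e5 : (planeZ (x - z))⁻¹ - (planeZ (x₀ - z))⁻¹
          + planeZ (x - x₀) * ((planeZ (z - x₀)) ^ 2)⁻¹ =
          planeZ (x - x₀) ^ 2 / (planeZ (z - x₀) ^ 2 * planeZ (x - z)) := by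
        rw [e3, e4]; field_simp; ring
      rw [e5, norm_mul, norm_div, norm_mul, norm_pow, norm_pow, norm_planeZ, norm_planeZ,
        norm_planeZ, Complex.norm_real, norm_sub_rev x₀ z]
      have hb := rpow_kernel_le (a := ‖z - x₀‖) (b := ‖x - z‖) (c := ‖x - x₀‖)
        (norm_pos_iff.2 (sub_ne_zero.2 hz0)) (norm_pos_iff.2 (sub_ne_zero.2 hz1.symm)) hq
        (by rw [add_comm, ← sub_add_sub_cancel x z x₀]; exact norm_add_le _ _) hβ hβ1
      calc _ ≤ C * ‖z - x₀‖ ^ β * (‖x - x₀‖ ^ 2 / (‖z - x₀‖ ^ 2 * ‖x - z‖)) := by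
            gcongr; exact hC z
        _ ≤ _ := by rw [mul_assoc]; gcongr
    · rw [integral_const_mul, integral_const_mul, integral_add (hK x₀).1 (hK x).1]
      gcongr
      exacts [(hK x₀).2, (hK x).2]
  refine HasFDerivAt.of_isLittleO (Asymptotics.isLittleO_iff.2 fun c hc => ?_)
  have ht : Tendsto (fun x : Plane => C * (2 * ‖x - x₀‖ ^ (β / 2) * (K + K))) (𝓝 x₀) (𝓝 0) := by
    have h1 : Tendsto (fun x : Plane => ‖x - x₀‖ ^ (β / 2)) (𝓝 x₀) (𝓝 0) := by
      have h2 : Tendsto (fun x : Plane => ‖x - x₀‖) (𝓝 x₀) (𝓝 0) := by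
        have : Continuous fun x : Plane => ‖x - x₀‖ := by fun_prop
        simpa using this.tendsto x₀
      have := h2.rpow_const (p := β / 2) (Or.inr (by linarith))
      rwa [Real.zero_rpow (by linarith)] at this
    have := (((h1.const_mul 2).mul_const (K + K)).const_mul C)
    simpa using this
  filter_upwards [ht.eventually_le_const hc] with x hx
  refine (key x).trans ?_
  rcases eq_or_ne x x₀ with rfl | hne
  · simp [Real.zero_rpow (show 1 + β / 2 ≠ 0 by linarith)]
  · rw [Real.rpow_add (norm_pos_iff.2 (sub_ne_zero.2 hne)), Real.rpow_one]
    calc _ = C * (2 * ‖x - x₀‖ ^ (β / 2) * (K + K)) * ‖x - x₀‖ := by ring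
      _ ≤ _ := by gcongr

theorem integrable_complex (H : NewtonData W h x₀ R M) (x : Plane) :
    Integrable (fun z => (h z : ℂ) * (planeZ (x - z))⁻¹) := by
  have e : (fun z => (h z : ℂ) * (planeZ (x - z))⁻¹) = fun z =>
      ((h z * kReg 0 e0 (x - z) : ℝ) : ℂ) - Complex.I * ((h z * kReg 0 e1 (x - z) : ℝ) : ℂ) := by
    funext z
    rw [kReg_zero_e0, kReg_zero_e1]
    apply Complex.ext <;> simp
  rw [e]
  exact (H.integrable_newt e0 x).ofReal.sub ((H.integrable_newt e1 x).ofReal.const_mul _)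

theorem newt_e0 (H : NewtonData W h x₀ R M) (x : Plane) :
    newt e0 h x = (∫ z, (h z : ℂ) * (planeZ (x - z))⁻¹).re := by
  rw [newt, ← Complex.reCLM_apply, ← Complex.reCLM.integral_comp_comm (H.integrable_complex x)]
  simp [kReg_zero_e0]

theorem newt_e1 (H : NewtonData W h x₀ R M) (x : Plane) :
    newt e1 h x = -(∫ z, (h z : ℂ) * (planeZ (x - z))⁻¹).im := by
  rw [newt, ← Complex.imCLM_apply, ← Complex.imCLM.integral_comp_comm (H.integrable_complex x),
    ← integral_neg]
  simp [kReg_zero_e1]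

theorem differentiableAt_newt (H : NewtonData W h x₀ R M) {β C : ℝ} (hβ : 0 < β) (hβ1 : β ≤ 1)
    (hC : ∀ z, |h z| ≤ C * ‖z - x₀‖ ^ β) :
    DifferentiableAt ℝ (newt e0 h) x₀ ∧ DifferentiableAt ℝ (newt e1 h) x₀ ∧
      fderiv ℝ (newt e0 h) x₀ e0 + fderiv ℝ (newt e1 h) x₀ e1 = 0 := by
  obtain ⟨A, hA⟩ := H.hasFDerivAt_newt hβ hβ1 hC
  have h0 := Complex.reCLM.hasFDerivAt.comp x₀ hA
  have h1 := (Complex.imCLM.hasFDerivAt.comp x₀ hA).neg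
  have e0' : newt e0 h = Complex.reCLM ∘ fun x => ∫ z, (h z : ℂ) * (planeZ (x - z))⁻¹ :=
    funext fun x => H.newt_e0 x
  have e1' : newt e1 h = -(Complex.imCLM ∘ fun x => ∫ z, (h z : ℂ) * (planeZ (x - z))⁻¹) :=
    funext fun x => H.newt_e1 x
  rw [← e0'] at h0
  rw [← e1'] at h1
  refine ⟨h0.differentiableAt, h1.differentiableAt, ?_⟩
  rw [h0.fderiv, h1.fderiv]
  simp [planeZ_e0, planeZ_e1]

end NewtonData

/-- A quadratic function with constant Laplacian `c`. -/
def quadP (c : ℝ) (x₀ x : Plane) : ℝ := c / 4 * ‖x - x₀‖ ^ 2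

theorem hasFDerivAt_quadP (c : ℝ) (x₀ x : Plane) :
    HasFDerivAt (quadP c x₀) ((c / 2) • innerSL ℝ (x - x₀)) x := by
  have h := (((hasFDerivAt_id x).sub_const x₀).norm_sq).const_mul (c / 4)
  refine h.congr_fderiv ?_
  ext v
  simp
  ring

theorem d0R_quadP (c : ℝ) (x₀ x : Plane) : d0R (quadP c x₀) x = c / 2 * (x 0 - x₀ 0) := by
  rw [d0R, (hasFDerivAt_quadP c x₀ x).fderiv]
  simp [inner_plane, e0]

theorem d1R_quadP (c : ℝ) (x₀ x : Plane) : d1R (quadP c x₀) x = c / 2 * (x 1 - x₀ 1) := by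
  rw [d1R, (hasFDerivAt_quadP c x₀ x).fderiv]
  simp [inner_plane, e1]

theorem fderiv_sub_quadP {w : Plane → ℝ} {x : Plane} (hw : DifferentiableAt ℝ w x) (c : ℝ)
    (x₀ : Plane) : fderiv ℝ (fun x => w x - quadP c x₀ x) x =
      fderiv ℝ w x - (c / 2) • innerSL ℝ (x - x₀) :=
  (hw.hasFDerivAt.sub (hasFDerivAt_quadP c x₀ x)).fderiv

theorem hasFDerivAt_coord (i : Fin 2) (k p : ℝ) (x : Plane) :
    HasFDerivAt (fun y : Plane => k * (y i - p))
      (k • (EuclideanSpace.proj i : Plane →L[ℝ] ℝ)) x :=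
  ((EuclideanSpace.proj i : Plane →L[ℝ] ℝ).hasFDerivAt.sub_const p).const_mul k

theorem integral_coord_mul (i : Fin 2) {v : Plane} (hv : v i = 1) (k p : ℝ) {ψ : Plane → ℝ}
    (hψ : TestFun ψ) :
    Integrable (fun x => k * (x i - p) * fderiv ℝ ψ x v + k * ψ x) ∧
      ∫ x, (k * (x i - p) * fderiv ℝ ψ x v + k * ψ x) = 0 := by
  have hc : Continuous fun x : Plane => k * (x i - p) := by fun_prop
  have hd : ∀ x, fderiv ℝ (fun y : Plane => k * (y i - p) * ψ y) x v
      = k * (x i - p) * fderiv ℝ ψ x v + k * ψ x := by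
    intro x
    have h := (hasFDerivAt_coord i k p x).mul (hψ.diff x).hasFDerivAt
    have h' : fderiv ℝ (fun y : Plane => k * (y i - p) * ψ y) x = _ := h.fderiv
    rw [h']
    simp [hv]
    ring
  have hi1 : Integrable (fun x : Plane => k * (x i - p) * ψ x) :=
    integrable_mul_of_hasCompactSupport hc hψ.smooth.continuous hψ.supp
  have hi2 : Integrable (fun x => k * (x i - p) * fderiv ℝ ψ x v + k * ψ x) := by
    refine (integrable_mul_of_hasCompactSupport hc
      ((hψ.smooth.continuous_fderiv (by norm_num)).clm_apply continuous_const) ?_).add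
      (integrable_mul_of_hasCompactSupport continuous_const hψ.smooth.continuous hψ.supp)
    exact (hψ.supp.fderiv (𝕜 := ℝ)).mono fun x hx => by
      rw [Function.mem_support] at hx ⊢
      exact fun h0 => hx (by rw [h0]; rfl)
  refine ⟨hi2, ?_⟩
  have := integral_fderiv_eq_zero (f := fun y : Plane => k * (y i - p) * ψ y)
    (fun x => ((hasFDerivAt_coord i k p x).mul (hψ.diff x).hasFDerivAt).differentiableAt) v hi1
    (by simpa only [hd] using hi2)
  simpa only [hd] using this

theorem WeakLap.sub_quadP {w g : Plane → ℝ} {x₀ : Plane} {r M : ℝ}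
    (H : WeakLap w g x₀ r M) (c : ℝ) :
    WeakLap (fun x => w x - quadP c x₀ x) (fun x => g x - c) x₀ r (M + |c| + |c| / 2 * r) := by
  have hfd := fun x => fderiv_sub_quadP (H.diff x) c x₀
  have hd0 : ∀ x, d0R (fun x => w x - quadP c x₀ x) x = d0R w x - c / 2 * (x 0 - x₀ 0) := by
    intro x
    rw [← d0R_quadP, d0R, hfd, d0R, d0R, (hasFDerivAt_quadP c x₀ x).fderiv]; rfl
  have hd1 : ∀ x, d1R (fun x => w x - quadP c x₀ x) x = d1R w x - c / 2 * (x 1 - x₀ 1) := by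
    intro x
    rw [← d1R_quadP, d1R, hfd, d1R, d1R, (hasFDerivAt_quadP c x₀ x).fderiv]; rfl
  refine ⟨fun x => ((H.diff x).hasFDerivAt.sub (hasFDerivAt_quadP c x₀ x)).differentiableAt,
    H.meas.sub_const c, fun x hx => ?_, fun x hx => ?_, fun ψ hψ hs => ?_⟩
  · rw [hfd]
    refine (norm_sub_le _ _).trans ?_
    rw [norm_smul, innerSL_apply_norm, Real.norm_eq_abs, abs_div, abs_two]
    have h1 := H.grad_le x hx
    have h2 : ‖x - x₀‖ ≤ r := (mem_ball_iff_norm.1 hx).le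
    have h3 : |c| / 2 * ‖x - x₀‖ ≤ |c| / 2 * r := by gcongr
    linarith [abs_nonneg c]
  · have h2 : 0 < r := (norm_nonneg _).trans_lt (mem_ball_iff_norm.1 hx)
    have h3 : 0 ≤ |c| / 2 * r := by positivity
    linarith [abs_sub (g x) c, H.le x hx]
  · have hz : ∀ x ∉ ball x₀ r, ψ x = 0 := fun x hx => image_eq_zero_of_notMem_tsupport
      fun h => hx (hs h)
    have hz' : ∀ x ∉ ball x₀ r, fderiv ℝ ψ x = 0 := fun x hx => by
      have := tsupport_fderiv_subset ℝ (f := ψ)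
      exact image_eq_zero_of_notMem_tsupport fun h => hx (hs (this h))
    have i0 := integrable_mul_of_bounded_ball (measurable_d0R w)
      (fun x hx => (abs_d0R_le w x).trans (H.grad_le x hx)) hψ.continuous_d0R
      (fun x hx => by rw [d0R, hz' x hx]; rfl)
    have i1 := integrable_mul_of_bounded_ball (measurable_d1R w)
      (fun x hx => (abs_d1R_le w x).trans (H.grad_le x hx)) hψ.continuous_d1R
      (fun x hx => by rw [d1R, hz' x hx]; rfl)
    have i2 := integrable_mul_of_bounded_ball H.meas H.le hψ.smooth.continuous hz
    obtain ⟨j0, k0⟩ := integral_coord_mul 0 (v := e0) (by simp [e0]) (c / 2) (x₀ 0) hψ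
    obtain ⟨j1, k1⟩ := integral_coord_mul 1 (v := e1) (by simp [e1]) (c / 2) (x₀ 1) hψ
    have hw := H.weak ψ hψ hs
    have e : (fun x => d0R (fun x => w x - quadP c x₀ x) x * d0R ψ x
        + d1R (fun x => w x - quadP c x₀ x) x * d1R ψ x + (g x - c) * ψ x) = fun x =>
        (d0R w x * d0R ψ x + d1R w x * d1R ψ x + g x * ψ x)
        - ((c / 2 * (x 0 - x₀ 0) * fderiv ℝ ψ x e0 + c / 2 * ψ x)
          + (c / 2 * (x 1 - x₀ 1) * fderiv ℝ ψ x e1 + c / 2 * ψ x)) := by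
      funext x
      rw [hd0, hd1]
      simp only [d0R, d1R]
      ring
    have i3 : Integrable (fun x => d0R w x * d0R ψ x + d1R w x * d1R ψ x + g x * ψ x) :=
      (i0.add i1).add i2
    have j2 : Integrable (fun x => (c / 2 * (x 0 - x₀ 0) * fderiv ℝ ψ x e0 + c / 2 * ψ x)
          + (c / 2 * (x 1 - x₀ 1) * fderiv ℝ ψ x e1 + c / 2 * ψ x)) := j0.add j1
    rw [e, integral_sub i3 j2, hw, integral_add j0 j1, k0, k1]
    simp

/-- Schauder-type pointwise regularity: a source which is Hölder at `x₀` gives a twice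
differentiable solution at `x₀`. -/
theorem WeakLap.lapR_eq {w g : Plane → ℝ} {x₀ : Plane} {r M : ℝ}
    (H : WeakLap w g x₀ r M) (hr : 0 < r) {β C ρ : ℝ} (hβ : 0 < β) (hβ1 : β ≤ 1) (hρ : 0 < ρ)
    (hC : ∀ x ∈ ball x₀ ρ, |g x - g x₀| ≤ C * ‖x - x₀‖ ^ β) :
    DifferentiableAt ℝ (d0R w) x₀ ∧ DifferentiableAt ℝ (d1R w) x₀ ∧ lapR w x₀ = g x₀ := by
  set c := g x₀ with hc
  obtain ⟨W, h, M', hN, hh, hk⟩ := (H.sub_quadP c).exists_newton hr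
  have hM' := hN.nonneg_bound
  set s := min ρ (r / 4) with hs
  have hs0 : 0 < s := lt_min hρ (by linarith)
  have hbound : ∀ z, |h z| ≤ (|C| + M' / s ^ β) * ‖z - x₀‖ ^ β := by
    intro z
    by_cases hz : z ∈ ball x₀ s
    · rw [hh z (ball_subset_ball (min_le_right _ _) hz)]
      refine (hC z (ball_subset_ball (min_le_left _ _) hz)).trans ?_
      gcongr
      have : 0 ≤ M' / s ^ β := by positivity
      linarith [le_abs_self C]
    · have hz' : s ≤ ‖z - x₀‖ := by rwa [mem_ball_iff_norm, not_lt] at hz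
      have h1 : s ^ β ≤ ‖z - x₀‖ ^ β := Real.rpow_le_rpow hs0.le hz' hβ.le
      have hsp : 0 < s ^ β := Real.rpow_pos_of_pos hs0 _
      calc |h z| ≤ M' := hN.le z
        _ = M' / s ^ β * s ^ β := by field_simp
        _ ≤ M' / s ^ β * ‖z - x₀‖ ^ β := by gcongr
        _ ≤ _ := by
          gcongr
          linarith [abs_nonneg C]
  obtain ⟨hd0, hd1, hdiv⟩ := hN.differentiableAt_newt hβ hβ1 hbound
  have hκ := kappa_pos
  have hev : ∀ᶠ x in 𝓝 x₀, x ∈ ball x₀ (r / 4) := ball_mem_nhds _ (by linarith)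
  have q0 : d0R w =ᶠ[𝓝 x₀] fun x => kappa⁻¹ * newt e0 h x + c / 2 * (x 0 - x₀ 0) := by
    filter_upwards [hev] with x hx
    rw [← hk x hx e0, fderiv_sub_quadP (H.diff x),
      inv_mul_cancel_left₀ hκ.ne', ← d0R_quadP, d0R, d0R, (hasFDerivAt_quadP c x₀ x).fderiv]
    simp
  have q1 : d1R w =ᶠ[𝓝 x₀] fun x => kappa⁻¹ * newt e1 h x + c / 2 * (x 1 - x₀ 1) := by
    filter_upwards [hev] with x hx
    rw [← hk x hx e1, fderiv_sub_quadP (H.diff x),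
      inv_mul_cancel_left₀ hκ.ne', ← d1R_quadP, d1R, d1R, (hasFDerivAt_quadP c x₀ x).fderiv]
    simp
  have f0 := ((hd0.hasFDerivAt.const_mul kappa⁻¹).add
    (hasFDerivAt_coord 0 (c / 2) (x₀ 0) x₀)).congr_of_eventuallyEq q0
  have f1 := ((hd1.hasFDerivAt.const_mul kappa⁻¹).add
    (hasFDerivAt_coord 1 (c / 2) (x₀ 1) x₀)).congr_of_eventuallyEq q1
  refine ⟨f0.differentiableAt, f1.differentiableAt, ?_⟩
  rw [lapR, f0.fderiv, f1.fderiv]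
  have e00 : e0 0 = 1 := by simp [e0]
  have e11 : e1 1 = 1 := by simp [e1]
  simp only [add_apply, smul_apply, smul_eq_mul, PiLp.proj_apply, e00, e11]
  linear_combination kappa⁻¹ * hdiv

/-- Hölder continuity of exponent `β` at the point `x₀`. -/
def HolderAt (β : ℝ) (x₀ : Plane) (f : Plane → ℝ) : Prop :=
  (fun x => f x - f x₀) =O[𝓝 x₀] fun x => ‖x - x₀‖ ^ β

namespace HolderAt

variable {β : ℝ} {x₀ : Plane} {f g : Plane → ℝ}

theorem add (hf : HolderAt β x₀ f) (hg : HolderAt β x₀ g) : HolderAt β x₀ (fun x => f x + g x) :=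
  (Asymptotics.IsBigO.add hf hg).congr_left fun x => by ring

theorem sub (hf : HolderAt β x₀ f) (hg : HolderAt β x₀ g) : HolderAt β x₀ (fun x => f x - g x) :=
  (Asymptotics.IsBigO.sub hf hg).congr_left fun x => by ring

theorem const (β : ℝ) (x₀ : Plane) (c : ℝ) : HolderAt β x₀ (fun _ => c) := by
  simp only [HolderAt, sub_self]
  exact Asymptotics.isBigO_zero _ _

theorem isBigO_norm_rpow {γ : ℝ} (h0 : 0 ≤ β) (h : β ≤ γ) (x₀ : Plane) :
    (fun x : Plane => ‖x - x₀‖ ^ γ) =O[𝓝 x₀] fun x => ‖x - x₀‖ ^ β := by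
  refine Asymptotics.IsBigO.of_bound 1 ?_
  filter_upwards [ball_mem_nhds x₀ one_pos] with x hx
  rw [mem_ball_iff_norm] at hx
  rw [one_mul, Real.norm_of_nonneg (by positivity), Real.norm_of_nonneg (by positivity)]
  exact Real.rpow_le_rpow_of_exponent_ge' (norm_nonneg _) hx.le h0 h

theorem mono {γ : ℝ} (hf : HolderAt γ x₀ f) (h0 : 0 ≤ β) (h : β ≤ γ) : HolderAt β x₀ f :=
  Asymptotics.IsBigO.trans hf (isBigO_norm_rpow h0 h x₀)

theorem of_differentiableAt (hf : DifferentiableAt ℝ f x₀) (h0 : 0 ≤ β) (h : β ≤ 1) :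
    HolderAt β x₀ f := by
  have h1 : HolderAt 1 x₀ f := by
    simp only [HolderAt, Real.rpow_one]
    exact hf.isBigO_sub.norm_right
  exact h1.mono h0 h

theorem mul (hf : HolderAt β x₀ f) (hg : HolderAt β x₀ g) (h0 : 0 ≤ β) :
    HolderAt β x₀ (fun x => f x * g x) := by
  have h1 : (fun x => f x - f x₀) =O[𝓝 x₀] fun _ => (1 : ℝ) := by
    refine Asymptotics.IsBigO.trans hf ((isBigO_norm_rpow le_rfl h0 x₀).congr_right fun x => ?_)
    rw [Real.rpow_zero]
  have h2 := (h1.mul hg).congr_right (g₂ := fun x => ‖x - x₀‖ ^ β) fun x => one_mul _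
  refine ((h2.add (Asymptotics.IsBigO.const_mul_left hg (f x₀))).add
    (Asymptotics.IsBigO.const_mul_left hf (g x₀))).congr_left fun x => by ring

theorem exists_bound (hf : HolderAt β x₀ f) :
    ∃ C ρ, 0 < ρ ∧ ∀ x ∈ ball x₀ ρ, |f x - f x₀| ≤ C * ‖x - x₀‖ ^ β := by
  obtain ⟨C, hC⟩ := Asymptotics.IsBigO.bound hf
  obtain ⟨ρ, hρ, h⟩ := Metric.eventually_nhds_iff_ball.1 hC
  refine ⟨C, ρ, hρ, fun x hx => ?_⟩
  have := h x hx
  rwa [Real.norm_of_nonneg (by positivity : 0 ≤ ‖x - x₀‖ ^ β)] at this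

theorem of_ball {C ρ : ℝ} (hρ : 0 < ρ) (h : ∀ x ∈ ball x₀ ρ, |f x - f x₀| ≤ C * ‖x - x₀‖ ^ β) :
    HolderAt β x₀ f := by
  refine Asymptotics.IsBigO.of_bound C ?_
  filter_upwards [ball_mem_nhds x₀ hρ] with x hx
  rw [Real.norm_of_nonneg (by positivity : 0 ≤ ‖x - x₀‖ ^ β)]
  exact h x hx

end HolderAt

theorem CondV.holderAt {V : Plane → ℝ} {Ω α β : ℝ} (hCV : CondV V Ω α) (h0 : 0 ≤ β) (h : β ≤ α)
    (x₀ : Plane) : HolderAt β x₀ V := by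
  obtain ⟨C, hC⟩ := hCV.2.2.2.1 (‖x₀‖ + 1) (by positivity)
  have h1 : HolderAt β x₀ (fun x => V x - Ω ^ 2 / 4 * ‖x‖ ^ 2) := by
    refine (HolderAt.of_ball one_pos fun x hx => hC x ?_ x₀ ?_).mono h0 h
    · rw [mem_closedBall_zero_iff]
      rw [mem_ball_iff_norm] at hx
      linarith [norm_le_insert' x x₀]
    · rw [mem_closedBall_zero_iff]; linarith
  have h2 : HolderAt β x₀ (fun x => Ω ^ 2 / 4 * ‖x‖ ^ 2) :=
    HolderAt.of_differentiableAt ((differentiableAt_id.norm_sq ℝ).const_mul _) h0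
      (h.trans hCV.1.2.le)
  refine (funext fun x => ?_ : (fun x => (V x - Ω ^ 2 / 4 * ‖x‖ ^ 2) + Ω ^ 2 / 4 * ‖x‖ ^ 2) = V) ▸
    h1.add h2
  ring

/-- A differentiable function has bounded gradient on some ball, inside any nonempty open set. -/
theorem exists_ball_fderiv_le {u : Plane → ℂ} (hu : Differentiable ℝ u) {U : Set Plane}
    (hU : IsOpen U) (hne : U.Nonempty) :
    ∃ x₀ ∈ U, ∃ r K, 0 < r ∧ ∀ x ∈ ball x₀ r, ‖fderiv ℝ u x‖ ≤ K := by
  let F : ℕ → Set Plane := fun n =>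
    {x | ∀ h : Plane, ‖h‖ ≤ 1 / ((n : ℝ) + 1) → ‖u (x + h) - u x‖ ≤ n * ‖h‖}
  have hclosed : ∀ n, IsClosed (F n) := by
    intro n
    have : F n = ⋂ h : Plane, ⋂ _ : ‖h‖ ≤ 1 / ((n : ℝ) + 1),
        {x | ‖u (x + h) - u x‖ ≤ n * ‖h‖} := by
      ext x; simp [F]
    rw [this]
    have hc := hu.continuous
    exact isClosed_iInter fun h => isClosed_iInter fun _ =>
      isClosed_le (by fun_prop) continuous_const
  have hunion : ⋃ n, F n = univ := by
    refine eq_univ_of_forall fun x => mem_iUnion.2 ?_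
    have hO := (hu x).isBigO_sub
    obtain ⟨C, hC⟩ := hO.bound
    obtain ⟨ρ, hρ, h⟩ := Metric.eventually_nhds_iff_ball.1 hC
    obtain ⟨n₁, hn₁⟩ := exists_nat_ge C
    obtain ⟨n₂, hn₂⟩ := exists_nat_one_div_lt hρ
    refine ⟨max n₁ n₂, fun y hy => ?_⟩
    have hle : 1 / (((max n₁ n₂ : ℕ) : ℝ) + 1) ≤ 1 / ((n₂ : ℝ) + 1) := by
      gcongr; exact le_max_right _ _
    have h1 := h (x + y) (by
      rw [mem_ball_iff_norm, add_sub_cancel_left]; exact (hy.trans hle).trans_lt hn₂)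
    rw [add_sub_cancel_left] at h1
    refine h1.trans ?_
    gcongr
    exact hn₁.trans (by exact_mod_cast le_max_left _ _)
  obtain ⟨x₀, hxU, hx₀⟩ :=
    (dense_iUnion_interior_of_closed hclosed hunion).inter_open_nonempty U hU hne
  obtain ⟨n, hn⟩ := mem_iUnion.1 hx₀
  obtain ⟨r, hr, hsub⟩ := Metric.isOpen_iff.1 isOpen_interior x₀ hn
  refine ⟨x₀, hxU, r, n, hr, fun x hx => ?_⟩
  have hF : x ∈ F n := interior_subset (hsub hx)
  refine (hu x).hasFDerivAt.le_of_lip' (by positivity) ?_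
  filter_upwards [ball_mem_nhds x (ε := 1 / ((n : ℝ) + 1)) (by positivity)] with y hy
  have := hF (y - x) (mem_ball_iff_norm.1 hy).le
  rwa [add_sub_cancel] at this

section

variable {V : Plane → ℝ} {Ω a : ℝ} {u : Plane → ℂ}

/-- The source in the equation for the real part of a minimizer. -/
def sourceRe (V : Plane → ℝ) (Ω a : ℝ) (u : Plane → ℂ) (x : Plane) : ℝ :=
  coeffEL V Ω a u x * (u x).re - Ω * rotIm u x

theorem continuous_logPot {g : Plane → ℝ} (hg : LogDens g) : Continuous (logPot g) := by
  obtain ⟨C, hC⟩ := logPot_holder hg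
  refine continuous_iff_continuousAt.2 fun x => tendsto_iff_dist_tendsto_zero.2 ?_
  have h1 : Continuous fun y : Plane => C * √‖y - x‖ := by fun_prop
  have h2 := h1.tendsto x
  simp only [sub_self, norm_zero, Real.sqrt_zero, mul_zero] at h2
  exact squeeze_zero (fun _ => dist_nonneg) (fun y => hC y x) h2

theorem norm_d0_le (u : Plane → ℂ) (x : Plane) : ‖d0 u x‖ ≤ ‖fderiv ℝ u x‖ := by
  simpa [norm_e0, d0] using (fderiv ℝ u x).le_opNorm e0

theorem norm_d1_le (u : Plane → ℂ) (x : Plane) : ‖d1 u x‖ ≤ ‖fderiv ℝ u x‖ := by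
  simpa [norm_e1, d1] using (fderiv ℝ u x).le_opNorm e1

theorem IsMinimizer.exists_weakLap (hV : V110 V) (ha : 0 < a) (hu : IsMinimizer V Ω a u)
    (h4 : Integrable (fun x => ‖u x‖ ^ 4)) {x₀ : Plane} {r K : ℝ} (hr : 0 < r)
    (hK : ∀ x ∈ ball x₀ r, ‖fderiv ℝ u x‖ ≤ K) :
    ∃ M, WeakLap (fun x => (u x).re) (sourceRe V Ω a u) x₀ r M := by
  have hd := hu.1.1.1.1
  have hρ := hu.1.1.logDens hV h4
  have hL := continuous_logPot hρ
  obtain ⟨CV, hCV⟩ := hV.2.2.1 (‖x₀‖ + r)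
  have hcont : Continuous fun x => (logPot (fun y => ‖u y‖ ^ 2) x - ‖u x‖ ^ 2 - lagr V Ω a u) := by
    have := hd.continuous
    fun_prop
  obtain ⟨B, hB⟩ := (isCompact_closedBall x₀ r).exists_bound_of_continuousOn hcont.continuousOn
  obtain ⟨N, hN⟩ := (isCompact_closedBall x₀ r).exists_bound_of_continuousOn
    hd.continuous.continuousOn
  have hx0 : x₀ ∈ closedBall x₀ r := mem_closedBall_self hr.le
  have hB0 := (norm_nonneg _).trans (hB x₀ hx0)
  have hN0 := (norm_nonneg _).trans (hN x₀ hx0)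
  have hK0 := (norm_nonneg _).trans (hK x₀ (mem_ball_self hr))
  have hC0 : 0 ≤ CV := (hV.2.1 x₀).trans (hCV x₀ (by linarith))
  set R := ‖x₀‖ + r with hR
  have hR0 : 0 ≤ R := by positivity
  have hre : ∀ x, ‖fderiv ℝ (fun y => (u y).re) x‖ ≤ ‖fderiv ℝ u x‖ := by
    intro x
    have h : fderiv ℝ (fun y => (u y).re) x = Complex.reCLM.comp (fderiv ℝ u x) :=
      (Complex.reCLM.hasFDerivAt.comp x (hd x).hasFDerivAt).fderiv
    rw [h]
    refine (ContinuousLinearMap.opNorm_comp_le _ _).trans ?_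
    rw [Complex.reCLM_norm, one_mul]
  have m0 := (measurable_d0 u)
  have m1 := (measurable_d1 u)
  refine ⟨K + ((CV + B) * N + |Ω| * (R * K + R * K)), fun x => ?_, ?_, fun x hx => ?_,
    fun x hx => ?_, fun ψ hψ _ => ?_⟩
  · exact (Complex.reCLM.hasFDerivAt.comp x (hd x).hasFDerivAt).differentiableAt
  · have mV := hV.1
    have mu := hd.continuous.measurable
    have mL := hL.measurable
    unfold sourceRe coeffEL rotIm
    fun_prop
  · have : 0 ≤ ((CV + B) * N + |Ω| * (R * K + R * K)) := by positivity
    linarith [hre x, hK x hx]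
  · have hx' := ball_subset_closedBall hx
    have hxR : ‖x‖ ≤ R := by
      rw [mem_ball_iff_norm] at hx
      linarith [norm_le_insert' x x₀]
    have b1 : |coeffEL V Ω a u x| ≤ CV + B := by
      have h1 := hB x hx'
      have h2 := hCV x hxR
      have h3 := hV.2.1 x
      rw [Real.norm_eq_abs, abs_le] at h1
      rw [coeffEL, abs_le]
      constructor <;> linarith [h1.1, h1.2]
    have b2 : |(u x).re| ≤ N := (Complex.abs_re_le_norm _).trans (hN x hx')
    have b3 : |(d0 u x).im| ≤ K := (Complex.abs_im_le_norm _).trans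
      ((norm_d0_le u x).trans (hK x hx))
    have b4 : |(d1 u x).im| ≤ K := (Complex.abs_im_le_norm _).trans
      ((norm_d1_le u x).trans (hK x hx))
    have b5 := (abs_coord_le x 0).trans hxR
    have b6 := (abs_coord_le x 1).trans hxR
    have b7 : |rotIm u x| ≤ R * K + R * K := by
      refine (abs_add_le _ _).trans ?_
      rw [abs_mul, abs_mul, abs_neg]
      gcongr
    refine (abs_sub _ _).trans ?_
    rw [abs_mul, abs_mul]
    have : |coeffEL V Ω a u x| * |(u x).re| ≤ (CV + B) * N := by gcongr
    have : |Ω| * |rotIm u x| ≤ |Ω| * (R * K + R * K) := by gcongr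
    linarith
  · rw [← hu.weak_re hV ha h4 hψ]
    refine integral_congr_ae (Eventually.of_forall fun x => ?_)
    simp only [gradCross, sourceRe, d0R_re (hd x), d1R_re (hd x)]

theorem IsMinimizer.holderAt_re (hV : V110 V) (ha : 0 < a) (hu : IsMinimizer V Ω a u)
    (h4 : Integrable (fun x => ‖u x‖ ^ 4)) {x₀ : Plane} {r K : ℝ} (hr : 0 < r)
    (hK : ∀ x ∈ ball x₀ r, ‖fderiv ℝ u x‖ ≤ K) :
    HolderAt (1 / 2) x₀ (fun x => (d0 u x).re) ∧ HolderAt (1 / 2) x₀ (fun x => (d1 u x).re) := by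
  obtain ⟨M, hM⟩ := hu.exists_weakLap hV ha h4 hr hK
  have hd := hu.1.1.1.1
  obtain ⟨C, -, hC⟩ := hM.fderiv_holder hr
  refine ⟨HolderAt.of_ball (C := C) (by linarith : 0 < r / 4) fun x hx => ?_,
    HolderAt.of_ball (C := C) (by linarith : 0 < r / 4) fun x hx => ?_⟩
  · rw [← d0R_re (hd x), ← d0R_re (hd x₀), ← Real.sqrt_eq_rpow]
    exact (hC x hx).1
  · rw [← d1R_re (hd x), ← d1R_re (hd x₀), ← Real.sqrt_eq_rpow]
    exact (hC x hx).2

end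

section

variable {V : Plane → ℝ} {Ω a α : ℝ} {u : Plane → ℂ} {x₀ : Plane} {r K : ℝ}

theorem integrable_norm_neg_I_mul {n : ℕ} (h : Integrable (fun x => ‖u x‖ ^ n)) :
    Integrable (fun x => ‖-Complex.I * u x‖ ^ n) := by
  simpa using h

theorem norm_fderiv_neg_I_mul_le (hu : Differentiable ℝ u) (x : Plane) :
    ‖fderiv ℝ (fun y => -Complex.I * u y) x‖ ≤ ‖fderiv ℝ u x‖ := by
  rw [fderiv_const_mul (hu x), norm_smul]
  simp

theorem IsMinimizer.holderAt_im (hV : V110 V) (ha : 0 < a) (hu : IsMinimizer V Ω a u)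
    (h4 : Integrable (fun x => ‖u x‖ ^ 4)) (hr : 0 < r)
    (hK : ∀ x ∈ ball x₀ r, ‖fderiv ℝ u x‖ ≤ K) :
    HolderAt (1 / 2) x₀ (fun x => (d0 u x).im) ∧ HolderAt (1 / 2) x₀ (fun x => (d1 u x).im) := by
  have hd := hu.1.1.1.1
  have h := (hu.const_mul hV (c := -Complex.I) (by simp)).holderAt_re hV ha
    (integrable_norm_neg_I_mul h4) hr
    (fun x hx => (norm_fderiv_neg_I_mul_le hd x).trans (hK x hx))
  simp only [d0_const_mul hd, d1_const_mul hd] at h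
  simpa using h

theorem IsMinimizer.lapR_re (hV : V110 V) (hCV : CondV V Ω α) (ha : 0 < a)
    (hu : IsMinimizer V Ω a u) (h4 : Integrable (fun x => ‖u x‖ ^ 4)) (hr : 0 < r)
    (hK : ∀ x ∈ ball x₀ r, ‖fderiv ℝ u x‖ ≤ K) :
    DifferentiableAt ℝ (fun x => (d0 u x).re) x₀ ∧ DifferentiableAt ℝ (fun x => (d1 u x).re) x₀ ∧
      d0R (fun x => (d0 u x).re) x₀ + d1R (fun x => (d1 u x).re) x₀ = sourceRe V Ω a u x₀ := by
  obtain ⟨M, hM⟩ := hu.exists_weakLap hV ha h4 hr hK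
  have hd := hu.1.1.1.1
  set β := min α (1 / 2) with hβ
  have hβ0 : 0 < β := lt_min hCV.1.1 (by norm_num)
  have hβα : β ≤ α := min_le_left _ _
  have hβ2 : β ≤ 1 / 2 := min_le_right _ _
  have hβ1 : β ≤ 1 := by linarith
  have g0 := (hu.holderAt_im hV ha h4 hr hK).1.mono hβ0.le hβ2
  have g1 := (hu.holderAt_im hV ha h4 hr hK).2.mono hβ0.le hβ2
  have hLog : HolderAt β x₀ (logPot (fun y => ‖u y‖ ^ 2)) := by
    obtain ⟨C, hC⟩ := logPot_holder (hu.1.1.logDens hV h4)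
    refine (HolderAt.of_ball (C := C) (β := 1 / 2) one_pos fun x _ => ?_).mono hβ0.le hβ2
    rw [← Real.sqrt_eq_rpow]
    exact hC x x₀
  have hsrc : HolderAt β x₀ (sourceRe V Ω a u) := by
    have hre : DifferentiableAt ℝ (fun x => (u x).re) x₀ :=
      (Complex.reCLM.hasFDerivAt.comp x₀ (hd x₀).hasFDerivAt).differentiableAt
    have hc : ∀ i : Fin 2, DifferentiableAt ℝ (fun x : Plane => x i) x₀ := fun i =>
      (EuclideanSpace.proj i : Plane →L[ℝ] ℝ).differentiableAt
    have k1 := (((hCV.holderAt hβ0.le hβα x₀).add hLog).sub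
      (HolderAt.of_differentiableAt ((hd x₀).norm_sq ℝ) hβ0.le hβ1)).sub
      (HolderAt.const β x₀ (lagr V Ω a u))
    have k2 := ((HolderAt.of_differentiableAt (hc 1).neg hβ0.le hβ1).mul g0 hβ0.le).add
      ((HolderAt.of_differentiableAt (hc 0) hβ0.le hβ1).mul g1 hβ0.le)
    exact (k1.mul (HolderAt.of_differentiableAt hre hβ0.le hβ1) hβ0.le).sub
      ((HolderAt.const β x₀ Ω).mul k2 hβ0.le)
  obtain ⟨C, ρ, hρ, hC⟩ := hsrc.exists_bound
  have h := hM.lapR_eq hr hβ0 hβ1 hρ hC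
  have f0 : d0R (fun x => (u x).re) = fun x => (d0 u x).re := funext fun x => d0R_re (hd x)
  have f1 : d1R (fun x => (u x).re) = fun x => (d1 u x).re := funext fun x => d1R_re (hd x)
  rw [lapR, f0, f1] at h
  exact h

theorem lagr_neg_I_mul (hV : V110 V) (hu : IsMinimizer V Ω a u) :
    lagr V Ω a (fun y => -Complex.I * u y) = lagr V Ω a u := by
  have hmin := hu.const_mul hV (c := -Complex.I) (by simp)
  have h : Ea V Ω (fun y => -Complex.I * u y) = Ea V Ω u :=
    le_antisymm (hmin.2 _ hu.1) (hu.2 _ hmin.1)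
  rw [lagr, lagr, h]
  simp

theorem IsMinimizer.lapR_im (hV : V110 V) (hCV : CondV V Ω α) (ha : 0 < a)
    (hu : IsMinimizer V Ω a u) (h4 : Integrable (fun x => ‖u x‖ ^ 4)) (hr : 0 < r)
    (hK : ∀ x ∈ ball x₀ r, ‖fderiv ℝ u x‖ ≤ K) :
    DifferentiableAt ℝ (fun x => (d0 u x).im) x₀ ∧ DifferentiableAt ℝ (fun x => (d1 u x).im) x₀ ∧
      d0R (fun x => (d0 u x).im) x₀ + d1R (fun x => (d1 u x).im) x₀ =
        coeffEL V Ω a u x₀ * (u x₀).im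
          + Ω * (-(x₀ 1) * (d0 u x₀).re + x₀ 0 * (d1 u x₀).re) := by
  have hd := hu.1.1.1.1
  have h := (hu.const_mul hV (c := -Complex.I) (by simp)).lapR_re hV hCV ha
    (integrable_norm_neg_I_mul h4) hr
    (fun x hx => (norm_fderiv_neg_I_mul_le hd x).trans (hK x hx))
  simp only [d0_const_mul hd, d1_const_mul hd, sourceRe, coeffEL, rotIm,
    lagr_neg_I_mul hV hu] at h
  simp only [neg_mul, Complex.neg_re, Complex.neg_im, Complex.mul_re, Complex.mul_im,
    Complex.I_re, Complex.I_im, norm_neg, norm_mul, Complex.norm_I, one_mul, zero_mul, zero_sub,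
    neg_neg, zero_add] at h
  refine ⟨h.1, h.2.1, h.2.2.trans ?_⟩
  rw [coeffEL]
  ring

/-- The multiplier in the Euler–Lagrange equation is the one given by homogeneity. -/
theorem IsMinimizer.multiplier_eq (hV : V110 V) (hCV : CondV V Ω α) (ha : 0 < a)
    (hu : IsMinimizer V Ω a u) (h4 : Integrable (fun x => ‖u x‖ ^ 4)) {μ : ℝ}
    (hEL : EulerLagrange V Ω u μ) : μ = lagr V Ω a u := by
  have hd := hu.1.1.1.1
  have hne : {x | u x ≠ 0}.Nonempty := by
    by_contra hcon
    rw [not_nonempty_iff_eq_empty] at hcon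
    have h0 : ∀ x, u x = 0 := fun x => by
      by_contra hx
      exact (hcon ▸ hx : x ∈ (∅ : Set Plane))
    have := hu.1.2
    simp [h0] at this
    exact ha.ne this
  obtain ⟨x₀, hx₀, r, K, hr, hK⟩ :=
    exists_ball_fderiv_le hd (isOpen_ne_fun hd.continuous continuous_const) hne
  obtain ⟨a0, a1, ha2⟩ := hu.lapR_re hV hCV ha h4 hr hK
  obtain ⟨b0, b1, hb2⟩ := hu.lapR_im hV hCV ha h4 hr hK
  have mk : ∀ {f : Plane → ℂ}, DifferentiableAt ℝ (fun x => (f x).re) x₀ →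
      DifferentiableAt ℝ (fun x => (f x).im) x₀ → DifferentiableAt ℝ f x₀ := by
    intro f h1 h2
    have h3 := (Complex.ofRealCLM.differentiableAt.comp x₀ h1).add
      ((Complex.ofRealCLM.differentiableAt.comp x₀ h2).mul_const Complex.I)
    refine h3.congr_of_eventuallyEq (Eventually.of_forall fun x => ?_)
    simp [Complex.re_add_im]
  have c0 := mk a0 b0
  have c1 := mk a1 b1
  rw [d0R_re c0, d1R_re c1] at ha2
  rw [d0R_im c0, d1R_im c1] at hb2
  have key := hEL x₀
  have hl : lapC u x₀ = d0 (d0 u) x₀ + d1 (d1 u) x₀ := rfl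
  have hp : (∫ y : Plane, Real.log ‖x₀ - y‖ * ‖u y‖ ^ 2) = logPot (fun y => ‖u y‖ ^ 2) x₀ := rfl
  rw [hl, hp] at key
  have kre := congrArg Complex.re key
  have kim := congrArg Complex.im key
  simp only [Complex.add_re, Complex.neg_re, Complex.mul_re, Complex.ofReal_re, Complex.ofReal_im,
    Complex.I_re, Complex.I_im, Complex.mul_im, Complex.add_im, Complex.neg_im] at kre kim
  rw [sourceRe, coeffEL, rotIm] at ha2
  rw [coeffEL] at hb2
  have r1 : (μ - lagr V Ω a u) * (u x₀).re = 0 := by linear_combination -kre - ha2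
  have r2 : (μ - lagr V Ω a u) * (u x₀).im = 0 := by linear_combination -kim - hb2
  by_contra hcon
  have hs : μ - lagr V Ω a u ≠ 0 := sub_ne_zero.2 hcon
  exact hx₀ (Complex.ext ((mul_eq_zero.1 r1).resolve_left hs)
    ((mul_eq_zero.1 r2).resolve_left hs))

end

theorem tendsto_sqrt_div_atTop : Tendsto (fun x : ℝ => √(2 * x + 1) / x) atTop (𝓝 0) := by
  have h1 : Tendsto (fun x : ℝ => 2 / √x) atTop (𝓝 0) :=
    Real.tendsto_sqrt_atTop.const_div_atTop 2
  refine squeeze_zero' ?_ ?_ h1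
  · filter_upwards [eventually_ge_atTop 0] with x hx
    positivity
  · filter_upwards [eventually_ge_atTop 1] with x hx
    have hx0 : 0 < x := by linarith
    have hs : 0 < √x := Real.sqrt_pos.2 hx0
    rw [div_le_div_iff₀ hx0 hs, ← Real.sqrt_mul (by linarith)]
    calc √((2 * x + 1) * x) ≤ √((2 * x) ^ 2) := Real.sqrt_le_sqrt (by nlinarith)
      _ = 2 * x := Real.sqrt_sq (by linarith)

/-- The asymptotics of kinetic energy and multiplier, from the basic energy inequalities. -/
theorem tendsto_of_energy_bounds {A C : ℝ} (hA : 0 < A) (hC : 0 ≤ C) {D P W E : ℝ → ℝ}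
    (hD : ∀ a ∈ Ioo 0 A, 0 ≤ D a)
    (hPD : ∀ a ∈ Ioo 0 A, A * P a ≤ 2 * a * D a)
    (hE : ∀ a ∈ Ioo 0 A, D a - P a / 2 + W a / 2 ≤ E a)
    (hW : ∀ a ∈ Ioo 0 A, -(C * √(P a + 1)) ≤ W a) (hbot : Tendsto E (𝓝[<] A) atBot) :
    Tendsto D (𝓝[<] A) atTop ∧
      Tendsto (fun a => (E a + (W a / 2 - P a / 2)) / a * (D a)⁻¹) (𝓝[<] A) (𝓝 (-1 / A)) := by
  have hev : ∀ᶠ a in 𝓝[<] A, a ∈ Ioo 0 A := Ioo_mem_nhdsLT hA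
  have hP2 : ∀ a ∈ Ioo 0 A, P a ≤ 2 * D a := fun a ha => by
    have h1 := hPD a ha
    have h2 : a * D a ≤ A * D a := mul_le_mul_of_nonneg_right ha.2.le (hD a ha)
    exact le_of_mul_le_mul_left (by linarith) hA
  have hW2 : ∀ a ∈ Ioo 0 A, -(C * √(2 * D a + 1)) ≤ W a := fun a ha => by
    refine le_trans (neg_le_neg ?_) (hW a ha)
    have := hP2 a ha
    gcongr
  have hE2 : ∀ a ∈ Ioo 0 A, -(C * √(2 * D a + 1)) ≤ E a := fun a ha => by
    have h1 := hE a ha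
    have h2 := hP2 a ha
    have h3 := hW2 a ha
    have h4 : 0 ≤ C * √(2 * D a + 1) := by positivity
    linarith
  have hDtop : Tendsto D (𝓝[<] A) atTop := by
    refine tendsto_atTop.2 fun b => ?_
    filter_upwards [hev, hbot.eventually_lt_atBot (-(C * √(2 * b + 1)))] with a ha hb
    by_contra! hcon
    have h1 := hE2 a ha
    have h2 : C * √(2 * D a + 1) ≤ C * √(2 * b + 1) := by gcongr
    linarith
  refine ⟨hDtop, ?_⟩
  have hDpos : ∀ᶠ a in 𝓝[<] A, 0 < D a := hDtop.eventually_gt_atTop 0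
  have hEneg : ∀ᶠ a in 𝓝[<] A, E a < 0 := hbot.eventually_lt_atBot 0
  have hs : Tendsto (fun a => C * (√(2 * D a + 1) / D a)) (𝓝[<] A) (𝓝 0) := by
    simpa using (tendsto_sqrt_div_atTop.comp hDtop).const_mul C
  have hs' : Tendsto (fun a => -(C * (√(2 * D a + 1) / D a))) (𝓝[<] A) (𝓝 0) := by
    simpa using hs.neg
  have tE : Tendsto (fun a => E a / D a) (𝓝[<] A) (𝓝 0) := by
    refine tendsto_of_tendsto_of_tendsto_of_le_of_le' hs' tendsto_const_nhds ?_ ?_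
    · filter_upwards [hev, hDpos] with a ha hd
      rw [← mul_div_assoc, ← neg_div]
      gcongr
      exact hE2 a ha
    · filter_upwards [hEneg, hDpos] with a he hd
      exact div_nonpos_of_nonpos_of_nonneg he.le hd.le
  have tW : Tendsto (fun a => W a / D a) (𝓝[<] A) (𝓝 0) := by
    refine tendsto_of_tendsto_of_tendsto_of_le_of_le' hs' tendsto_const_nhds ?_ ?_
    · filter_upwards [hev, hDpos] with a ha hd
      rw [← mul_div_assoc, ← neg_div]
      gcongr
      exact hW2 a ha
    · filter_upwards [hev, hEneg, hDpos] with a ha he hd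
      refine div_nonpos_of_nonpos_of_nonneg ?_ hd.le
      linarith [hE a ha, hP2 a ha]
  have tP : Tendsto (fun a => P a / D a) (𝓝[<] A) (𝓝 2) := by
    have h2 : Tendsto (fun a => 2 - C * (√(2 * D a + 1) / D a)) (𝓝[<] A) (𝓝 2) := by
      simpa using hs.const_sub 2
    refine tendsto_of_tendsto_of_tendsto_of_le_of_le' h2 tendsto_const_nhds ?_ ?_
    · filter_upwards [hev, hEneg, hDpos] with a ha he hd
      rw [le_div_iff₀ hd, sub_mul, mul_assoc, div_mul_cancel₀ _ hd.ne']
      linarith [hE a ha, hW2 a ha]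
    · filter_upwards [hev, hDpos] with a ha hd
      rw [div_le_iff₀ hd]
      exact hP2 a ha
  have ta : Tendsto (fun a : ℝ => a) (𝓝[<] A) (𝓝 A) := tendsto_id.mono_left nhdsWithin_le_nhds
  have := ((tE.add ((tW.div_const 2).sub (tP.div_const 2))).div ta hA.ne')
  have e : (0 + (0 / 2 - 2 / 2)) / A = -1 / A := by norm_num
  rw [e] at this
  refine this.congr fun a => ?_
  simp only [Pi.div_apply]
  ring

section

variable {V : Plane → ℝ} {Ω a α : ℝ} {u : Plane → ℂ}

theorem integrable_gradAbsSq (hu : InH1 u) : Integrable (gradAbsSq u) :=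
  hu.2.2.mono' (measurable_gradAbsSq u).aestronglyMeasurable (Eventually.of_forall fun x => by
    rw [Real.norm_of_nonneg (gradAbsSq_nonneg u x)]
    exact gradAbsSq_le_gradSq (hu.1 x))

theorem interForm_norm_sq (u : Plane → ℂ) :
    interForm (fun x => ‖u x‖ ^ 2) (fun x => ‖u x‖ ^ 2) =
      logConv u / 2 - (∫ x, ‖u x‖ ^ 4) / 2 := by
  have h (x : Plane) : ‖u x‖ ^ 4 = ‖u x‖ ^ 2 * ‖u x‖ ^ 2 := by ring
  simp only [interForm, h]
  change 1 / 2 * logForm _ _ - _ = logForm _ _ / 2 - _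
  ring

theorem InH.Ea_ge (hV : V110 V) (hCV : CondV V Ω α) (hu : InH V u) :
    (∫ x, gradAbsSq u x) - (∫ x, ‖u x‖ ^ 4) / 2 + logConv u / 2 ≤ Ea V Ω u := by
  have h1 : ∫ x, gradAbsSq u x ≤ ∫ x, kinDens V Ω u x := by
    refine integral_mono (integrable_gradAbsSq hu.1) (hu.integrable_kinDens hV Ω) fun x => ?_
    refine (diamagnetic (hu.1.1 x) Ω).trans ?_
    have h2 := mul_nonneg (hCV.2.1 x) (sq_nonneg ‖u x‖)
    simp only [kinDens]
    linarith
  rw [Ea_eq_kinDens hV hu Ω, interForm_norm_sq]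
  linarith

end

theorem InH.logConv_ge {V : Plane → ℝ} (hV : V110 V) {u : Plane → ℂ} (hu : InH V u)
    (h4 : Integrable (fun x => ‖u x‖ ^ 4)) {A : ℝ} (hA : ∫ x, ‖u x‖ ^ 2 ≤ A) :
    -(A / 2 * ((∫ z, logSing z ^ 2) + 1) * √((∫ x, ‖u x‖ ^ 4) + 1)) ≤ logConv u := by
  set P := ∫ x, ‖u x‖ ^ 4
  set L := ∫ z, logSing z ^ 2
  have hP : 0 ≤ P := integral_nonneg fun x => by positivity
  have hL : 0 ≤ L := integral_nonneg fun x => sq_nonneg _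
  have hs : 0 < √(P + 1) := Real.sqrt_pos.2 (by linarith)
  refine le_trans (neg_le_neg ?_)
    (logForm_self_lower (hu.logDens hV h4) (fun x => sq_nonneg _) hs)
  have h (x : Plane) : (‖u x‖ ^ 2) ^ 2 = ‖u x‖ ^ 4 := by ring
  simp only [h]
  have h1 : (√(P + 1))⁻¹ * P ≤ √(P + 1) := by
    rw [inv_mul_le_iff₀ hs, Real.mul_self_sqrt (by linarith)]
    linarith
  have h2 : 0 ≤ (√(P + 1))⁻¹ * P := by positivity
  have hA0 : 0 ≤ A := (integral_nonneg fun x => sq_nonneg _).trans hA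
  calc (∫ x, ‖u x‖ ^ 2) * (1 / 2 * (√(P + 1) * L + (√(P + 1))⁻¹ * P))
      ≤ A * (1 / 2 * (√(P + 1) * L + √(P + 1))) := by gcongr
    _ = A / 2 * (L + 1) * √(P + 1) := by ring

theorem epsOf_sq (u : ℝ → Plane → ℂ) (a : ℝ) :
    epsOf u a ^ 2 = (∫ x, gradAbsSq (u a) x)⁻¹ := by
  rw [epsOf, ← Real.rpow_mul_natCast (integral_nonneg fun x => gradAbsSq_nonneg _ x),
    ← Real.rpow_neg_one]
  norm_num

theorem eps_and_multiplier_limits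
    (V : Plane → ℝ) (Ω α : ℝ) (Q : Plane → ℝ)
    (hV : V110 V) (hΩ : 0 < Ω) (hsub : SubCritical V Ω) (hCV : CondV V Ω α)
    (hQ : IsGroundState Q)
    (astar : ℝ) (hastar : astar = ∫ x : Plane, (Q x) ^ 2)
    (u : ℝ → Plane → ℂ)
    (hmin : ∀ a ∈ Ioo (0 : ℝ) astar, IsMinimizer V Ω a (u a))
    (μ : ℝ → ℝ) (hEL : ∀ a ∈ Ioo (0 : ℝ) astar, EulerLagrange V Ω (u a) (μ a)) :
    Tendsto (fun a => epsOf u a) (𝓝[<] astar) (𝓝 0) ∧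
    Tendsto (fun a => μ a * (epsOf u a) ^ 2) (𝓝[<] astar) (𝓝 (-1 / astar)) := by
  have hA : 0 < astar := hastar ▸ hQ.astar_pos
  have hlow : ∀ a ∈ Ioo 0 astar, ∃ L, ∀ v ∈ Sset V a, L ≤ Ea V Ω v := fun a ha =>
    ⟨_, (hmin a ha).2⟩
  have hGN (a : ℝ) (ha : a ∈ Ioo 0 astar) := gagliardo_abs hV hA hlow (hmin a ha).1.1.1
  have hbot : Tendsto (fun a => Ea V Ω (u a)) (𝓝[<] astar) atBot := by
    refine tendsto_atBot.2 fun M => ?_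
    have hM := hQ.exists_energy_le hV hCV (Ω := Ω) M
    rw [← hastar] at hM
    filter_upwards [Ioo_mem_nhdsLT hA, hM] with a ha ⟨v, hv, hvM⟩
    exact ((hmin a ha).2 v hv).trans hvM
  have hL : 0 ≤ ∫ z, logSing z ^ 2 := integral_nonneg fun x => sq_nonneg _
  obtain ⟨hD, hlim⟩ := tendsto_of_energy_bounds hA
    (C := astar / 2 * ((∫ z, logSing z ^ 2) + 1)) (by positivity)
    (D := fun a => ∫ x, gradAbsSq (u a) x) (P := fun a => ∫ x, ‖u a x‖ ^ 4)
    (W := fun a => logConv (u a))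
    (fun a _ => integral_nonneg fun x => gradAbsSq_nonneg _ x)
    (fun a ha => (hGN a ha).2.trans_eq (by rw [(hmin a ha).1.2]))
    (fun a ha => (hmin a ha).1.1.Ea_ge hV hCV)
    (fun a ha => (hmin a ha).1.1.logConv_ge hV (hGN a ha).1 ((hmin a ha).1.2.le.trans ha.2.le))
    hbot
  refine ⟨?_, hlim.congr' ?_⟩
  · have h := (tendsto_rpow_neg_atTop (y := 1 / 2) (by norm_num)).comp hD
    simpa only [Function.comp_def, epsOf, neg_div] using h
  · filter_upwards [Ioo_mem_nhdsLT hA] with a ha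
    rw [(hmin a ha).multiplier_eq hV hCV ha.1 (hGN a ha).1 (hEL a ha), lagr, interForm_norm_sq,
      epsOf_sq]

end
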